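/- For every α ∈ (0, 1/2] there exist a function A : [0,∞) → (0,∞) continuous, strictly increasing and regularly varying with index α, and a Borel probability measure F on ℝ satisfying the two-sided tail assumption (T2) with p = q = 1, such that: condition (★) holds (with r(x) := x·F((x−h,x])/F((x,∞))), but the condition lim_{η→0⁺} limsup_{x→∞} (1/A(x)²) ∫_1^{ηx} (A(s)²/s)·( r(x−s) + r(x+s) ) ds = 0 fails; in particular the strong renewal theorem fails for F. -/

import Mathlib

open MeasureTheory ProbabilityTheory Filter Set Asymptotics Topology

/-- `t > 0` is an arithmetic support span of `F` (i.e. `F` is supported on `t·ℤ`). -/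
def IsArithSpan (F : MeasureTheory.Measure ℝ) (t : ℝ) : Prop :=
  0 < t ∧ F ({x : ℝ | ∃ k : ℤ, x = t * k}ᶜ) = 0

/-- The ratio `r(x) = x · F((x−h, x]) / F((x, ∞))`. -/
noncomputable def rr (F : MeasureTheory.Measure ℝ) (h x : ℝ) : ℝ :=
  x * (F (Set.Ioc (x - h) x)).toReal / (F (Set.Ioi x)).toReal

/-- Condition (★): `lim_{η→0⁺} limsup_{x→∞} (1/A(x)²) ∫_1^{ηx} (A(s)²/s)·r(x−s) ds = 0`. -/
def CondStar (F : MeasureTheory.Measure ℝ) (A : ℝ → ℝ) (h : ℝ) : Prop :=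
  Filter.Tendsto (fun η : ℝ =>
      Filter.limsup (fun x : ℝ =>
        1 / (A x) ^ 2 * ∫ s in (1:ℝ)..(η * x), (A s) ^ 2 / s * rr F h (x - s))
        Filter.atTop)
    (nhdsWithin 0 (Set.Ioi 0)) (nhds 0)

/-- `convPow F n` is the law of `S_n = X_1 + ⋯ + X_n` for `X_i` i.i.d. with law `F`. -/
noncomputable def convPow (F : MeasureTheory.Measure ℝ) : ℕ → MeasureTheory.Measure ℝ
  | 0 => MeasureTheory.Measure.dirac 0
  | n + 1 => MeasureTheory.Measure.map (fun p : ℝ × ℝ => p.1 + p.2)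
      ((convPow F n).prod F)

/-- Collected analytic facts about the normalising function `A` and the bump profile `w`. -/
structure GoodA (α : ℝ) (A : ℝ → ℝ) (w : ℕ → ℝ) (c C a : ℝ) : Prop where
  c_pos : 0 < c
  c_le : c ≤ 1 / 2
  C_ge : 1 ≤ C
  a_pos : 0 < a
  four : ∀ x : ℝ, 0 ≤ x → 4 ≤ A x
  cont : ContinuousOn A (Set.Ici 0)
  smono : StrictMonoOn A (Set.Ici 0)
  rv : ∀ l : ℝ, 0 < l → Tendsto (fun x : ℝ => A (l * x) / A x) atTop (nhds (l ^ α))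
  kanti : ∀ x y : ℝ, 0 < x → x ≤ y → A y ^ 2 * x ≤ A x ^ 2 * y
  step_up : ∀ z : ℕ, A (z + 1) * (z + 1) ≤ A z * (z + 2)
  step_lo : ∀ z : ℕ, A z * (z + 1) ≤ A (z + 1) * (z + 1 - c)
  dbl : ∀ q : ℝ, 1 ≤ q → (1 + c) * A q ≤ A (2 * q)
  small : ∀ s x : ℝ, 1 ≤ s → s ≤ x → A s ≤ C * (s / x) ^ a * A x
  kzero : Tendsto (fun x : ℝ => A x ^ 2 / x) atTop (nhds 0)
  atop : Tendsto A atTop atTop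
  sqb : ∀ j t : ℕ, j < t → A t ≤ C * Real.sqrt (t / (j + 1)) * A j
  w_pos : ∀ s, 0 < w s
  w_anti : Antitone w
  w_half : ∀ i Y : ℕ, Y ≤ 2 * i → w i ≤ 2 * w Y
  w_A : ∀ Y : ℕ, A Y ^ 2 * w Y ≤ C
  w_K : ∀ Y : ℕ, 1 ≤ Y → A Y ^ 2 / Y * ∑ s ∈ Finset.Icc 1 Y, w s ≤ C
  w_div : ¬ Summable (fun s : ℕ => A s ^ 2 / s * w s)

noncomputable def AA (α : ℝ) (x : ℝ) : ℝ :=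
  4 * Real.sqrt (1 / α) * ((x + Real.exp (1 / α)) ^ α / Real.sqrt (Real.log (x + Real.exp (1 / α))))

lemma bb_ge {α : ℝ} (h0 : 0 < α) (h1 : α ≤ 1 / 2) : 3 ≤ Real.exp (1 / α) := by
  have : 2 ≤ 1 / α := by rw [le_div_iff₀ h0]; linarith
  have := Real.add_one_le_exp (1/α)
  linarith

lemma logt_ge {α : ℝ} (_h0 : 0 < α) (_h1 : α ≤ 1 / 2) {x : ℝ} (hx : 0 ≤ x) : 1 / α ≤ Real.log (x + Real.exp (1 / α)) := by
  rw [Real.le_log_iff_exp_le (by positivity)]; linarith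

lemma logt_ge2 {α : ℝ} (h0 : 0 < α) (h1 : α ≤ 1 / 2) {x : ℝ} (hx : 0 ≤ x) : 2 ≤ Real.log (x + Real.exp (1 / α)) := by
  have : 2 ≤ 1 / α := by rw [le_div_iff₀ h0]; linarith
  exact this.trans (logt_ge h0 h1 hx)

lemma AA_pos {α : ℝ} (h0 : 0 < α) (h1 : α ≤ 1 / 2) {x : ℝ} (hx : 0 ≤ x) : 0 < AA α x := by
  have := logt_ge2 h0 h1 hx
  unfold AA
  have : 0 < x + Real.exp (1/α) := by positivity
  have : 0 < Real.log (x + Real.exp (1 / α)) := by linarith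
  positivity

lemma AA_sq {α : ℝ} (h0 : 0 < α) (h1 : α ≤ 1 / 2) {x : ℝ} (hx : 0 ≤ x) : AA α x ^ 2 =
    16 * (1 / α) * ((x + Real.exp (1 / α)) ^ (2 * α) / Real.log (x + Real.exp (1 / α))) := by
  have := logt_ge2 h0 h1 hx
  have hp : 0 < x + Real.exp (1/α) := by positivity
  unfold AA
  rw [mul_pow, mul_pow, div_pow, Real.sq_sqrt (by positivity), Real.sq_sqrt (by linarith),
    ← Real.rpow_natCast (_ ^ α), ← Real.rpow_mul hp.le]
  have e : α * ((2:ℕ):ℝ) = 2 * α := by push_cast; ring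
  rw [e]; norm_num

lemma AA_up {α : ℝ} (h0 : 0 < α) (h1 : α ≤ 1 / 2) {x y : ℝ} (hx : 0 ≤ x) (hxy : x ≤ y) :
    AA α y ≤ AA α x * Real.sqrt ((y + Real.exp (1/α)) / (x + Real.exp (1/α))) := by
  have l1 := logt_ge2 h0 h1 hx
  have hp : 0 < x + Real.exp (1/α) := by positivity
  have hq : 0 < y + Real.exp (1/α) := by linarith
  have hm : Real.log (x + Real.exp (1/α)) ≤ Real.log (y + Real.exp (1/α)) :=
    Real.log_le_log hp (by linarith)
  unfold AA
  set t := x + Real.exp (1/α)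
  set t' := y + Real.exp (1/α)
  have htt : t ≤ t' := by simp only [t, t']; linarith
  rw [mul_assoc (4 * Real.sqrt (1 / α)) (t ^ α / _)]
  apply mul_le_mul_of_nonneg_left _ (by positivity)
  have e1 : t' ^ α ≤ t ^ α * Real.sqrt (t' / t) := by
    have : (t' / t) ^ α ≤ (t'/t) ^ (1/2 : ℝ) :=
      Real.rpow_le_rpow_of_exponent_le (by rw [le_div_iff₀ hp]; linarith) h1
    rw [Real.div_rpow hq.le hp.le, div_le_iff₀ (by positivity)] at this
    rw [Real.sqrt_eq_rpow]; linarith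
  have : 0 < Real.sqrt (Real.log t) := Real.sqrt_pos.2 (by linarith)
  calc t' ^ α / Real.sqrt (Real.log t') ≤ (t ^ α * Real.sqrt (t' / t)) / Real.sqrt (Real.log t) := by
        gcongr
    _ = _ := by ring

lemma AA_lo {α : ℝ} (h0 : 0 < α) (h1 : α ≤ 1 / 2) {x y : ℝ} (hx : 0 ≤ x) (hxy : x ≤ y) :
    AA α x * ((y + Real.exp (1/α)) / (x + Real.exp (1/α))) ^ (α / 2) ≤ AA α y := by
  have l1 := logt_ge2 h0 h1 hx
  have l2 := logt_ge2 h0 h1 (hx.trans hxy)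
  have l3 := logt_ge h0 h1 hx
  have hp : 0 < x + Real.exp (1/α) := by positivity
  have hq : 0 < y + Real.exp (1/α) := by linarith
  have hx' := AA_pos h0 h1 hx
  have hy' := AA_pos h0 h1 (hx.trans hxy)
  have s1 := AA_sq h0 h1 hx
  have s2 := AA_sq h0 h1 (hx.trans hxy)
  set t := x + Real.exp (1/α)
  set t' := y + Real.exp (1/α)
  have htt : t ≤ t' := by simp only [t, t']; linarith
  have hr : 1 ≤ t' / t := by rw [le_div_iff₀ hp]; linarith
  refine le_of_sq_le_sq ?_ hy'.le
  rw [mul_pow, s1, s2, ← Real.rpow_natCast (_ ^ (α/2)), ← Real.rpow_mul (by positivity)]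
  have e : α / 2 * ((2:ℕ):ℝ) = α := by push_cast; ring
  rw [e, mul_assoc]
  apply mul_le_mul_of_nonneg_left _ (by positivity)
  have key : Real.log t' ≤ Real.log t * (t'/t) ^ α := by
    have a1 : Real.log t' = Real.log t + Real.log (t'/t) := by
      rw [Real.log_div hq.ne' hp.ne']; ring
    have a2 : 1 + α * Real.log (t'/t) ≤ (t'/t)^α := by
      rw [Real.rpow_def_of_pos (by positivity)]
      have := Real.add_one_le_exp (Real.log (t'/t) * α)
      linarith
    have a3 : 0 ≤ Real.log (t'/t) := Real.log_nonneg hr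
    have a4 : 1 ≤ α * Real.log t := by
      rw [div_le_iff₀ h0] at l3; linarith
    nlinarith [mul_le_mul_of_nonneg_left a2 (by linarith : 0 ≤ Real.log t)]
  have e2 : t' ^ (2*α) = t ^ (2 * α) * ((t'/t)^α * (t'/t)^α) := by
    rw [← Real.rpow_add (by positivity), ← two_mul, Real.div_rpow hq.le hp.le]
    field_simp
  rw [e2, div_mul_eq_mul_div, div_le_div_iff₀ (by linarith) (by linarith)]
  have : 0 ≤ t ^ (2*α) * (t'/t)^α := by positivity
  nlinarith [mul_le_mul_of_nonneg_left key this]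


lemma AA_dec {α : ℝ} (h0 : 0 < α) (h1 : α ≤ 1 / 2) {x y : ℝ} (hx : 0 ≤ x) (hxy : x ≤ y) :
    AA α x ≤ AA α y * (1 - α / 2 * ((y - x) / (y + Real.exp (1/α)))) := by
  have hp : 0 < x + Real.exp (1/α) := by positivity
  have hq : 0 < y + Real.exp (1/α) := by linarith
  have hlo := AA_lo h0 h1 hx hxy
  have hy' := AA_pos h0 h1 (hx.trans hxy)
  have hb := rpow_one_add_le_one_add_mul_self (s := - ((y - x) / (y + Real.exp (1/α)))) (p := α / 2)
    (by rw [neg_le_neg_iff, div_le_one hq]; linarith) (by linarith) (by linarith)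
  have e : 1 + - ((y - x) / (y + Real.exp (1/α))) = ((y + Real.exp (1/α)) / (x + Real.exp (1/α)))⁻¹ := by
    rw [inv_div]; field_simp; ring
  rw [e, Real.inv_rpow (by positivity)] at hb
  have hr : 0 < ((y + Real.exp (1/α)) / (x + Real.exp (1/α))) ^ (α / 2) := by positivity
  calc AA α x ≤ AA α y * (((y + Real.exp (1/α)) / (x + Real.exp (1/α))) ^ (α / 2))⁻¹ := by
        rw [← div_eq_mul_inv, le_div_iff₀ hr]; exact hlo
    _ ≤ AA α y * (1 - α / 2 * ((y - x) / (y + Real.exp (1/α)))) := by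
        apply mul_le_mul_of_nonneg_left _ hy'.le; linarith

lemma AA_zero {α : ℝ} (h0 : 0 < α) (h1 : α ≤ 1 / 2) : 4 ≤ AA α 0 := by
  unfold AA
  rw [zero_add, Real.log_exp, ← Real.exp_mul]
  have : 0 < Real.sqrt (1/α) := by positivity
  have h := Real.add_one_le_exp (1/α * α)
  have e : 1 / α * α = 1 := by field_simp
  rw [e] at h ⊢
  calc (4:ℝ) ≤ 4 * Real.exp 1 := by linarith
    _ = _ := by field_simp

lemma AA_smono {α : ℝ} (h0 : 0 < α) (h1 : α ≤ 1 / 2) : StrictMonoOn (AA α) (Set.Ici 0) := by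
  intro x hx y hy hxy
  have hx : 0 ≤ x := hx
  have hd := AA_dec h0 h1 hx hxy.le
  have hy' := AA_pos h0 h1 (hx.trans hxy.le)
  have : 0 < (y - x) / (y + Real.exp (1/α)) := by
    apply div_pos (by linarith); have := Real.exp_pos (1/α); linarith
  nlinarith [mul_pos h0 this, mul_pos hy' (mul_pos h0 this)]

lemma AA_cont {α : ℝ} (h0 : 0 < α) (h1 : α ≤ 1 / 2) : ContinuousOn (AA α) (Set.Ici 0) := by
  unfold AA
  apply ContinuousOn.mul continuousOn_const
  have hp : ∀ x ∈ Set.Ici (0:ℝ), 0 < x + Real.exp (1/α) := by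
    intro x hx; have : (0:ℝ) ≤ x := hx; positivity
  apply ContinuousOn.div
  · apply ContinuousOn.rpow_const (by fun_prop)
    intro x hx; left; exact (hp x hx).ne'
  · apply ContinuousOn.sqrt
    apply ContinuousOn.log (by fun_prop)
    intro x hx; exact (hp x hx).ne'
  · intro x hx
    have := logt_ge2 h0 h1 (show (0:ℝ) ≤ x from hx)
    exact (Real.sqrt_pos.2 (by linarith)).ne'

lemma AA_rv {α : ℝ} (h0 : 0 < α) (h1 : α ≤ 1 / 2) (l : ℝ) (hl : 0 < l) :
    Tendsto (fun x : ℝ => AA α (l * x) / AA α x) atTop (nhds (l ^ α)) := by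
  set b := Real.exp (1/α) with hb
  have hbp : 0 < b := Real.exp_pos _
  have hxb : Tendsto (fun x : ℝ => x + b) atTop atTop := tendsto_atTop_add_const_right _ _ tendsto_id
  have hlog : Tendsto (fun x : ℝ => Real.log (x + b)) atTop atTop := Real.tendsto_log_atTop.comp hxb
  have hr : Tendsto (fun x : ℝ => (l * x + b) / (x + b)) atTop (nhds l) := by
    have : Tendsto (fun x : ℝ => l + (b - l * b) / (x + b)) atTop (nhds (l + 0)) :=
      tendsto_const_nhds.add (Tendsto.div_atTop tendsto_const_nhds hxb)
    rw [add_zero] at this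
    refine this.congr' ?_
    filter_upwards [eventually_gt_atTop 0] with x hx
    field_simp; ring
  have h2 : Tendsto (fun x : ℝ => 1 + Real.log ((l * x + b) / (x + b)) / Real.log (x + b)) atTop
      (nhds (1 + 0)) := by
    apply tendsto_const_nhds.add
    exact Tendsto.div_atTop ((Real.continuousAt_log hl.ne').tendsto.comp hr) hlog
  have h3 : Tendsto (fun x : ℝ => ((l * x + b) / (x + b)) ^ α /
      Real.sqrt (1 + Real.log ((l * x + b) / (x + b)) / Real.log (x + b))) atTop
      (nhds (l ^ α / Real.sqrt (1 + 0))) := by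
    apply Tendsto.div
    · exact hr.rpow_const (Or.inl hl.ne')
    · exact (Real.continuous_sqrt.tendsto _).comp h2
    · simp
  simp only [add_zero, Real.sqrt_one, div_one] at h3
  refine h3.congr' ?_
  filter_upwards [eventually_gt_atTop 0] with x hx
  have l1 := logt_ge2 h0 h1 hx.le
  have l2 := logt_ge2 h0 h1 (mul_pos hl hx).le
  unfold AA
  rw [← hb] at l1 l2 ⊢
  have p1 : 0 < x + b := by positivity
  have p2 : 0 < l * x + b := by positivity
  have e : 1 + Real.log ((l * x + b) / (x + b)) / Real.log (x + b) =
      Real.log (l * x + b) / Real.log (x + b) := by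
    rw [Real.log_div p2.ne' p1.ne']
    field_simp; ring
  rw [e, Real.sqrt_div (by linarith), Real.div_rpow p2.le p1.le]
  have : 0 < Real.sqrt (Real.log (x + b)) := Real.sqrt_pos.2 (by linarith)
  have : 0 < Real.sqrt (Real.log (l * x + b)) := Real.sqrt_pos.2 (by linarith)
  have : 0 < Real.sqrt (1/α) := by positivity
  field_simp

lemma AA_wK {α : ℝ} (h0 : 0 < α) (h1 : α ≤ 1 / 2) (Y : ℕ) (hY : 1 ≤ Y) : AA α Y ^ 2 / Y * ∑ s ∈ Finset.Icc 1 Y,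
    ((s:ℝ) + Real.exp (1/α)) ^ (-(2*α)) ≤ 32 / α * (1 + Real.exp (1/α)) := by
  rw [AA_sq h0 h1 (Nat.cast_nonneg Y)]
  have l1 := logt_ge2 h0 h1 (Nat.cast_nonneg Y)
  set b := Real.exp (1/α) with hb
  have hbp : 0 < b := Real.exp_pos _
  have hY' : (1:ℝ) ≤ Y := by exact_mod_cast hY
  have hsum : ∑ s ∈ Finset.Icc 1 Y, ((s:ℝ) + b) ^ (-(2*α)) ≤
      ((Y:ℝ) + b) ^ (1 - 2 * α) * (1 + Real.log Y) := by
    have hh := harmonic_le_one_add_log Y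
    rw [harmonic_eq_sum_Icc] at hh
    push_cast at hh
    calc ∑ s ∈ Finset.Icc 1 Y, ((s:ℝ) + b) ^ (-(2*α))
        ≤ ∑ s ∈ Finset.Icc 1 Y, ((Y:ℝ) + b) ^ (1 - 2 * α) * (s:ℝ)⁻¹ := by
          apply Finset.sum_le_sum
          intro s hs
          rw [Finset.mem_Icc] at hs
          have hs1 : (1:ℝ) ≤ s := by exact_mod_cast hs.1
          have hs2 : (s:ℝ) ≤ Y := by exact_mod_cast hs.2
          have e : -(2*α) = (1 - 2 * α) + (-1) := by ring
          rw [e, Real.rpow_add (by positivity), Real.rpow_neg_one]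
          gcongr
          · linarith
          · linarith
      _ = ((Y:ℝ) + b) ^ (1 - 2 * α) * ∑ s ∈ Finset.Icc 1 Y, (s:ℝ)⁻¹ := by rw [Finset.mul_sum]
      _ ≤ _ := by gcongr
  have hlog : Real.log Y ≤ Real.log (Y + b) := Real.log_le_log (by linarith) (by linarith)
  have hlp : 0 < Real.log (Y + b) := by linarith
  calc 16 * (1 / α) * (((Y:ℝ) + b) ^ (2 * α) / Real.log (Y + b)) / Y * ∑ s ∈ Finset.Icc 1 Y, ((s:ℝ) + b) ^ (-(2*α))
      ≤ 16 * (1 / α) * (((Y:ℝ) + b) ^ (2 * α) / Real.log (Y + b)) / Y *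
        (((Y:ℝ) + b) ^ (1 - 2 * α) * (1 + Real.log Y)) := by
        gcongr
    _ = 16 * (1 / α) * ((((Y:ℝ) + b) ^ (2 * α) * ((Y:ℝ) + b) ^ (1 - 2 * α)) / Y) *
        ((1 + Real.log Y) / Real.log (Y + b)) := by ring
    _ = 16 * (1 / α) * ((Y + b) / Y) * ((1 + Real.log Y) / Real.log (Y + b)) := by
        rw [← Real.rpow_add (by positivity)]; norm_num
    _ ≤ 16 * (1 / α) * (1 + b) * 2 := by
        have h1 : ((Y:ℝ) + b) / Y ≤ 1 + b := by rw [div_le_iff₀ (by linarith)]; nlinarith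
        have h2 : (1 + Real.log Y) / Real.log (Y + b) ≤ 2 := by rw [div_le_iff₀ hlp]; linarith
        have h3 : 0 ≤ (1 + Real.log Y) / Real.log (Y + b) := by
          have := Real.log_nonneg hY'
          positivity
        gcongr
    _ = _ := by ring

lemma AA_wdiv {α : ℝ} (h0 : 0 < α) (h1 : α ≤ 1 / 2) : ¬ Summable (fun s : ℕ => AA α s ^ 2 / s * ((s:ℝ) + Real.exp (1/α)) ^ (-(2*α))) := by
  set b := Real.exp (1/α) with hb
  have hbp : 0 < b := Real.exp_pos _
  have hlp : ∀ s : ℕ, 2 ≤ Real.log (s + b) := fun s => logt_ge2 h0 h1 (Nat.cast_nonneg s)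
  have e : (fun s : ℕ => AA α s ^ 2 / s * ((s:ℝ) + b) ^ (-(2*α))) =
      fun s : ℕ => 16 * (1/α) * (1 / (s * Real.log (s + b))) := by
    funext s
    have := hlp s
    rw [AA_sq h0 h1 (Nat.cast_nonneg s), ← hb, Real.rpow_neg (by positivity)]
    have : 0 < ((s:ℝ) + b) ^ (2 * α) := by positivity
    field_simp
  rw [e, summable_mul_left_iff (by positivity), ← summable_condensed_iff_of_nonneg]
  · intro hs
    have hlog1b : 0 < Real.log (1 + b) := Real.log_pos (by linarith)
    have hle : Summable (fun k : ℕ => 1 / (1 + Real.log (1 + b)) * (1 / ((k:ℝ) + 1))) := by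
      refine Summable.of_nonneg_of_le (fun k => by positivity) (fun k => ?_) hs
      push_cast
      have h2k : (1:ℝ) ≤ 2 ^ k := one_le_pow₀ (by norm_num)
      have : 2 ≤ Real.log ((2:ℝ)^k + b) := by have := hlp (2^k); push_cast at this; exact this
      have e1 : (2:ℝ)^k * (1 / (2^k * Real.log (2^k + b))) = 1 / Real.log (2^k + b) := by
        field_simp
      rw [e1, one_div_mul_one_div]
      apply one_div_le_one_div_of_le (by linarith)
      have h3 : Real.log ((2:ℝ)^k + b) ≤ Real.log (2^k * (1 + b)) := by
        apply Real.log_le_log (by positivity); nlinarith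
      rw [Real.log_mul (by positivity) (by positivity), Real.log_pow] at h3
      have h4 : Real.log 2 ≤ 1 := by linarith [Real.log_two_lt_d9]
      have h5 : (k:ℝ) * Real.log 2 ≤ k := by nlinarith [Nat.cast_nonneg (α := ℝ) k]
      nlinarith [Nat.cast_nonneg (α := ℝ) k]
    rw [summable_mul_left_iff (by positivity)] at hle
    have := (summable_nat_add_iff (f := fun n : ℕ => 1 / (n:ℝ)) 1).1 (by simpa using hle)
    exact Real.not_summable_one_div_natCast this
  · intro n; have := hlp n; positivity
  · intro m n hm hmn
    have hm' : (0:ℝ) < m := by exact_mod_cast hm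
    have hmn' : (m:ℝ) ≤ n := by exact_mod_cast hmn
    have := hlp m
    have : 0 < Real.log (m + b) := by linarith
    have h3 : Real.log (m + b) ≤ Real.log (n + b) := Real.log_le_log (by positivity) (by linarith)
    apply one_div_le_one_div_of_le (by positivity)
    gcongr


lemma exists_goodA {α : ℝ} (h0 : 0 < α) (h1 : α ≤ 1 / 2) :
    ∃ (A : ℝ → ℝ) (w : ℕ → ℝ) (c C a : ℝ), GoodA α A w c C a := by
  set b := Real.exp (1/α) with hb
  have hbp : 0 < b := Real.exp_pos _
  have hb3 : 3 ≤ b := bb_ge h0 h1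
  have hC1 : 1 + b ≤ 32 / α * (1 + b) := by
    have : 1 ≤ 32 / α := by rw [le_div_iff₀ h0]; linarith
    nlinarith
  have hcle : α / 2 / (2 + b) ≤ α / 2 := div_le_self (by linarith) (by linarith)
  refine ⟨AA α, fun s => ((s:ℝ) + b) ^ (-(2*α)), α / 2 / (2 + b), 32 / α * (1 + b), α / 2, ?_⟩
  constructor
  · positivity
  · linarith
  · linarith
  · positivity
  · intro x hx
    have h := (AA_smono h0 h1).monotoneOn (by simp : (0:ℝ) ∈ Set.Ici (0:ℝ)) hx hx
    linarith [AA_zero h0 h1]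
  · exact AA_cont h0 h1
  · exact AA_smono h0 h1
  · exact AA_rv h0 h1
  · intro x y hx hxy
    have hu := AA_up h0 h1 hx.le hxy
    have hy := AA_pos h0 h1 (hx.le.trans hxy)
    have hu2 := pow_le_pow_left₀ hy.le hu 2
    have hyb : 0 < y + b := by linarith
    rw [mul_pow, Real.sq_sqrt (by positivity)] at hu2
    have : (y + b) / (x + b) ≤ y / x := by
      rw [div_le_div_iff₀ (by linarith) hx]; nlinarith
    calc AA α y ^ 2 * x ≤ (AA α x ^ 2 * (y / x)) * x := by
          gcongr; exact hu2.trans (by gcongr)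
      _ = _ := by field_simp
  · intro z
    have hu := AA_up h0 h1 (Nat.cast_nonneg z) (by linarith : (z:ℝ) ≤ z + 1)
    have hz : (0:ℝ) ≤ z := Nat.cast_nonneg z
    have hz' := AA_pos h0 h1 hz
    have : Real.sqrt (((z:ℝ) + 1 + b) / (z + b)) ≤ (z + 2) / (z + 1) := by
      rw [Real.sqrt_le_left (by positivity)]
      have e1 : ((z:ℝ) + 1 + b) / (z + b) ≤ (z + 2) / (z + 1) := by
        rw [div_le_div_iff₀ (by positivity) (by positivity)]; nlinarith
      have e2 : 1 ≤ ((z:ℝ) + 2) / (z + 1) := by rw [le_div_iff₀ (by positivity)]; linarith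
      nlinarith
    calc AA α (z + 1) * (z + 1) ≤ (AA α z * ((z + 2) / (z + 1))) * (z + 1) := by
          gcongr; exact hu.trans (by gcongr)
      _ = _ := by field_simp
  · intro z
    have hd := AA_dec h0 h1 (Nat.cast_nonneg z) (by linarith : (z:ℝ) ≤ z + 1)
    have hz : (0:ℝ) ≤ z := Nat.cast_nonneg z
    have hz' := AA_pos h0 h1 (by linarith : 0 ≤ (z:ℝ) + 1)
    have : α / 2 / (2 + b) / (z + 1) ≤ α / 2 * ((z + 1 - z) / (z + 1 + b)) := by
      rw [add_sub_cancel_left, div_div, ← mul_div_assoc, mul_one]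
      apply div_le_div_of_nonneg_left (by positivity) (by positivity); nlinarith
    calc AA α z * (z + 1) ≤ (AA α (z + 1) * (1 - α / 2 / (2 + b) / (z + 1))) * (z + 1) := by
          gcongr; exact hd.trans (by gcongr)
      _ = _ := by field_simp
  · intro q hq
    have hd := AA_dec h0 h1 (by linarith : 0 ≤ q) (by linarith : q ≤ 2 * q)
    have hz' := AA_pos h0 h1 (by linarith : 0 ≤ 2 * q)
    have h3 : α / 2 / (2 + b) ≤ α / 2 * ((2 * q - q) / (2 * q + b)) := by
      rw [← mul_div_assoc, div_le_div_iff₀ (by positivity) (by positivity)]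
      have h4 : 2 * q + b ≤ (2 * q - q) * (2 + b) := by nlinarith
      calc α / 2 * (2 * q + b) ≤ α / 2 * ((2 * q - q) * (2 + b)) := by gcongr
        _ = _ := by ring
    have hd' : AA α q ≤ AA α (2 * q) * (1 - α / 2 / (2 + b)) := hd.trans (by gcongr)
    have hcp : 0 ≤ α / 2 / (2 + b) := by positivity
    nlinarith [mul_le_mul_of_nonneg_left hd' (by linarith : 0 ≤ 1 + α / 2 / (2 + b)),
      mul_nonneg hz'.le (sq_nonneg (α / 2 / (2 + b)))]
  · intro s x hs hsx
    have hlo := AA_lo h0 h1 (by linarith : 0 ≤ s) hsx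
    have hxp := AA_pos h0 h1 (by linarith : 0 ≤ x)
    have hsb : 0 < s + b := by linarith
    have hxb : 0 < x + b := by linarith
    have h2 : AA α s ≤ AA α x * ((s + b) / (x + b)) ^ (α / 2) := by
      rw [← inv_div, Real.inv_rpow (by positivity), ← div_eq_mul_inv, le_div_iff₀ (by positivity)]
      exact hlo
    have h3 : ((s + b) / (x + b)) ^ (α / 2) ≤ 32 / α * (1 + b) * (s / x) ^ (α / 2) := by
      calc ((s + b) / (x + b)) ^ (α / 2) ≤ ((1 + b) * (s / x)) ^ (α / 2) := by
            apply Real.rpow_le_rpow (by positivity) _ (by positivity)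
            rw [← mul_div_assoc, div_le_div_iff₀ hxb (by linarith)]
            nlinarith [mul_nonneg hbp.le (by linarith : 0 ≤ s - 1), mul_nonneg (mul_nonneg hbp.le (by linarith : 0 ≤ x)) (by linarith : 0 ≤ s - 1), mul_pos hbp hsb]
        _ = (1 + b) ^ (α / 2) * (s / x) ^ (α / 2) := by
            rw [Real.mul_rpow (by positivity) (div_nonneg (by linarith) (by linarith))]
        _ ≤ _ := by
            have : (1 + b) ^ (α / 2) ≤ (1 + b) ^ (1:ℝ) :=
              Real.rpow_le_rpow_of_exponent_le (by linarith) (by linarith)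
            rw [Real.rpow_one] at this
            have hn : 0 ≤ (s / x) ^ (α / 2) := Real.rpow_nonneg (div_nonneg (by linarith) (by linarith)) _
            gcongr
            linarith
    calc AA α s ≤ AA α x * ((s + b) / (x + b)) ^ (α / 2) := h2
      _ ≤ AA α x * (32 / α * (1 + b) * (s / x) ^ (α / 2)) := by gcongr
      _ = _ := by ring
  · have hxb : Tendsto (fun x : ℝ => x + b) atTop atTop :=
      tendsto_atTop_add_const_right _ _ tendsto_id
    have hlog : Tendsto (fun x : ℝ => Real.log (x + b)) atTop atTop := Real.tendsto_log_atTop.comp hxb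
    have hlim : Tendsto (fun x : ℝ => 16 * (1 / α) * (1 + b) / Real.log (x + b)) atTop (nhds 0) :=
      Tendsto.div_atTop tendsto_const_nhds hlog
    refine squeeze_zero' ?_ ?_ hlim
    · filter_upwards [eventually_ge_atTop 1] with x hx
      positivity
    · filter_upwards [eventually_ge_atTop 1] with x hx
      have l1 := logt_ge2 h0 h1 (by linarith : 0 ≤ x)
      rw [AA_sq h0 h1 (by linarith : 0 ≤ x), ← hb]
      rw [← hb] at l1
      have h2 : (x + b) ^ (2 * α) ≤ (x + b) ^ (1:ℝ) :=
        Real.rpow_le_rpow_of_exponent_le (by linarith) (by linarith)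
      rw [Real.rpow_one] at h2
      have h3 : (x + b) ^ (2 * α) / x ≤ 1 + b := by
        rw [div_le_iff₀ (by linarith)]; nlinarith
      calc 16 * (1 / α) * ((x + b) ^ (2 * α) / Real.log (x + b)) / x
          = 16 * (1 / α) * ((x + b) ^ (2 * α) / x) / Real.log (x + b) := by ring
        _ ≤ _ := by gcongr
  · have h2 : Tendsto (fun x : ℝ => AA α 0 * ((x + b) / (0 + b)) ^ (α / 2)) atTop atTop := by
      apply Tendsto.const_mul_atTop (AA_pos h0 h1 le_rfl)
      apply (tendsto_rpow_atTop (by positivity)).comp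
      apply Tendsto.atTop_div_const (by linarith)
      exact tendsto_atTop_add_const_right _ _ tendsto_id
    refine tendsto_atTop_mono' _ ?_ h2
    filter_upwards [eventually_ge_atTop 0] with x hx
    exact AA_lo h0 h1 le_rfl hx
  · intro j t hjt
    have hjt' : (j:ℝ) + 1 ≤ t := by exact_mod_cast hjt
    have hj0 : (0:ℝ) ≤ j := Nat.cast_nonneg j
    have hu := AA_up h0 h1 hj0 (by linarith : (j:ℝ) ≤ t)
    have hjp := AA_pos h0 h1 hj0
    have h3 : Real.sqrt (((t:ℝ) + b) / (j + b)) ≤ 32 / α * (1 + b) * Real.sqrt (t / (j + 1)) := by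
      calc Real.sqrt (((t:ℝ) + b) / (j + b)) ≤ Real.sqrt ((1 + b) ^ 2 * (t / (j + 1))) := by
            apply Real.sqrt_le_sqrt
            rw [← mul_div_assoc, div_le_div_iff₀ (by linarith) (by linarith)]
            have k1 : (t:ℝ) + b ≤ (1 + b) * t := by nlinarith
            have k2 : (1 + b) * t * (j + 1) ≤ (1 + b) ^ 2 * t * (j + 1) := by
              have : 0 ≤ (t:ℝ) := by linarith
              gcongr
              nlinarith
            have k3 : (1 + b) ^ 2 * (t:ℝ) * (j + 1) ≤ (1 + b) ^ 2 * t * (j + b) := by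
              have : 0 ≤ (t:ℝ) := by linarith
              gcongr
              linarith
            have k4 : ((t:ℝ) + b) * (j + 1) ≤ (1 + b) * t * (j + 1) := by gcongr
            linarith
        _ = (1 + b) * Real.sqrt (t / (j + 1)) := by
            rw [Real.sqrt_mul (by positivity), Real.sqrt_sq (by linarith)]
        _ ≤ _ := by gcongr
    calc AA α t ≤ AA α j * Real.sqrt (((t:ℝ) + b) / (j + b)) := hu
      _ ≤ AA α j * (32 / α * (1 + b) * Real.sqrt (t / (j + 1))) := by gcongr
      _ = _ := by ring
  · intro s; positivity
  · intro s t hst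
    have : (s:ℝ) ≤ t := by exact_mod_cast hst
    exact Real.rpow_le_rpow_of_nonpos (by positivity) (by linarith) (by linarith)
  · intro i Y hY
    have : (Y:ℝ) ≤ 2 * i := by exact_mod_cast hY
    have hi : (0:ℝ) ≤ i := Nat.cast_nonneg i
    rw [Real.rpow_neg (by positivity), Real.rpow_neg (by positivity), ← div_eq_mul_inv,
      ← one_div, div_le_div_iff₀ (by positivity) (by positivity), one_mul]
    calc ((Y:ℝ) + b) ^ (2 * α) ≤ (2 * (i + b)) ^ (2 * α) :=
          Real.rpow_le_rpow (by positivity) (by linarith) (by linarith)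
      _ = 2 ^ (2 * α) * (i + b) ^ (2 * α) := Real.mul_rpow (by norm_num) (by positivity)
      _ ≤ 2 ^ (1:ℝ) * (i + b) ^ (2 * α) := by
          gcongr
          · norm_num
          · linarith
      _ = _ := by rw [Real.rpow_one]
  · intro Y
    have l1 := logt_ge2 h0 h1 (Nat.cast_nonneg Y)
    rw [AA_sq h0 h1 (Nat.cast_nonneg Y), ← hb, Real.rpow_neg (by positivity)]
    rw [← hb] at l1
    have hp : 0 < ((Y:ℝ) + b) ^ (2 * α) := by positivity
    have e : 16 * (1 / α) * (((Y:ℝ) + b) ^ (2 * α) / Real.log (Y + b)) * (((Y:ℝ) + b) ^ (2 * α))⁻¹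
        = 16 / α * (1 / Real.log (Y + b)) := by field_simp
    rw [e]
    have h2 : 1 / Real.log (Y + b) ≤ 1 := by rw [div_le_one (by linarith)]; linarith
    have h3 : 0 < 16 / α := by positivity
    have e2 : 32 / α = 2 * (16 / α) := by ring
    rw [e2]
    nlinarith
  · intro Y hY; exact AA_wK h0 h1 Y hY
  · exact AA_wdiv h0 h1

/-- Nonnegative functions on the integers, with convolution as multiplication. -/
@[ext] structure Cv : Type where
  /-- the underlying function -/
  fn : ℤ → ENNReal

namespace Cv

noncomputable instance : CoeFun Cv (fun _ => ℤ → ENNReal) := ⟨Cv.fn⟩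

noncomputable instance : PartialOrder Cv where
  le a b := ∀ z, a z ≤ b z
  le_refl a := fun z => le_rfl
  le_trans a b c h h' := fun z => (h z).trans (h' z)
  le_antisymm a b h h' := by ext z; exact le_antisymm (h z) (h' z)

noncomputable instance : Zero Cv := ⟨⟨fun _ => 0⟩⟩

noncomputable instance : Add Cv := ⟨fun a b => ⟨fun z => a z + b z⟩⟩

noncomputable instance : One Cv := ⟨⟨fun z => if z = 0 then 1 else 0⟩⟩

noncomputable instance : Mul Cv := ⟨fun a b => ⟨fun z => ∑' y, a y * b (z - y)⟩⟩

lemma add_apply (a b : Cv) (z : ℤ) : (a + b) z = a z + b z := rfl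
lemma zero_apply (z : ℤ) : (0 : Cv) z = 0 := rfl
lemma one_apply (z : ℤ) : (1 : Cv) z = if z = 0 then 1 else 0 := rfl
lemma mul_apply (a b : Cv) (z : ℤ) : (a * b) z = ∑' y, a y * b (z - y) := rfl
lemma le_def (a b : Cv) : a ≤ b ↔ ∀ z, a z ≤ b z := Iff.rfl

lemma cv_ext {a b : Cv} (h : ∀ z, a z = b z) : a = b := Cv.ext (funext h)

lemma mul_comm_aux (a b : Cv) : a * b = b * a := by
  apply cv_ext; intro z
  rw [mul_apply, mul_apply, ← (Equiv.subLeft z).tsum_eq]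
  apply tsum_congr; intro y
  simp [mul_comm]

lemma one_mul_aux (a : Cv) : 1 * a = a := by
  apply cv_ext; intro z
  rw [mul_apply, tsum_eq_single 0]
  · simp [one_apply]
  · intro y hy; simp [one_apply, hy]

lemma mul_assoc_aux (a b c : Cv) : a * b * c = a * (b * c) := by
  apply cv_ext; intro z
  calc (a * b * c) z = ∑' y, ∑' t, a t * b (y - t) * c (z - y) := by
        rw [mul_apply]; simp_rw [mul_apply, ENNReal.tsum_mul_right]
    _ = ∑' t, ∑' y, a t * b (y - t) * c (z - y) := ENNReal.tsum_comm
    _ = ∑' t, ∑' y, a t * (b y * c (z - t - y)) := by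
        apply tsum_congr; intro t
        rw [← (Equiv.addRight t).tsum_eq]
        apply tsum_congr; intro y
        simp only [Equiv.coe_addRight, add_sub_cancel_right]
        rw [mul_assoc]; congr 3; ring
    _ = _ := by
        rw [mul_apply]; simp_rw [mul_apply, ENNReal.tsum_mul_left]

lemma mul_add_aux (a b c : Cv) : a * (b + c) = a * b + a * c := by
  apply cv_ext; intro z
  simp only [mul_apply, add_apply, mul_add, ENNReal.tsum_add]

noncomputable instance : CommSemiring Cv where
  add_assoc a b c := cv_ext fun z => add_assoc _ _ _
  zero_add a := cv_ext fun z => zero_add _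
  add_zero a := cv_ext fun z => add_zero _
  add_comm a b := cv_ext fun z => add_comm _ _
  mul_assoc := mul_assoc_aux
  one_mul := one_mul_aux
  mul_one a := by rw [mul_comm_aux, one_mul_aux]
  left_distrib := mul_add_aux
  right_distrib a b c := by
    rw [mul_comm_aux, mul_add_aux, mul_comm_aux, mul_comm_aux c b]
  zero_mul a := by apply cv_ext; intro z; simp [mul_apply, zero_apply]
  mul_zero a := by apply cv_ext; intro z; simp [mul_apply, zero_apply]
  mul_comm := mul_comm_aux
  nsmul := nsmulRec

/-- Total mass. -/
noncomputable def mass : Cv →+* ENNReal where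
  toFun a := ∑' z, a z
  map_one' := by
    change ∑' z, (1 : Cv) z = 1
    rw [tsum_eq_single 0]
    · simp [one_apply]
    · intro y hy; simp [one_apply, hy]
  map_zero' := by change ∑' z, (0 : Cv) z = 0; simp [zero_apply]
  map_add' a b := by change ∑' z, (a + b) z = _; simp_rw [add_apply]; exact ENNReal.tsum_add
  map_mul' a b := by
    change ∑' z, (a * b) z = (∑' z, a z) * ∑' z, b z
    simp_rw [mul_apply]
    rw [ENNReal.tsum_comm, ← ENNReal.tsum_mul_right]
    apply tsum_congr; intro y
    rw [ENNReal.tsum_mul_left]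
    congr 1
    exact (Equiv.subRight y).tsum_eq b

lemma mass_def (a : Cv) : mass a = ∑' z, a z := rfl

/-- Sup norm. -/
noncomputable def sup (a : Cv) : ENNReal := ⨆ z, a z

lemma le_sup (a : Cv) (z : ℤ) : a z ≤ a.sup := le_iSup a z

lemma sup_le {a : Cv} {b : ENNReal} (h : ∀ z, a z ≤ b) : a.sup ≤ b := iSup_le h

lemma mul_apply_le (a b : Cv) (z : ℤ) : (a * b) z ≤ mass a * b.sup := by
  rw [mul_apply, mass_def, ← ENNReal.tsum_mul_right]
  exact ENNReal.tsum_le_tsum fun y => by gcongr; exact le_sup _ _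

lemma sup_mul_le (a b : Cv) : (a * b).sup ≤ mass a * b.sup := sup_le fun z => mul_apply_le a b z

lemma sup_mono {a b : Cv} (h : a ≤ b) : a.sup ≤ b.sup := iSup_mono h

lemma mul_mono {a b c d : Cv} (h : a ≤ b) (h' : c ≤ d) : a * c ≤ b * d := by
  intro z; rw [mul_apply, mul_apply]
  exact ENNReal.tsum_le_tsum fun y => mul_le_mul' (h y) (h' _)

lemma pow_mono {a b : Cv} (h : a ≤ b) (n : ℕ) : a ^ n ≤ b ^ n := by
  induction n with
  | zero => simp
  | succ n ih => rw [pow_succ, pow_succ]; exact mul_mono ih h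

lemma add_mono {a b c d : Cv} (h : a ≤ b) (h' : c ≤ d) : a + c ≤ b + d := by
  intro z; rw [add_apply, add_apply]; exact add_le_add (h z) (h' z)

lemma sum_apply {ι : Type*} (s : Finset ι) (a : ι → Cv) (z : ℤ) :
    (∑ i ∈ s, a i) z = ∑ i ∈ s, a i z := by
  induction s using Finset.cons_induction with
  | empty => simp [zero_apply]
  | cons i s hi ih => rw [Finset.sum_cons, Finset.sum_cons, add_apply, ih]

lemma le_add_right (a b : Cv) : a ≤ a + b := fun z => by rw [add_apply]; exact le_self_add

lemma mass_mono {a b : Cv} (h : a ≤ b) : mass a ≤ mass b := by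
  rw [mass_def, mass_def]; exact ENNReal.tsum_le_tsum h

lemma sup_add_le (a b : Cv) : (a + b).sup ≤ a.sup + b.sup :=
  sup_le fun z => by rw [add_apply]; exact add_le_add (le_sup _ _) (le_sup _ _)

/-- Indicator of `{0,…,d-1}`. -/
noncomputable def ind (d : ℕ) : Cv := ⟨fun z => if 0 ≤ z ∧ z < d then 1 else 0⟩

lemma ind_mul_apply (d : ℕ) (a : Cv) (z : ℤ) :
    (ind d * a) z = ∑ i ∈ Finset.range d, a (z - i) := by
  rw [mul_apply, tsum_eq_sum (s := (Finset.range d).map Nat.castEmbedding)]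
  · rw [Finset.sum_map]
    apply Finset.sum_congr rfl; intro i hi
    have : i < d := Finset.mem_range.1 hi
    simp [ind, this]
  · intro y hy
    have : ¬ (0 ≤ y ∧ y < d) := by
      rintro ⟨h1, h2⟩
      apply hy
      simp only [Finset.mem_map, Finset.mem_range, Nat.castEmbedding_apply]
      exact ⟨y.toNat, by omega, by omega⟩
    simp [ind, this]

lemma ind_apply_le (d : ℕ) (z : ℤ) : ind d z ≤ 1 := by
  simp only [ind]; split_ifs <;> simp

lemma mass_ind (d : ℕ) : mass (ind d) = d := by
  rw [mass_def, tsum_eq_sum (s := (Finset.range d).map Nat.castEmbedding)]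
  · rw [Finset.sum_map, Finset.sum_congr rfl (g := fun _ => (1:ENNReal))]
    · simp
    · intro i hi
      have : i < d := Finset.mem_range.1 hi
      simp [ind, this]
  · intro y hy
    have : ¬ (0 ≤ y ∧ y < d) := by
      rintro ⟨h1, h2⟩
      apply hy
      simp only [Finset.mem_map, Finset.mem_range, Nat.castEmbedding_apply]
      exact ⟨y.toNat, by omega, by omega⟩
    simp [ind, this]

/-- Point mass at `p` with weight `c`. -/
noncomputable def pt (c : ENNReal) (p : ℤ) : Cv := ⟨fun z => if z = p then c else 0⟩

lemma pt_mul_apply (c : ENNReal) (p : ℤ) (a : Cv) (z : ℤ) : (pt c p * a) z = c * a (z - p) := by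
  rw [mul_apply, tsum_eq_single p]
  · simp [pt]
  · intro y hy; simp [pt, hy]

lemma mass_pt (c : ENNReal) (p : ℤ) : mass (pt c p) = c := by
  rw [mass_def, tsum_eq_single p]
  · simp [pt]
  · intro y hy; simp [pt, hy]

/-- `c` times the indicator of `[q+1,2q]`. -/
noncomputable def blk (c : ENNReal) (q : ℕ) : Cv := pt c (q + 1) * ind q

lemma mass_blk (c : ENNReal) (q : ℕ) : mass (blk c q) = c * q := by
  rw [blk, map_mul, mass_pt, mass_ind]

lemma blk_mul_sup (c : ENNReal) (q : ℕ) (φ : Cv) : (blk c q * φ).sup ≤ c * (ind q * φ).sup := by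
  rw [blk, mul_assoc]; refine (sup_mul_le _ _).trans ?_
  rw [mass_pt]

/-- difference of powers -/
lemma pow_split (R H : Cv) (n : ℕ) :
    (R + H) ^ n = R ^ n + H * ∑ j ∈ Finset.range n, (R + H) ^ (n - 1 - j) * R ^ j := by
  induction n with
  | zero => simp
  | succ n ih =>
    rw [Finset.sum_range_succ']
    have e : ∑ j ∈ Finset.range n, (R + H) ^ (n + 1 - 1 - (j + 1)) * R ^ (j + 1) =
        (∑ j ∈ Finset.range n, (R + H) ^ (n - 1 - j) * R ^ j) * R := by
      rw [Finset.sum_mul]; apply Finset.sum_congr rfl; intro j hj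
      have : n + 1 - 1 - (j + 1) = n - 1 - j := by omega
      rw [this]; ring
    rw [e]
    simp only [Nat.add_sub_cancel, Nat.sub_zero, pow_zero, mul_one]
    set S := ∑ j ∈ Finset.range n, (R + H) ^ (n - 1 - j) * R ^ j
    calc (R + H) ^ (n + 1) = (R + H) ^ n * R + H * (R + H) ^ n := by ring
      _ = (R ^ n + H * S) * R + H * (R + H) ^ n := by rw [ih]
      _ = _ := by ring

lemma mass_pow_le {f : Cv} (h : mass f ≤ 1) (n : ℕ) : mass (f ^ n) ≤ 1 := by
  rw [map_pow]; exact pow_le_one' h n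

lemma mass_T (R H : Cv) (hm : mass (R + H) = 1) (n : ℕ) :
    mass H * mass (∑ j ∈ Finset.range n, (R + H) ^ (n - 1 - j) * R ^ j) ≤ 1 := by
  have := congrArg mass (pow_split R H n)
  rw [map_pow, hm, one_pow, map_add, map_mul] at this
  rw [this]; exact le_add_self

lemma mass_R_le {R H : Cv} (hm : mass (R + H) = 1) : mass R ≤ 1 := by
  rw [← hm, map_add]; exact le_self_add

/-- Master estimate. -/
lemma master (R : Cv) (c : ENNReal) (q : ℕ) (hq : q ≠ 0)
    (hm : mass (R + blk c q) = 1) (n : ℕ) (φ : Cv) :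
    ((R + blk c q) ^ n * φ).sup ≤ mass R ^ n * φ.sup + (ind q * φ).sup / q := by
  rw [pow_split, add_mul]
  refine (sup_add_le _ _).trans (add_le_add ?_ ?_)
  · refine (sup_mul_le _ _).trans ?_; rw [map_pow]
  · set S := ∑ j ∈ Finset.range n, (R + blk c q) ^ (n - 1 - j) * R ^ j with hS
    have h1 := mass_T R (blk c q) hm n
    rw [← hS, mass_blk] at h1
    have e : blk c q * S * φ = S * (blk c q * φ) := by ring
    rw [e]
    refine (sup_mul_le _ _).trans ?_
    have hq' : (q : ENNReal) ≠ 0 := by exact_mod_cast hq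
    rw [ENNReal.le_div_iff_mul_le (Or.inl hq') (Or.inl (by simp))]
    calc mass S * (blk c q * φ).sup * q ≤ mass S * (c * (ind q * φ).sup) * q := by
          gcongr; exact blk_mul_sup _ _ _
      _ = (c * q * mass S) * (ind q * φ).sup := by ring
      _ ≤ 1 * (ind q * φ).sup := by gcongr
      _ = _ := one_mul _

lemma shift_sum (a : ℤ → ENNReal) (q e : ℕ) (z : ℤ) :
    ∑ i ∈ Finset.range q, a (z + e - i) ≤
      ∑ i ∈ Finset.range q, a (z - i) + ∑ i ∈ Finset.range e, a (z + e - i) := by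
  have h1 : ∑ i ∈ Finset.range q, a (z - i) + ∑ i ∈ Finset.range e, a (z + e - i) =
      ∑ i ∈ Finset.range (e + q), a (z + e - i) := by
    rw [Finset.sum_range_add, add_comm]
    congr 1
    apply Finset.sum_congr rfl; intro i _; congr 1; push_cast; ring
  rw [h1]
  apply Finset.sum_le_sum_of_subset
  intro i hi; rw [Finset.mem_range] at *; omega

lemma blk_mul_apply (c : ENNReal) (q : ℕ) (φ : Cv) (z : ℤ) :
    (blk c q * φ) z = c * ∑ i ∈ Finset.range q, φ (z - (q + 1) - i) := by
  rw [blk, mul_assoc, pt_mul_apply, ind_mul_apply]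

lemma blk_shift (c : ENNReal) (q e : ℕ) (φ : Cv) (z : ℤ) :
    (blk c q * φ) (z + e) ≤ (blk c q * φ) z + c * (ind e * φ).sup := by
  rw [blk_mul_apply, blk_mul_apply, ← mul_add]
  gcongr
  have h := shift_sum φ q e (z - (q + 1))
  have e1 : ∀ i : ℕ, z + (e:ℤ) - (q + 1) - i = z - (q + 1) + e - i := fun i => by ring
  simp_rw [e1]
  refine h.trans ?_
  gcongr
  rw [← ind_mul_apply]; exact le_sup _ _

lemma master_shift (R : Cv) (c : ENNReal) (q : ℕ) (hq : q ≠ 0)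
    (hm : mass (R + blk c q) = 1) (n : ℕ) (φ : Cv) (x : ℤ) (e : ℕ) :
    ((R + blk c q) ^ n * φ) (x + e) ≤ ((R + blk c q) ^ n * φ) x +
      (mass R ^ n * φ.sup + (ind e * φ).sup / q) := by
  rw [pow_split, add_mul, add_apply, add_apply]
  set S := ∑ j ∈ Finset.range n, (R + blk c q) ^ (n - 1 - j) * R ^ j with hS
  have h1 := mass_T R (blk c q) hm n
  rw [← hS, mass_blk] at h1
  have e1 : blk c q * S * φ = S * (blk c q * φ) := by ring
  rw [e1]
  have hA : (R ^ n * φ) (x + e) ≤ mass R ^ n * φ.sup := by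
    refine (mul_apply_le _ _ _).trans ?_; rw [map_pow]
  have hB : (S * (blk c q * φ)) (x + e) ≤ (S * (blk c q * φ)) x + (ind e * φ).sup / q := by
    have : (S * (blk c q * φ)) (x + e) ≤
        (S * (blk c q * φ)) x + mass S * (c * (ind e * φ).sup) := by
      rw [mul_apply, mul_apply S _ x, mass_def, ← ENNReal.tsum_mul_right, ← ENNReal.tsum_add]
      refine ENNReal.tsum_le_tsum fun y => ?_
      rw [← mul_add]; gcongr
      have := blk_shift c q e φ (x - y)
      have e2 : x + (e:ℤ) - y = x - y + e := by ring
      rwa [e2]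
    refine this.trans ?_
    gcongr
    have hq' : (q : ENNReal) ≠ 0 := by exact_mod_cast hq
    rw [ENNReal.le_div_iff_mul_le (Or.inl hq') (Or.inl (by simp))]
    calc mass S * (c * (ind e * φ).sup) * q = (c * q * mass S) * (ind e * φ).sup := by ring
      _ ≤ 1 * (ind e * φ).sup := by gcongr
      _ = _ := one_mul _
  calc _ ≤ mass R ^ n * φ.sup + ((S * (blk c q * φ)) x + (ind e * φ).sup / q) := add_le_add hA hB
    _ = (S * (blk c q * φ)) x + (mass R ^ n * φ.sup + (ind e * φ).sup / q) := by ring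
    _ ≤ _ := by gcongr; exact le_add_self

/-- Renewal function. -/
noncomputable def ren (f : Cv) : Cv := ⟨fun z => ∑' n : ℕ, (f ^ n) z⟩

lemma mul_ren_apply (a f : Cv) (z : ℤ) : (a * ren f) z = ∑' n : ℕ, (a * f ^ n) z := by
  simp_rw [mul_apply, ren, ← ENNReal.tsum_mul_left]
  exact ENNReal.tsum_comm

lemma ren_split (f : Cv) (N : ℕ) (z : ℤ) :
    ren f z = ∑ n ∈ Finset.range N, (f ^ n) z + (f ^ N * ren f) z := by
  have h := ENNReal.summable.sum_add_tsum_nat_add' (f := fun n : ℕ => (f ^ n) z) (k := N)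
  rw [mul_ren_apply]; simp only [ren]
  rw [← h]
  congr 1
  apply tsum_congr; intro n; rw [← pow_add, add_comm]

/-- Linear lower bound of a power. -/
lemma pow_add_ge (G B : Cv) (n : ℕ) (z : ℤ) : (n : ENNReal) * (G ^ (n - 1) * B) z ≤ ((G + B) ^ n) z := by
  have key : ∀ n : ℕ, ∑ _i ∈ Finset.range n, (G ^ (n - 1) * B) ≤ (G + B) ^ n := by
    intro n
    rw [pow_split]
    rw [add_comm]; refine le_trans ?_ (le_add_right _ _)
    rw [Finset.mul_sum]
    intro z
    rw [sum_apply, sum_apply]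
    apply Finset.sum_le_sum; intro i hi
    have hi' := Finset.mem_range.1 hi
    have e : G ^ (n - 1) * B = B * (G ^ (n - 1 - i) * G ^ i) := by
      rw [← pow_add, show n - 1 - i + i = n - 1 by omega, mul_comm]
    rw [e]
    exact mul_mono le_rfl (mul_mono (pow_mono (le_add_right _ _) _) le_rfl) z
  have := key n z
  rw [sum_apply] at this
  simpa using this

lemma exists_sub {a b : Cv} (h : a ≤ b) : ∃ R : Cv, R + a = b :=
  ⟨⟨fun z => b z - a z⟩, cv_ext fun z => by
    rw [add_apply]; exact tsub_add_cancel_of_le (h z)⟩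

end Cv

section elem
variable {α : ℝ} {A : ℝ → ℝ} {w : ℕ → ℝ} {c C a : ℝ}

lemma GoodA.pos (h : GoodA α A w c C a) {x : ℝ} (hx : 0 ≤ x) : 0 < A x := by
  linarith [h.four x hx]

lemma GoodA.mono (h : GoodA α A w c C a) {x y : ℝ} (hx : 0 ≤ x) (hxy : x ≤ y) : A x ≤ A y :=
  h.smono.monotoneOn hx (hx.trans hxy) hxy

lemma GoodA.scale (h : GoodA α A w c C a) {x r : ℝ} (hx : 0 < x) (hr : 1 ≤ r) :
    A (r ^ 2 * x) ≤ r * A x := by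
  have h1 := h.kanti x (r ^ 2 * x) hx (le_mul_of_one_le_left hx.le (one_le_pow₀ hr))
  have h2 : A (r ^ 2 * x) ^ 2 ≤ (r * A x) ^ 2 := by
    have : A (r ^ 2 * x) ^ 2 * x ≤ (r * A x) ^ 2 * x := by nlinarith
    exact le_of_mul_le_mul_right this hx
  have h3 := h.pos hx.le
  exact le_of_sq_le_sq h2 (by positivity)
where
  le_of_sq_le_sq {a b : ℝ} (h : a ^ 2 ≤ b ^ 2) (hb : 0 ≤ b) : a ≤ b := abs_le_of_sq_le_sq' h hb |>.2

lemma GoodA.two (h : GoodA α A w c C a) {x : ℝ} (hx : 0 < x) : A (2 * x) ≤ 2 * A x :=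
  (h.mono (by positivity) (by nlinarith)).trans (h.scale hx (r := 2) (by norm_num))

end elem

/-- Abstract properties of the step distribution used in the renewal estimates. -/
structure Stp (A : ℝ → ℝ) (c : ℝ) (f : Cv) : Prop where
  mass_eq : Cv.mass f = 1
  low : ∀ z : ℤ, z ≠ 0 → ENNReal.ofReal (c / (z.natAbs * A z.natAbs)) ≤ f z
  tail : ∀ t : ℕ, 1 ≤ t → ∑' z : ℤ, (if t ≤ z.natAbs then f z else 0) ≤ ENNReal.ofReal (6 / A t)

section ren
variable {α : ℝ} {A : ℝ → ℝ} {w : ℕ → ℝ} {c C a : ℝ} {f : Cv}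

lemma blk_le (h : GoodA α A w c C a) (hf : Stp A c f) (q : ℕ) (hq : 1 ≤ q) :
    Cv.blk (ENNReal.ofReal (c / (4 * (q * A q)))) q ≤ f := by
  intro z
  rw [Cv.blk, Cv.pt_mul_apply]
  simp only [Cv.ind]
  split_ifs with hz
  · obtain ⟨n, rfl⟩ : ∃ n : ℕ, z = n := ⟨z.toNat, by omega⟩
    have hn : 1 ≤ n ∧ n ≤ 2 * q := by omega
    refine le_trans ?_ (hf.low n (by omega))
    rw [mul_one]
    apply ENNReal.ofReal_le_ofReal
    have hq0 : (0:ℝ) < q := by exact_mod_cast hq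
    have hn0 : (0:ℝ) < n := by exact_mod_cast hn.1
    have hn2 : (n:ℝ) ≤ 2 * q := by exact_mod_cast hn.2
    have hA := h.pos hn0.le
    have h1 : A n ≤ 2 * A q := (h.mono hn0.le hn2).trans (h.two hq0)
    have := h.c_pos
    simp only [Int.natAbs_natCast]
    apply div_le_div_of_nonneg_left this.le (by positivity)
    calc (n:ℝ) * A n ≤ (2 * q) * (2 * A q) := by gcongr
      _ = _ := by ring
  · simp

lemma exp_bound (h : GoodA α A w c C a) (hf : Stp A c f) (q : ℕ) (hq : 1 ≤ q) :
    ∃ R : Cv, R + Cv.blk (ENNReal.ofReal (c / (4 * (q * A q)))) q = f ∧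
      ∀ n : ℕ, Cv.mass R ^ n ≤ ENNReal.ofReal (Real.exp (-(c / 4 * (n / A q)))) := by
  obtain ⟨R, hR⟩ := Cv.exists_sub (blk_le h hf q hq)
  refine ⟨R, hR, fun n => ?_⟩
  have hq0 : (0:ℝ) < q := by exact_mod_cast hq
  have hA := h.pos hq0.le
  have hc := h.c_pos
  have h1 : Cv.mass R + ENNReal.ofReal (c / (4 * A q)) = 1 := by
    have := hf.mass_eq
    rw [← hR, map_add, Cv.mass_blk] at this
    rw [← this]; congr 1
    rw [show (q : ENNReal) = ENNReal.ofReal q by simp, ← ENNReal.ofReal_mul (by positivity)]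
    congr 1; field_simp
  have h2 : Cv.mass R ≤ ENNReal.ofReal (Real.exp (-(c / (4 * A q)))) := by
    have h3 : Cv.mass R = 1 - ENNReal.ofReal (c / (4 * A q)) :=
      ENNReal.eq_sub_of_add_eq (by simp) h1
    rw [h3, ← ENNReal.ofReal_one, ← ENNReal.ofReal_sub _ (by positivity)]
    apply ENNReal.ofReal_le_ofReal
    linarith [Real.add_one_le_exp (-(c / (4 * A q)))]
  calc Cv.mass R ^ n ≤ ENNReal.ofReal (Real.exp (-(c / (4 * A q)))) ^ n := by gcongr
    _ = ENNReal.ofReal (Real.exp (-(c / 4 * (n / A q)))) := by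
        rw [← ENNReal.ofReal_pow (by positivity), ← Real.exp_nat_mul]
        congr 2; field_simp

lemma L1 (h : GoodA α A w c C a) (hf : Stp A c f) (q : ℕ) (hq : 1 ≤ q) (n : ℕ) (φ : Cv) :
    (f ^ n * φ).sup ≤ ENNReal.ofReal (Real.exp (-(c / 4 * (n / A q)))) * φ.sup
      + (Cv.ind q * φ).sup / q := by
  obtain ⟨R, hR, hn⟩ := exp_bound h hf q hq
  have := Cv.master R _ q (by omega) (by rw [hR]; exact hf.mass_eq) n φ
  rw [hR] at this
  refine this.trans ?_
  gcongr; exact hn n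

lemma L2 (h : GoodA α A w c C a) (hf : Stp A c f) (q : ℕ) (hq : 1 ≤ q) (n : ℕ) (φ : Cv)
    (x : ℤ) (e : ℕ) :
    (f ^ n * φ) (x + e) ≤ (f ^ n * φ) x + (ENNReal.ofReal (Real.exp (-(c / 4 * (n / A q)))) * φ.sup
      + (Cv.ind e * φ).sup / q) := by
  obtain ⟨R, hR, hn⟩ := exp_bound h hf q hq
  have := Cv.master_shift R _ q (by omega) (by rw [hR]; exact hf.mass_eq) n φ x e
  rw [hR] at this
  refine this.trans ?_
  gcongr; exact hn n

lemma pow_sup_anti (hf : Cv.mass f = 1) (φ : Cv) {m n : ℕ} (hmn : m ≤ n) :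
    (f ^ n * φ).sup ≤ (f ^ m * φ).sup := by
  obtain ⟨k, rfl⟩ := Nat.exists_eq_add_of_le hmn
  have e : f ^ (m + k) * φ = f ^ k * (f ^ m * φ) := by ring
  rw [e]
  refine (Cv.sup_mul_le _ _).trans ?_
  rw [map_pow, hf, one_pow, one_mul]

lemma exp_neg_le {x : ℝ} (hx : 0 < x) : Real.exp (-x) ≤ 24 / x ^ 4 := by
  have := Real.pow_div_factorial_le_exp x hx.le 4
  rw [Real.exp_neg, ← one_div, div_le_div_iff₀ (by positivity) (by positivity)]
  norm_num [Nat.factorial] at this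
  linarith

lemma C3_aux (h : GoodA α A w c C a) (hf : Stp A c f) (d : ℕ) (hd : 1 ≤ d) (k : ℕ) :
    (f ^ (8 ^ k * ⌈A d⌉₊) * Cv.ind d).sup ≤
      ENNReal.ofReal ((24 / (c / 4) ^ 4 + 1) * (1 / 16) ^ k) := by
  have hd0 : (0:ℝ) < d := by exact_mod_cast hd
  have hA := h.pos hd0.le
  have hc := h.c_pos
  have hq : 1 ≤ 16 ^ k * d := Nat.one_le_iff_ne_zero.2 (by positivity)
  refine (L1 h hf (16 ^ k * d) hq _ _).trans ?_
  rw [add_mul, ENNReal.ofReal_add (by positivity) (by positivity)]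
  have hs : (Cv.ind d).sup ≤ 1 := Cv.sup_le fun z => Cv.ind_apply_le d z
  gcongr
  · refine (mul_le_mul' le_rfl hs).trans ?_
    rw [mul_one]
    apply ENNReal.ofReal_le_ofReal
    have hA2 : A (((16 ^ k * d : ℕ)):ℝ) ≤ 4 ^ k * A d := by
      have := h.scale hd0 (r := 4 ^ k) (one_le_pow₀ (by norm_num))
      have e : (((16 ^ k * d : ℕ)):ℝ) = ((4:ℝ) ^ k) ^ 2 * d := by
        push_cast; rw [← pow_mul, mul_comm k 2, pow_mul]; norm_num
      rw [e]; exact this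
    have hA3 := h.pos (Nat.cast_nonneg (16 ^ k * d) : (0:ℝ) ≤ _)
    have key : c / 4 * 2 ^ k ≤ c / 4 * (((8 ^ k * ⌈A d⌉₊ : ℕ) : ℝ) / A (((16 ^ k * d : ℕ)):ℝ)) := by
      gcongr
      rw [le_div_iff₀ hA3]
      have := Nat.le_ceil (A d)
      calc (2:ℝ) ^ k * A (((16 ^ k * d : ℕ)):ℝ) ≤ 2 ^ k * (4 ^ k * A d) := by gcongr
        _ = 8 ^ k * A d := by rw [← mul_assoc, ← mul_pow]; norm_num
        _ ≤ 8 ^ k * ⌈A d⌉₊ := by gcongr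
        _ = _ := by push_cast; ring
    calc Real.exp (-(c / 4 * (((8 ^ k * ⌈A d⌉₊ : ℕ) : ℝ) / A (((16 ^ k * d : ℕ)):ℝ))))
        ≤ Real.exp (-(c / 4 * 2 ^ k)) := by gcongr
      _ ≤ 24 / (c / 4 * 2 ^ k) ^ 4 := exp_neg_le (by positivity)
      _ = 24 / (c / 4) ^ 4 * (1 / 16) ^ k := by
        rw [mul_pow, ← pow_mul, mul_comm k 4, pow_mul, div_pow]; norm_num
        field_simp
        rw [← mul_pow]; norm_num
  · rw [one_mul]
    have h1 : (Cv.ind (16 ^ k * d) * Cv.ind d).sup ≤ d := by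
      rw [mul_comm]; refine (Cv.sup_mul_le _ _).trans ?_
      rw [Cv.mass_ind]
      calc (d : ENNReal) * (Cv.ind (16 ^ k * d)).sup ≤ d * 1 := by
            gcongr; exact Cv.sup_le fun z => Cv.ind_apply_le _ z
        _ = d := mul_one _
    refine (ENNReal.div_le_div_right h1 _).trans (le_of_eq ?_)
    rw [show ((d : ℕ) : ENNReal) = ENNReal.ofReal d by simp,
      show (((16 ^ k * d : ℕ)) : ENNReal) = ENNReal.ofReal ((16 ^ k * d : ℕ) : ℝ) by
        rw [ENNReal.ofReal_natCast],
      ← ENNReal.ofReal_div_of_pos (by push_cast; positivity)]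
    congr 1; push_cast
    rw [div_pow]; field_simp; simp

lemma C3 (h : GoodA α A w c C a) (hf : Stp A c f) (d : ℕ) (hd : 1 ≤ d) :
    (Cv.ind d * Cv.ren f).sup ≤ ENNReal.ofReal (2 * (1 + 16 * (24 / (c / 4) ^ 4 + 1)) * A d) := by
  have hd0 : (0:ℝ) < d := by exact_mod_cast hd
  have hA := h.pos hd0.le
  have hc := h.c_pos
  set g : ℕ → ENNReal := fun n => (f ^ n * Cv.ind d).sup with hg
  have hganti : ∀ ⦃m n : ℕ⦄, 0 < m → m ≤ n → g n ≤ g m := fun m n _ hmn =>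
    pow_sup_anti hf.mass_eq _ hmn
  have ha : 0 < ⌈A d⌉₊ := Nat.ceil_pos.2 hA
  have hu : StrictMono (fun k : ℕ => 8 ^ k * ⌈A d⌉₊) := by
    apply strictMono_nat_of_lt_succ; intro k
    have : 0 < 8 ^ k * ⌈A d⌉₊ := by positivity
    rw [pow_succ]; nlinarith
  have hsum := ENNReal.le_tsum_schlomilch hganti (u := fun k : ℕ => 8 ^ k * ⌈A d⌉₊)
    (fun n => by positivity) hu
  have hg1 : ∀ n, g n ≤ 1 := fun n => by
    refine (Cv.sup_mul_le _ _).trans ?_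
    rw [map_pow, hf.mass_eq, one_pow, one_mul]
    exact Cv.sup_le fun z => Cv.ind_apply_le d z
  have h1 : (Cv.ind d * Cv.ren f).sup ≤ ∑' n, g n := by
    apply Cv.sup_le; intro z
    rw [Cv.mul_ren_apply]
    refine ENNReal.tsum_le_tsum fun n => ?_
    rw [mul_comm]; exact Cv.le_sup _ _
  set D := 24 / (c / 4) ^ 4 + 1 with hD
  have hDp : 0 < D := by positivity
  have hce : (⌈A d⌉₊ : ℝ) ≤ 2 * A d := by
    have := Nat.ceil_lt_add_one hA.le
    linarith [h.four d hd0.le]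
  refine h1.trans (hsum.trans ?_)
  have hp1 : ∑ k ∈ Finset.range (8 ^ 0 * ⌈A d⌉₊), g k ≤ ENNReal.ofReal (2 * A d) := by
    calc _ ≤ ∑ k ∈ Finset.range (8 ^ 0 * ⌈A d⌉₊), 1 := Finset.sum_le_sum fun i _ => hg1 i
      _ = ENNReal.ofReal (⌈A d⌉₊ : ℝ) := by simp
      _ ≤ _ := ENNReal.ofReal_le_ofReal hce
  have hp2 : ∑' k : ℕ, ((((8 ^ (k + 1) * ⌈A d⌉₊ : ℕ)) : ENNReal) - ((8 ^ k * ⌈A d⌉₊ : ℕ) : ENNReal)) *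
      g (8 ^ k * ⌈A d⌉₊) ≤ ENNReal.ofReal (32 * D * A d) := by
    have hterm : ∀ k : ℕ, ((((8 ^ (k + 1) * ⌈A d⌉₊ : ℕ)) : ENNReal) - ((8 ^ k * ⌈A d⌉₊ : ℕ) : ENNReal)) *
      g (8 ^ k * ⌈A d⌉₊) ≤ ENNReal.ofReal (16 * D * A d * (1 / 2) ^ k) := by
      intro k
      calc _ ≤ (((8 ^ (k + 1) * ⌈A d⌉₊ : ℕ)) : ENNReal) * ENNReal.ofReal (D * (1 / 16) ^ k) := by
            gcongr
            · exact tsub_le_self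
            · exact C3_aux h hf d hd k
        _ = ENNReal.ofReal ((((8 ^ (k + 1) * ⌈A d⌉₊ : ℕ)) : ℝ) * (D * (1 / 16) ^ k)) := by
            rw [ENNReal.ofReal_mul (Nat.cast_nonneg _), ENNReal.ofReal_natCast]
        _ ≤ _ := by
            apply ENNReal.ofReal_le_ofReal
            have e : (8:ℝ) ^ k * (1 / 16) ^ k = (1 / 2) ^ k := by rw [← mul_pow]; norm_num
            push_cast
            calc (8:ℝ) ^ (k + 1) * ⌈A d⌉₊ * (D * (1 / 16) ^ k)
                = 8 * D * ⌈A d⌉₊ * ((8:ℝ) ^ k * (1 / 16) ^ k) := by ring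
              _ ≤ 8 * D * (2 * A d) * (1 / 2) ^ k := by rw [e]; gcongr
              _ = _ := by ring
    refine (ENNReal.tsum_le_tsum hterm).trans (le_of_eq ?_)
    rw [← ENNReal.ofReal_tsum_of_nonneg (fun k => by positivity)
      (summable_geometric_two.mul_left _), tsum_mul_left, tsum_geometric_two]
    congr 1; ring
  calc _ ≤ ENNReal.ofReal (2 * A d) + ENNReal.ofReal (32 * D * A d) := add_le_add hp1 hp2
    _ = _ := by rw [← ENNReal.ofReal_add (by positivity) (by positivity)]; congr 1; ring

/-- The constant in `C3`. -/
noncomputable def k3 (c : ℝ) : ℝ := 2 * (1 + 16 * (24 / (c / 4) ^ 4 + 1))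

lemma C3' (h : GoodA α A w c C a) (hf : Stp A c f) (d : ℕ) (hd : 1 ≤ d) (m : ℕ) :
    (Cv.ind d * (f ^ m * Cv.ren f)).sup ≤ ENNReal.ofReal (k3 c * A d) := by
  have e : Cv.ind d * (f ^ m * Cv.ren f) = f ^ m * (Cv.ind d * Cv.ren f) := by ring
  rw [e]
  refine (Cv.sup_mul_le _ _).trans ?_
  rw [map_pow, hf.mass_eq, one_pow, one_mul]
  exact C3 h hf d hd

lemma k3_pos (c : ℝ) : 0 < k3 c := by unfold k3; positivity

lemma C4_aux (h : GoodA α A w c C a) (hf : Stp A c f) : ∃ M : ℝ, 0 < M ∧ ∀ i : ℕ,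
    (f ^ ⌈M * A (2 ^ i)⌉₊ * Cv.ren f).sup ≤ ENNReal.ofReal (4 * k3 c * (A (2 ^ i) / 2 ^ i)) := by
  have hc := h.c_pos
  have hk := k3_pos c
  refine ⟨1 / c * (1 + 16 / c), by positivity, fun i => ?_⟩
  set M := 1 / c * (1 + 16 / c) with hM
  have hMp : 0 < M := by positivity
  induction i with
  | zero =>
    have h0 := C3' h hf 1 le_rfl ⌈M * A (2 ^ 0)⌉₊
    have e : Cv.ind 1 = 1 := Cv.cv_ext fun z => by
      simp only [Cv.ind, Cv.one_apply]
      by_cases hz : z = 0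
      · simp [hz]
      · rw [if_neg hz, if_neg (by push_cast; omega)]
    rw [e, one_mul] at h0
    refine h0.trans (ENNReal.ofReal_le_ofReal ?_)
    have := h.pos (x := 1) zero_le_one
    simp only [pow_zero, div_one, Nat.cast_one]
    nlinarith [mul_pos hk this]
  | succ i ih =>
    have hq1 : (1:ℝ) ≤ 2 ^ i := one_le_pow₀ (by norm_num)
    have hA := h.pos (x := 2 ^ i) (by positivity)
    have hA4 := h.four (2 ^ i) (by positivity)
    have hA' := h.dbl (2 ^ i) hq1
    rw [show (2:ℝ) * 2 ^ i = 2 ^ (i + 1) by ring] at hA'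
    have hAle : A (2 ^ i) ≤ A (2 ^ (i + 1)) := by nlinarith
    have hle : ⌈M * A (2 ^ i)⌉₊ ≤ ⌈M * A (2 ^ (i + 1))⌉₊ := Nat.ceil_mono (by gcongr)
    obtain ⟨n, hn⟩ := Nat.exists_eq_add_of_le hle
    have hn2 : 16 / c * A (2 ^ i) ≤ n := by
      have h1 := Nat.le_ceil (M * A (2 ^ (i + 1)))
      have h2 := Nat.ceil_lt_add_one (a := M * A (2 ^ i)) (by positivity)
      rw [hn] at h1; push_cast at h1
      have h3 : M * ((1 + c) * A (2 ^ i)) ≤ M * A (2 ^ (i + 1)) := by gcongr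
      have h4 : M * c = 1 + 16 / c := by rw [hM]; field_simp
      have h5 : M * ((1 + c) * A (2 ^ i)) = M * A (2 ^ i) + (1 + 16 / c) * A (2 ^ i) := by
        rw [← h4]; ring
      nlinarith
    rw [hn, pow_add, mul_comm (f ^ _), mul_assoc]
    have hL := L1 h hf (2 ^ i) Nat.one_le_two_pow n (f ^ ⌈M * A (2 ^ i)⌉₊ * Cv.ren f)
    have hI := C3' h hf (2 ^ i) Nat.one_le_two_pow ⌈M * A (2 ^ i)⌉₊
    refine hL.trans ?_
    push_cast at hI ⊢
    have hex : Real.exp (-(c / 4 * (n / A (2 ^ i)))) ≤ 1 / 4 := by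
      have : 4 ≤ c / 4 * (n / A (2 ^ i)) := by
        have : 16 / c ≤ n / A (2 ^ i) := by rw [le_div_iff₀ hA]; exact hn2
        calc 4 = c / 4 * (16 / c) := by field_simp; norm_num
          _ ≤ _ := by gcongr
      calc Real.exp (-(c / 4 * (n / A (2 ^ i)))) ≤ Real.exp (-4) := by gcongr
        _ ≤ 1 / 4 := by
          have h5 : (4:ℝ) ≤ Real.exp 4 := by linarith [Real.add_one_le_exp (4:ℝ)]
          rw [Real.exp_neg, ← one_div]
          exact one_div_le_one_div_of_le (by norm_num) h5
    calc _ ≤ ENNReal.ofReal (1 / 4) * ENNReal.ofReal (4 * k3 c * (A (2 ^ i) / 2 ^ i)) +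
          ENNReal.ofReal (k3 c * A (2 ^ i)) / ENNReal.ofReal (2 ^ i) := by
          gcongr
          rw [ENNReal.ofReal_pow (by norm_num)]; simp
      _ = ENNReal.ofReal (2 * k3 c * (A (2 ^ i) / 2 ^ i)) := by
          rw [← ENNReal.ofReal_mul (by norm_num), ← ENNReal.ofReal_div_of_pos (by positivity),
            ← ENNReal.ofReal_add (by positivity) (by positivity)]
          congr 1; ring
      _ ≤ _ := by
          apply ENNReal.ofReal_le_ofReal
          calc 2 * k3 c * (A (2 ^ i) / 2 ^ i) ≤ 2 * k3 c * (A (2 ^ (i+1)) / 2 ^ i) := by gcongr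
            _ = _ := by rw [pow_succ]; field_simp; ring

lemma C4 (h : GoodA α A w c C a) (hf : Stp A c f) (ε : ℝ) (hε : 0 < ε) : ∃ D X0 : ℝ, 0 < D ∧
    ∀ X : ℝ, X0 ≤ X → ∀ m : ℕ, ε * A X ≤ m →
      (f ^ m * Cv.ren f).sup ≤ ENNReal.ofReal (D * (A X / X)) := by
  obtain ⟨M, hM, hV⟩ := C4_aux h hf
  have hk := k3_pos c
  have hC := h.C_ge
  have ha := h.a_pos
  -- choose the ratio
  obtain ⟨ρ, hρ0, hρ1, hρ⟩ : ∃ ρ : ℝ, 0 < ρ ∧ ρ ≤ 1 ∧ M * (C * ρ ^ a) ≤ ε / 2 := by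
    have ht : Tendsto (fun ρ : ℝ => M * (C * ρ ^ a)) (𝓝[>] 0) (𝓝 0) := by
      have h1 : Tendsto (fun ρ : ℝ => ρ ^ a) (𝓝[>] 0) (𝓝 (0 ^ a)) :=
        ((Real.continuousAt_rpow_const 0 a (Or.inr ha.le)).tendsto).mono_left nhdsWithin_le_nhds
      rw [Real.zero_rpow ha.ne'] at h1
      simpa using (h1.const_mul C).const_mul M
    have e1 := ht.eventually (eventually_le_nhds (show (0:ℝ) < ε / 2 by positivity))
    have e2 : ∀ᶠ ρ : ℝ in 𝓝[>] 0, ρ ∈ Set.Ioc (0:ℝ) 1 := Ioc_mem_nhdsGT one_pos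
    obtain ⟨ρ, h1, h2⟩ := (e1.and e2).exists
    exact ⟨ρ, h2.1, h2.2, h1⟩
  obtain ⟨X1, hX1⟩ := (h.atop.eventually_ge_atTop (2 / ε)).exists_forall_of_atTop
  refine ⟨4 * k3 c * (2 / ρ), max X1 (1 / ρ), by positivity, fun X hX m hm => ?_⟩
  have hXρ : 1 ≤ ρ * X := by
    have := (le_max_right _ _).trans hX
    rw [div_le_iff₀ hρ0] at this; linarith
  have hX0 : 0 < X := by
    by_contra hh; push Not at hh; nlinarith
  obtain ⟨i, hi1, hi2⟩ : ∃ i : ℕ, (2:ℝ) ^ i ≤ ρ * X ∧ ρ * X < 2 ^ (i + 1) :=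
    exists_nat_pow_near hXρ one_lt_two
  have hXX : (2:ℝ) ^ i ≤ X := hi1.trans (by nlinarith)
  have hAX := h.pos hX0.le
  have h2i : (1:ℝ) ≤ 2 ^ i := one_le_pow₀ (by norm_num)
  have hA1 : A (2 ^ i) ≤ C * ρ ^ a * A X := by
    refine (h.small (2 ^ i) X h2i hXX).trans ?_
    gcongr
    rw [div_le_iff₀ hX0]; exact hi1
  have hm' : ⌈M * A (2 ^ i)⌉₊ ≤ m := by
    rw [Nat.ceil_le]
    have h3 : M * A (2 ^ i) ≤ ε / 2 * A X := by
      calc M * A (2 ^ i) ≤ M * (C * ρ ^ a * A X) := by gcongr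
        _ = M * (C * ρ ^ a) * A X := by ring
        _ ≤ _ := by gcongr
    nlinarith
  refine (pow_sup_anti hf.mass_eq _ hm').trans ((hV i).trans (ENNReal.ofReal_le_ofReal ?_))
  have hAm := h.mono (by positivity) hXX
  calc 4 * k3 c * (A (2 ^ i) / 2 ^ i) ≤ 4 * k3 c * (A X / (ρ * X / 2)) := by
        gcongr
        rw [pow_succ] at hi2; linarith
    _ = _ := by field_simp

end ren

namespace Cv

/-- restriction to `|z| ≥ t` -/
noncomputable def far (t : ℕ) (a : Cv) : Cv := ⟨fun z => if t ≤ z.natAbs then a z else 0⟩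

/-- restriction to `|z| < t` -/
noncomputable def near (t : ℕ) (a : Cv) : Cv := ⟨fun z => if t ≤ z.natAbs then 0 else a z⟩

lemma near_add_far (t : ℕ) (a : Cv) : near t a + far t a = a := cv_ext fun z => by
  rw [add_apply]; simp only [near, far]; split_ifs <;> simp

lemma far_mono (t : ℕ) {a b : Cv} (h : a ≤ b) : far t a ≤ far t b := by
  intro z; simp only [far]; split_ifs
  · exact h z
  · exact le_rfl

lemma far_add (t : ℕ) (a b : Cv) : far t (a + b) = far t a + far t b := cv_ext fun z => by
  simp only [far, add_apply]; split_ifs <;> simp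

lemma far_le (t : ℕ) (a : Cv) : far t a ≤ a := by
  intro z; simp only [far]; split_ifs <;> simp

lemma near_le (t : ℕ) (a : Cv) : near t a ≤ a := by
  intro z; simp only [near]; split_ifs <;> simp

/-- first absolute moment -/
noncomputable def mom (a : Cv) : ENNReal := ∑' z : ℤ, (z.natAbs : ENNReal) * a z

lemma mom_one : mom 1 = 0 := by
  unfold mom
  rw [ENNReal.tsum_eq_zero]; intro z
  by_cases hz : z = 0
  · simp [hz]
  · simp [one_apply, hz]

lemma mom_mul (a b : Cv) : mom (a * b) ≤ mom a * mass b + mass a * mom b := by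
  have key : mom (a * b) ≤ ∑' z : ℤ, ∑' y : ℤ, ((y.natAbs : ENNReal) * a y * b (z - y) +
      a y * (((z - y).natAbs : ENNReal) * b (z - y))) := by
    unfold mom
    refine ENNReal.tsum_le_tsum fun z => ?_
    rw [mul_apply, ← ENNReal.tsum_mul_left]
    refine ENNReal.tsum_le_tsum fun y => ?_
    have h1 : z.natAbs ≤ y.natAbs + (z - y).natAbs := by omega
    have h2 : (z.natAbs : ENNReal) ≤ y.natAbs + (z - y).natAbs := by exact_mod_cast h1
    calc (z.natAbs : ENNReal) * (a y * b (z - y))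
        ≤ (y.natAbs + (z - y).natAbs) * (a y * b (z - y)) := by gcongr
      _ = _ := by ring
  refine key.trans (le_of_eq ?_)
  simp_rw [ENNReal.tsum_add]
  congr 1
  · exact map_mul mass (⟨fun z => (z.natAbs : ENNReal) * a z⟩ : Cv) b
  · exact map_mul mass a (⟨fun z => (z.natAbs : ENNReal) * b z⟩ : Cv)

lemma mom_pow (a : Cv) (h : mass a ≤ 1) (n : ℕ) : mom (a ^ n) ≤ n * mom a := by
  induction n with
  | zero => simp [mom_one]
  | succ n ih =>
    rw [pow_succ]
    calc mom (a ^ n * a) ≤ mom (a ^ n) * mass a + mass (a ^ n) * mom a := mom_mul _ _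
      _ ≤ (n * mom a) * 1 + 1 * mom a := by
          gcongr; exact mass_pow_le h n
      _ = _ := by push_cast; ring

lemma mass_far_mul_le (t : ℕ) (a : Cv) : t * mass (far t a) ≤ mom a := by
  rw [mass_def, ← ENNReal.tsum_mul_left]
  refine ENNReal.tsum_le_tsum fun z => ?_
  simp only [far]
  split_ifs with h
  · gcongr
  · simp

lemma mom_near_le (t : ℕ) (a : Cv) : mom (near t a) ≤ ∑ j ∈ Finset.range t, mass (far (j + 1) a) := by
  simp_rw [mass_def]
  rw [← Summable.tsum_finsetSum (fun i _ => ENNReal.summable)]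
  refine ENNReal.tsum_le_tsum fun z => ?_
  simp only [near, far]
  split_ifs with h
  · simp
  · push Not at h
    calc (z.natAbs : ENNReal) * a z = ∑ j ∈ Finset.range z.natAbs, a z := by simp
      _ = ∑ j ∈ Finset.range z.natAbs, (if j + 1 ≤ z.natAbs then a z else 0) := by
          apply Finset.sum_congr rfl; intro j hj
          rw [if_pos]; exact Finset.mem_range.1 hj
      _ ≤ _ := Finset.sum_le_sum_of_subset fun j hj => by
          rw [Finset.mem_range] at *; omega

end Cv

lemma sum_inv_sqrt (t : ℕ) : ∑ j ∈ Finset.range t, 1 / Real.sqrt ((j:ℝ) + 1) ≤ 2 * Real.sqrt t := by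
  induction t with
  | zero => simp
  | succ t ih =>
    rw [Finset.sum_range_succ]; push_cast
    have h1 : 0 < Real.sqrt ((t:ℝ) + 1) := by positivity
    have h2 : 1 / Real.sqrt ((t:ℝ) + 1) ≤ 2 * Real.sqrt ((t:ℝ) + 1) - 2 * Real.sqrt t := by
      rw [div_le_iff₀ h1]
      have h3 := Real.sq_sqrt (show (0:ℝ) ≤ t + 1 by positivity)
      have h4 := Real.sq_sqrt (show (0:ℝ) ≤ t by positivity)
      nlinarith [sq_nonneg (Real.sqrt ((t:ℝ) + 1) - Real.sqrt t)]
    linarith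

section
variable {α : ℝ} {A : ℝ → ℝ} {w : ℕ → ℝ} {c C a : ℝ} {f : Cv}

lemma mom_bound (h : GoodA α A w c C a) (hf : Stp A c f) (t : ℕ) (ht : 1 ≤ t) :
    Cv.mom (Cv.near t f) ≤ ENNReal.ofReal (12 * C * (t / A t)) := by
  have hC := h.C_ge
  have ht0 : (0:ℝ) < t := by exact_mod_cast ht
  have hAt := h.pos ht0.le
  refine (Cv.mom_near_le t f).trans ?_
  calc ∑ j ∈ Finset.range t, Cv.mass (Cv.far (j + 1) f)
      ≤ ∑ j ∈ Finset.range t, ENNReal.ofReal (6 * (C * Real.sqrt t / A t) * (1 / Real.sqrt ((j:ℝ) + 1))) := by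
        apply Finset.sum_le_sum; intro j hj
        refine (hf.tail (j + 1) (by omega)).trans (ENNReal.ofReal_le_ofReal ?_)
        have hj0 : (0:ℝ) ≤ j := Nat.cast_nonneg j
        have hAj := h.pos hj0
        have h1 : A j ≤ A (j + 1 : ℕ) := h.mono hj0 (by push_cast; linarith)
        have h2 := h.sqb j t (Finset.mem_range.1 hj)
        rw [Real.sqrt_div ht0.le] at h2
        have hs : 0 < Real.sqrt ((j:ℝ) + 1) := by positivity
        have h3 : 1 / A j ≤ C * Real.sqrt t / A t * (1 / Real.sqrt ((j:ℝ) + 1)) := by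
          rw [div_le_iff₀ hAj]
          calc 1 = A t / A t := by field_simp
            _ ≤ (C * (Real.sqrt t / Real.sqrt ((j:ℝ) + 1)) * A j) / A t := by gcongr
            _ = _ := by ring
        calc 6 / A (j + 1 : ℕ) ≤ 6 / A j := by gcongr
          _ = 6 * (1 / A j) := by ring
          _ ≤ 6 * (C * Real.sqrt t / A t * (1 / Real.sqrt ((j:ℝ) + 1))) := by gcongr
          _ = _ := by ring
    _ = ENNReal.ofReal (6 * (C * Real.sqrt t / A t) * ∑ j ∈ Finset.range t, (1 / Real.sqrt ((j:ℝ) + 1))) := by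
        rw [Finset.mul_sum, ENNReal.ofReal_sum_of_nonneg]
        intro i _; positivity
    _ ≤ ENNReal.ofReal (6 * (C * Real.sqrt t / A t) * (2 * Real.sqrt t)) := by
        apply ENNReal.ofReal_le_ofReal
        gcongr; exact sum_inv_sqrt t
    _ = _ := by
        congr 1
        have := Real.mul_self_sqrt ht0.le
        calc _ = 12 * C * ((Real.sqrt t * Real.sqrt t) / A t) := by ring
          _ = _ := by rw [this]

lemma C5 (h : GoodA α A w c C a) (hf : Stp A c f) (n t : ℕ) (ht : 1 ≤ t) :
    Cv.mass (Cv.far t (f ^ n)) ≤ ENNReal.ofReal (18 * C * (n / A t)) := by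
  have hC := h.C_ge
  have ht0 : (0:ℝ) < t := by exact_mod_cast ht
  have hAt := h.pos ht0.le
  set f1 := Cv.near t f
  set f2 := Cv.far t f
  have e : f1 + f2 = f := Cv.near_add_far t f
  have hm1 : Cv.mass f1 ≤ 1 := by rw [← hf.mass_eq]; exact Cv.mass_mono (Cv.near_le t f)
  have h1 : Cv.mass (Cv.far t (f1 ^ n)) ≤ ENNReal.ofReal (12 * C * (n / A t)) := by
    have h2 : (t : ENNReal) * Cv.mass (Cv.far t (f1 ^ n)) ≤ t * ENNReal.ofReal (12 * C * (n / A t)) := by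
      calc (t : ENNReal) * Cv.mass (Cv.far t (f1 ^ n)) ≤ Cv.mom (f1 ^ n) := Cv.mass_far_mul_le _ _
        _ ≤ n * Cv.mom f1 := Cv.mom_pow f1 hm1 n
        _ ≤ n * ENNReal.ofReal (12 * C * (t / A t)) := by gcongr; exact mom_bound h hf t ht
        _ = ENNReal.ofReal (n * (12 * C * (t / A t))) := by
            rw [ENNReal.ofReal_mul (Nat.cast_nonneg n), ENNReal.ofReal_natCast]
        _ = ENNReal.ofReal (t * (12 * C * (n / A t))) := by congr 1; ring
        _ = _ := by rw [ENNReal.ofReal_mul (Nat.cast_nonneg t), ENNReal.ofReal_natCast]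
    exact (ENNReal.mul_le_mul_iff_right (by simp; omega) (by simp)).1 h2
  rw [← e, Cv.pow_split, Cv.far_add, map_add]
  have h3 : Cv.mass (Cv.far t (f2 * ∑ j ∈ Finset.range n, (f1 + f2) ^ (n - 1 - j) * f1 ^ j)) ≤
      ENNReal.ofReal (6 * (n / A t)) := by
    refine (Cv.mass_mono (Cv.far_le _ _)).trans ?_
    rw [map_mul, map_sum]
    calc _ ≤ ENNReal.ofReal (6 / A t) * ∑ j ∈ Finset.range n, 1 := by
          gcongr with j hj
          · exact hf.tail t ht
          · rw [map_mul, e, ← one_mul (1:ENNReal)]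
            exact mul_le_mul' (Cv.mass_pow_le hf.mass_eq.le _) (Cv.mass_pow_le hm1 _)
      _ = _ := by
          simp only [Finset.sum_const, Finset.card_range, nsmul_eq_mul, mul_one]
          rw [← ENNReal.ofReal_natCast, ← ENNReal.ofReal_mul (by positivity)]
          congr 1; ring
  refine (add_le_add h1 h3).trans ?_
  rw [← ENNReal.ofReal_add (by positivity) (by positivity)]
  apply ENNReal.ofReal_le_ofReal
  have : 0 ≤ (n:ℝ) / A t := by positivity
  nlinarith

/-- constant of C7 -/
noncomputable def k7 (C : ℝ) : ℝ := 1 / (4 * (1 + 18 * C))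

lemma C7_aux (h : GoodA α A w c C a) (hf : Stp A c f) (G B : Cv) (hGB : G + B = f)
    (hB0 : ∀ z : ℤ, z ≤ 0 → B z = 0) (s : ℕ) (hs : 1 ≤ s)
    (hBm : Cv.mass B ≤ ENNReal.ofReal (1 / A s)) (m : ℕ) (hm1 : 1 ≤ m) (hm : (m:ℝ) ≤ k7 C * A s) :
    (m : ENNReal) * ENNReal.ofReal (c / (8 * (s * A s))) ≤ (G ^ m) (-s) := by
  have hC := h.C_ge
  have hc := h.c_pos
  have hc2 := h.c_le
  have hs0 : (0:ℝ) < s := by exact_mod_cast hs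
  have hAs := h.pos hs0.le
  have hA4 := h.four s hs0.le
  set κ := c / (4 * (s * A s)) with hκ
  have hκ0 : 0 < κ := by positivity
  set t := s / 2 + 1 with ht
  set D : Cv := ⟨fun z => if (z + s).natAbs < t then ENNReal.ofReal κ else 0⟩ with hD
  have hDG : D ≤ G := by
    intro z
    simp only [hD]
    split_ifs with hz
    · have hz1 : z < 0 := by omega
      have hG : G z = f z := by rw [← hGB, Cv.add_apply, hB0 z hz1.le, add_zero]
      rw [hG]
      refine le_trans ?_ (hf.low z hz1.ne)
      apply ENNReal.ofReal_le_ofReal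
      have hn1 : 0 < z.natAbs := by omega
      have hn2 : z.natAbs ≤ 2 * s := by omega
      have hn1' : (0:ℝ) < z.natAbs := by exact_mod_cast hn1
      have hn2' : (z.natAbs:ℝ) ≤ 2 * s := by exact_mod_cast hn2
      have hA := h.pos hn1'.le
      have h1 : A z.natAbs ≤ 2 * A s := (h.mono hn1'.le hn2').trans (h.two hs0)
      apply div_le_div_of_nonneg_left hc.le (by positivity)
      calc (z.natAbs:ℝ) * A z.natAbs ≤ (2 * s) * (2 * A s) := by gcongr
        _ = _ := by ring
    · simp
  have hDm : Cv.mass D ≤ ENNReal.ofReal (1 / A s) := by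
    have h1 : Cv.mass D ≤ (2 * s + 2 : ℕ) * ENNReal.ofReal κ := by
      rw [Cv.mass_def, tsum_eq_sum (s := Finset.Icc (-(s:ℤ) - (t - 1)) (-s + (t - 1)))]
      · calc _ ≤ ∑ z ∈ Finset.Icc (-(s:ℤ) - (t - 1)) (-s + (t - 1)), ENNReal.ofReal κ := by
              apply Finset.sum_le_sum; intro z _; simp only [hD]; split_ifs <;> simp
          _ = _ := by rw [Finset.sum_const, nsmul_eq_mul]
          _ ≤ _ := by
              gcongr
              rw [Int.card_Icc]; omega
      · intro z hz
        simp only [hD]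
        rw [if_neg]
        intro hh; apply hz; rw [Finset.mem_Icc]; omega
    refine h1.trans ?_
    rw [← ENNReal.ofReal_natCast, ← ENNReal.ofReal_mul (by positivity)]
    apply ENNReal.ofReal_le_ofReal
    have hs1 : (1:ℝ) ≤ s := by exact_mod_cast hs
    push_cast
    rw [hκ, ← mul_div_assoc, div_le_div_iff₀ (by positivity) hAs]
    have : (2 * s + 2) * c ≤ 4 * s := by nlinarith
    nlinarith
  obtain ⟨G', hG'⟩ := Cv.exists_sub hDG
  have hm0 : Cv.mass G' + (Cv.mass D + Cv.mass B) = 1 := by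
    rw [← hf.mass_eq, ← hGB, ← hG', map_add, map_add]; ring
  have hGm : ENNReal.ofReal (1 - 2 / A s) ≤ Cv.mass G' := by
    have h2 : Cv.mass D + Cv.mass B ≤ ENNReal.ofReal (2 / A s) := by
      refine (add_le_add hDm hBm).trans ?_
      rw [← ENNReal.ofReal_add (by positivity) (by positivity)]
      apply ENNReal.ofReal_le_ofReal; apply le_of_eq; ring
    rw [ENNReal.ofReal_sub _ (by positivity), ENNReal.ofReal_one, tsub_le_iff_right, ← hm0]
    gcongr
  have hG'f : G' ≤ f := by
    rw [← hGB, ← hG', add_assoc]; exact Cv.le_add_right _ _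
  have hmA : (m:ℝ) / A s ≤ k7 C := by rw [div_le_iff₀ hAs]; exact hm
  have hk7 : (1 + 18 * C) * k7 C = 1 / 4 := by unfold k7; field_simp
  have hmass : ENNReal.ofReal (1 / 2) ≤ Cv.mass (Cv.near t (G' ^ (m - 1))) := by
    have h1 : ENNReal.ofReal (1 - 2 * (m / A s)) ≤ Cv.mass (G' ^ (m - 1)) := by
      rw [map_pow]
      have h2A : 2 / A s ≤ 1 / 2 := by rw [div_le_iff₀ hAs]; linarith
      calc ENNReal.ofReal (1 - 2 * (m / A s)) ≤ ENNReal.ofReal ((1 - 2 / A s) ^ (m - 1)) := by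
            apply ENNReal.ofReal_le_ofReal
            have hb := one_add_mul_le_pow (a := -(2 / A s)) (by linarith) (m - 1)
            have hm2 : ((m - 1 : ℕ) : ℝ) ≤ m := by exact_mod_cast Nat.sub_le m 1
            have : ((m - 1 : ℕ) : ℝ) * (2 / A s) ≤ m * (2 / A s) := by gcongr
            have e2 : (m:ℝ) * (2 / A s) = 2 * (m / A s) := by ring
            rw [sub_eq_add_neg 1 (2 / A s)]
            linarith
        _ = ENNReal.ofReal (1 - 2 / A s) ^ (m - 1) := ENNReal.ofReal_pow (by linarith) _
        _ ≤ _ := by gcongr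
    have h2 : Cv.mass (Cv.far t (G' ^ (m - 1))) ≤ ENNReal.ofReal (36 * C * (m / A s)) := by
      refine (Cv.mass_mono (Cv.far_mono t (Cv.pow_mono hG'f _))).trans ?_
      refine (C5 h hf (m - 1) t (by omega)).trans (ENNReal.ofReal_le_ofReal ?_)
      have ht0 : (0:ℝ) < t := by rw [ht]; positivity
      have hst : (s:ℝ) ≤ 2 * t := by
        have : s ≤ 2 * t := by omega
        exact_mod_cast this
      have hAt := h.pos ht0.le
      have hA2 : A s ≤ 2 * A t := (h.mono hs0.le hst).trans (h.two ht0)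
      have hm2 : ((m - 1 : ℕ) : ℝ) ≤ m := by exact_mod_cast Nat.sub_le m 1
      calc 18 * C * (((m - 1 : ℕ) : ℝ) / A t) ≤ 18 * C * ((m : ℝ) / (A s / 2)) := by
            gcongr; linarith
        _ = _ := by field_simp; ring
    have h3 : ENNReal.ofReal (1 / 2) + ENNReal.ofReal (36 * C * (m / A s)) ≤
        Cv.mass (Cv.near t (G' ^ (m - 1))) + ENNReal.ofReal (36 * C * (m / A s)) := by
      rw [← ENNReal.ofReal_add (by norm_num) (by positivity)]
      calc ENNReal.ofReal (1 / 2 + 36 * C * (m / A s)) ≤ ENNReal.ofReal (1 - 2 * (m / A s)) := by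
            apply ENNReal.ofReal_le_ofReal
            have : (1 + 18 * C) * (m / A s) ≤ (1 + 18 * C) * k7 C := by gcongr
            linarith
        _ ≤ Cv.mass (G' ^ (m - 1)) := h1
        _ = Cv.mass (Cv.near t (G' ^ (m - 1))) + Cv.mass (Cv.far t (G' ^ (m - 1))) := by
            rw [← map_add, Cv.near_add_far]
        _ ≤ _ := by gcongr
    exact (ENNReal.add_le_add_iff_right ENNReal.ofReal_ne_top).1 h3
  have hlow : ENNReal.ofReal (c / (8 * (s * A s))) ≤ (G' ^ (m - 1) * D) (-s) := by
    rw [Cv.mul_apply]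
    calc ENNReal.ofReal (c / (8 * (s * A s))) = ENNReal.ofReal (1 / 2) * ENNReal.ofReal κ := by
          rw [← ENNReal.ofReal_mul (by norm_num)]; congr 1; rw [hκ]; field_simp; norm_num
      _ ≤ Cv.mass (Cv.near t (G' ^ (m - 1))) * ENNReal.ofReal κ := by gcongr
      _ = ∑' y, (Cv.near t (G' ^ (m - 1))) y * ENNReal.ofReal κ := by
          rw [Cv.mass_def, ENNReal.tsum_mul_right]
      _ ≤ _ := by
          refine ENNReal.tsum_le_tsum fun y => ?_
          simp only [Cv.near, hD]
          split_ifs with h1 h2 h2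
          · simp
          · simp
          · exact le_rfl
          · exfalso; omega
  calc _ ≤ (m : ENNReal) * (G' ^ (m - 1) * D) (-s) := by gcongr
    _ ≤ ((G' + D) ^ m) (-s) := Cv.pow_add_ge G' D m _
    _ = _ := by rw [hG']

lemma sum_sq_ge (p : ℕ) : (p:ℝ) ^ 3 / 3 ≤ ∑ m ∈ Finset.range (p + 1), (m:ℝ) ^ 2 := by
  induction p with
  | zero => simp
  | succ p ih =>
    rw [Finset.sum_range_succ]; push_cast
    have : (0:ℝ) ≤ p := Nat.cast_nonneg p
    nlinarith

lemma C7_one (h : GoodA α A w c C a) (hf : Stp A c f) (G B : Cv) (hGB : G + B = f)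
    (hB0 : ∀ z : ℤ, z ≤ 0 → B z = 0) (s : ℕ) (hs : 1 ≤ s)
    (hBm : Cv.mass B ≤ ENNReal.ofReal (1 / A s)) (hsA : 1 ≤ k7 C * A s) (N : ℕ)
    (hN : k7 C * A s + 2 ≤ N) :
    ENNReal.ofReal (k7 C ^ 3 * c / 192 * (A s ^ 2 / s)) ≤
      ∑ n ∈ Finset.range N, (n : ENNReal) * (G ^ (n - 1)) (-s) := by
  have hC := h.C_ge
  have hc := h.c_pos
  have hs0 : (0:ℝ) < s := by exact_mod_cast hs
  have hAs := h.pos hs0.le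
  set p := ⌊k7 C * A s⌋₊ with hp
  have hp1 : (p:ℝ) ≤ k7 C * A s := Nat.floor_le (by linarith)
  have hp2 : k7 C * A s / 2 ≤ p := by
    have h1 := Nat.lt_floor_add_one (k7 C * A s)
    have h2 : 1 ≤ p := (Nat.one_le_floor_iff _).2 hsA
    have h2' : (1:ℝ) ≤ p := by exact_mod_cast h2
    rw [← hp] at h1; linarith
  have hpN : p + 2 ≤ N := by
    have : ((p + 2 : ℕ) : ℝ) ≤ N := by push_cast; linarith
    exact_mod_cast this
  calc ENNReal.ofReal (k7 C ^ 3 * c / 192 * (A s ^ 2 / s))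
      ≤ ENNReal.ofReal (∑ m ∈ Finset.range (p + 1), (m:ℝ) ^ 2 * (c / (8 * (s * A s)))) := by
        apply ENNReal.ofReal_le_ofReal
        rw [← Finset.sum_mul]
        calc k7 C ^ 3 * c / 192 * (A s ^ 2 / s) = (k7 C * A s / 2) ^ 3 / 3 * (c / (8 * (s * A s))) := by
              field_simp; ring
          _ ≤ (p:ℝ) ^ 3 / 3 * (c / (8 * (s * A s))) := by
              have : 0 ≤ k7 C * A s / 2 := by linarith
              gcongr
          _ ≤ _ := by gcongr; exact sum_sq_ge p
    _ = ∑ m ∈ Finset.range (p + 1), ENNReal.ofReal ((m:ℝ) ^ 2 * (c / (8 * (s * A s)))) :=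
        ENNReal.ofReal_sum_of_nonneg fun i _ => by positivity
    _ ≤ ∑ m ∈ Finset.range (p + 1), ((m + 1 : ℕ) : ENNReal) * (G ^ (m + 1 - 1)) (-s) := by
        apply Finset.sum_le_sum; intro m hm
        have hmp : m ≤ p := by have := Finset.mem_range.1 hm; omega
        rcases Nat.eq_zero_or_pos m with rfl | hm0
        · simp
        · have hmp' : (m:ℝ) ≤ k7 C * A s := le_trans (by exact_mod_cast hmp) hp1
          have h1 := C7_aux h hf G B hGB hB0 s hs hBm m hm0 hmp'
          rw [Nat.add_sub_cancel]
          calc ENNReal.ofReal ((m:ℝ) ^ 2 * (c / (8 * (s * A s)))) =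
                m * (m * ENNReal.ofReal (c / (8 * (s * A s)))) := by
                rw [ENNReal.ofReal_mul (by positivity), ENNReal.ofReal_pow (by positivity),
                  ENNReal.ofReal_natCast]; ring
            _ ≤ ((m + 1 : ℕ) : ENNReal) * (G ^ m) (-s) := by
                gcongr; omega
    _ ≤ ∑ n ∈ Finset.range (p + 2), (n : ENNReal) * (G ^ (n - 1)) (-s) := by
        rw [Finset.sum_range_succ' _ (p + 1)]; simp
    _ ≤ _ := Finset.sum_le_sum_of_subset (by
        intro i hi; rw [Finset.mem_range] at *; omega)

lemma C7 (h : GoodA α A w c C a) (hf : Stp A c f) (G B : Cv) (hGB : G + B = f)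
    (hB0 : ∀ z : ℤ, z ≤ 0 → B z = 0) (S : Finset ℕ) (b : ℕ → ℝ) (x : ℤ)
    (hb : ∀ s ∈ S, 0 ≤ b s ∧ B (x + s) = ENNReal.ofReal (b s))
    (hS : ∀ s ∈ S, 1 ≤ s ∧ Cv.mass B ≤ ENNReal.ofReal (1 / A s) ∧ 1 ≤ k7 C * A s) (N : ℕ)
    (hN : ∀ s ∈ S, k7 C * A s + 2 ≤ N) :
    ENNReal.ofReal (k7 C ^ 3 * c / 192 * ∑ s ∈ S, A s ^ 2 / s * b s) ≤
      ∑ n ∈ Finset.range N, (f ^ n) x := by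
  have hC := h.C_ge
  have hc := h.c_pos
  have hk : 0 < k7 C := by unfold k7; positivity
  calc ENNReal.ofReal (k7 C ^ 3 * c / 192 * ∑ s ∈ S, A s ^ 2 / s * b s)
      = ∑ s ∈ S, ENNReal.ofReal (k7 C ^ 3 * c / 192 * (A s ^ 2 / s)) * B (x + s) := by
        rw [Finset.mul_sum, ENNReal.ofReal_sum_of_nonneg]
        · apply Finset.sum_congr rfl; intro s hs
          rw [(hb s hs).2, ← ENNReal.ofReal_mul (by positivity)]
          congr 1; ring
        · intro s hs; have := (hb s hs).1; positivity
    _ ≤ ∑ s ∈ S, (∑ n ∈ Finset.range N, (n : ENNReal) * (G ^ (n - 1)) (-s)) * B (x + s) := by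
        apply Finset.sum_le_sum; intro s hs
        gcongr
        obtain ⟨h1, h2, h3⟩ := hS s hs
        exact C7_one h hf G B hGB hB0 s h1 h2 h3 N (hN s hs)
    _ = ∑ n ∈ Finset.range N, (n : ENNReal) * ∑ s ∈ S, (G ^ (n - 1)) (-s) * B (x + s) := by
        simp_rw [Finset.sum_mul, Finset.mul_sum]
        rw [Finset.sum_comm]
        simp_rw [mul_assoc]
    _ ≤ ∑ n ∈ Finset.range N, (n : ENNReal) * (G ^ (n - 1) * B) x := by
        gcongr with n hn
        rw [Cv.mul_apply]
        calc ∑ s ∈ S, (G ^ (n - 1)) (-s) * B (x + s)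
            = ∑ y ∈ S.image (fun s : ℕ => -(s:ℤ)), (G ^ (n - 1)) y * B (x - y) := by
              rw [Finset.sum_image]
              · apply Finset.sum_congr rfl; intro s _; rw [sub_neg_eq_add]
              · intro i _ j _ hij; simpa using hij
          _ ≤ _ := ENNReal.sum_le_tsum _
    _ ≤ _ := by
        gcongr with n hn
        rw [← hGB]; exact Cv.pow_add_ge G B n x

end

/-- normaliser of the bump profile -/
noncomputable def Zf (A : ℝ → ℝ) (w : ℕ → ℝ) (s0 L : ℕ) : ℝ :=
  ∑ s ∈ Finset.Icc s0 L, A s ^ 2 / s * w s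

/-- total mass of the normalised bump profile -/
noncomputable def mf (A : ℝ → ℝ) (w : ℕ → ℝ) (s0 L : ℕ) : ℝ :=
  (∑ s ∈ Finset.Icc s0 L, w s) / Zf A w s0 L

/-- normalised bump profile -/
noncomputable def wbf (A : ℝ → ℝ) (w : ℕ → ℝ) (s0 L : ℕ) (z : ℤ) : ℝ :=
  if (s0:ℤ) ≤ z ∧ z ≤ L then w z.toNat / Zf A w s0 L else 0

/-- left end of block `k` -/
def Xf (d : ℕ → ℕ) (k : ℕ) : ℕ := (k + 1) * d k

/-- Properties of the block parameters. -/
structure Bl (A : ℝ → ℝ) (w : ℕ → ℝ) (C : ℝ) (s0 : ℕ) (L d : ℕ → ℕ) : Prop where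
  s0_pos : 1 ≤ s0
  s0_A : ∀ s : ℕ, s0 ≤ s → 1 ≤ k7 C * A s
  Z_ge : ∀ k : ℕ, (k:ℝ) + 1 ≤ Zf A w s0 (L k)
  dL : ∀ k, 2 * L k < d k
  sep : ∀ k, 16 * Xf d k ≤ Xf d (k + 1)
  massb : ∀ k : ℕ, ((k:ℝ) + 1) * (A (Xf d k) / Xf d k) * mf A w s0 (L k) * A (2 * Xf d k)
    ≤ (1 / 2) ^ (k + 3)
  kd : ∀ k : ℕ, ∀ Y : ℝ, (d k : ℝ) / 2 ≤ Y →
    ((k:ℝ) + 1) * mf A w s0 (L k) * (A Y ^ 2 / Y) ≤ 1 / ((k:ℝ) + 1)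
  AL : ∀ k : ℕ, ((k:ℝ) + 1) * A (L k) ≤ A (Xf d k)

section
variable {α : ℝ} {A : ℝ → ℝ} {w : ℕ → ℝ} {c C a : ℝ}

lemma k7_pos (h : GoodA α A w c C a) : 0 < k7 C := by
  have := h.C_ge; unfold k7; positivity

lemma exists_L (h : GoodA α A w c C a) (s0 : ℕ) (k : ℕ) : ∃ L : ℕ, (k:ℝ) + 1 ≤ Zf A w s0 L := by
  by_contra hh
  push Not at hh
  apply h.w_div
  have hnn : ∀ s : ℕ, 0 ≤ A s ^ 2 / s * w s := fun s => by
    have := h.w_pos s; positivity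
  refine summable_of_sum_range_le (c := ∑ s ∈ Finset.range s0, A s ^ 2 / s * w s + (k + 1)) hnn fun n => ?_
  calc ∑ s ∈ Finset.range n, A s ^ 2 / s * w s
      ≤ ∑ s ∈ Finset.range s0 ∪ Finset.Icc s0 n, A s ^ 2 / s * w s := by
        apply Finset.sum_le_sum_of_subset_of_nonneg
        · intro i hi; simp only [Finset.mem_union, Finset.mem_range, Finset.mem_Icc] at *; omega
        · intro i _ _; exact hnn i
    _ = ∑ s ∈ Finset.range s0, A s ^ 2 / s * w s + Zf A w s0 n := by
        rw [Finset.sum_union, Zf]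
        rw [Finset.disjoint_left]; intro i hi hi'
        simp only [Finset.mem_range, Finset.mem_Icc] at *; omega
    _ ≤ _ := by linarith [(hh n).le]

lemma mf_nonneg (h : GoodA α A w c C a) (s0 L : ℕ) : 0 ≤ mf A w s0 L := by
  unfold mf Zf
  apply div_nonneg
  · exact Finset.sum_nonneg fun i _ => (h.w_pos i).le
  · exact Finset.sum_nonneg fun i _ => by have := (h.w_pos i).le; positivity

lemma exists_Bl (h : GoodA α A w c C a) : ∃ s0 L d, Bl A w C s0 L d := by
  have hk7 := k7_pos h
  obtain ⟨s1, hs1⟩ := (h.atop.eventually_ge_atTop (1 / k7 C)).exists_forall_of_atTop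
  set s0 := max 1 ⌈s1⌉₊ with hs0
  have hs0A : ∀ s : ℕ, s0 ≤ s → 1 ≤ k7 C * A s := by
    intro s hs
    have h1 : s1 ≤ (s:ℝ) := (Nat.le_ceil s1).trans (by exact_mod_cast (le_max_right _ _).trans hs)
    have := hs1 _ h1
    rw [div_le_iff₀ hk7] at this; linarith
  choose L hL using exists_L h s0
  have hp16 : Tendsto (fun e : ℕ => ((16:ℝ) ^ e)) atTop atTop :=
    tendsto_pow_atTop_atTop_of_one_lt (by norm_num)
  have hev : ∀ k : ℕ, ∀ᶠ e : ℕ in atTop,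
      (2 * (L k:ℝ) < 16 ^ e) ∧
      (A ((k + 1) * 16 ^ e) ^ 2 / ((k + 1) * 16 ^ e) ≤
        (1 / 2) ^ (k + 3) / (2 * (k + 1) * (mf A w s0 (L k) + 1))) ∧
      (A (16 ^ e / 2) ^ 2 / (16 ^ e / 2) ≤ 1 / ((k + 1) ^ 2 * (mf A w s0 (L k) + 1))) ∧
      (((k:ℝ) + 1) * A (L k) ≤ A ((k + 1) * 16 ^ e)) := by
    intro k
    have hm := mf_nonneg h s0 (L k)
    have hX : Tendsto (fun e : ℕ => ((k:ℝ) + 1) * (16:ℝ) ^ e) atTop atTop :=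
      hp16.const_mul_atTop (by positivity)
    have hd2 : Tendsto (fun e : ℕ => (16:ℝ) ^ e / 2) atTop atTop :=
      hp16.atTop_div_const (by norm_num)
    refine (hp16.eventually_gt_atTop _).and (((h.kzero.comp hX).eventually
      (eventually_le_nhds ?_)).and (((h.kzero.comp hd2).eventually
      (eventually_le_nhds ?_)).and ((h.atop.comp hX).eventually_ge_atTop _)))
    · positivity
    · positivity
  obtain ⟨φ, hφ, hφ'⟩ := extraction_forall_of_eventually hev
  refine ⟨s0, L, fun k => 16 ^ φ k, le_max_left _ _, hs0A, hL, ?_, ?_, ?_, ?_, ?_⟩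
  · intro k; have := (hφ' k).1; exact_mod_cast this
  · intro k
    simp only [Xf]
    have h1 : φ k + 1 ≤ φ (k + 1) := hφ (Nat.lt_succ_self k)
    have h2 : 16 ^ (φ k + 1) ≤ 16 ^ φ (k + 1) := Nat.pow_le_pow_right (by norm_num) h1
    rw [pow_succ] at h2
    calc 16 * ((k + 1) * 16 ^ φ k) = (k + 1) * (16 ^ φ k * 16) := by ring
      _ ≤ (k + 1 + 1) * 16 ^ φ (k + 1) := Nat.mul_le_mul (by omega) h2
  · intro k
    have hb := (hφ' k).2.1
    have hm := mf_nonneg h s0 (L k)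
    have e : ((Xf (fun k => 16 ^ φ k) k : ℕ) : ℝ) = (k + 1) * 16 ^ φ k := by simp [Xf]
    rw [e]
    set X : ℝ := (k + 1) * 16 ^ φ k with hX
    have hXp : 0 < X := by positivity
    have hAX := h.pos hXp.le
    have h2 := h.two hXp
    calc ((k:ℝ) + 1) * (A X / X) * mf A w s0 (L k) * A (2 * X)
        ≤ ((k:ℝ) + 1) * (A X / X) * mf A w s0 (L k) * (2 * A X) := by gcongr
      _ = (A X ^ 2 / X) * (2 * (k + 1) * mf A w s0 (L k)) := by ring
      _ ≤ (1 / 2) ^ (k + 3) / (2 * (k + 1) * (mf A w s0 (L k) + 1)) *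
          (2 * (k + 1) * (mf A w s0 (L k) + 1)) := by
          gcongr; linarith
      _ = _ := by field_simp
  · intro k Y hY
    have hb := (hφ' k).2.2.1
    have hm := mf_nonneg h s0 (L k)
    push_cast at hY
    have hdp : (0:ℝ) < 16 ^ φ k / 2 := by positivity
    have hYp : 0 < Y := by linarith
    have h1 : A Y ^ 2 / Y ≤ A (16 ^ φ k / 2) ^ 2 / (16 ^ φ k / 2) := by
      rw [div_le_div_iff₀ hYp hdp]; exact h.kanti _ _ hdp hY
    calc ((k:ℝ) + 1) * mf A w s0 (L k) * (A Y ^ 2 / Y)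
        ≤ ((k:ℝ) + 1) * (mf A w s0 (L k) + 1) * (1 / ((k + 1) ^ 2 * (mf A w s0 (L k) + 1))) := by
          apply mul_le_mul _ (h1.trans hb) (by positivity) (by positivity)
          gcongr; linarith
      _ = _ := by field_simp
  · intro k
    have e : ((Xf (fun k => 16 ^ φ k) k : ℕ) : ℝ) = (k + 1) * 16 ^ φ k := by simp [Xf]
    rw [e]; exact (hφ' k).2.2.2

end

/-- block `k` of bumps -/
noncomputable def Gk (A : ℝ → ℝ) (w : ℕ → ℝ) (s0 : ℕ) (L d : ℕ → ℕ) (k : ℕ) (z : ℤ) : ℝ :=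
  A (Xf d k) / Xf d k * ∑ j ∈ Finset.range (k + 1), wbf A w s0 (L k) (z - (Xf d k + j * d k : ℕ))

/-- all bumps -/
noncomputable def gg (A : ℝ → ℝ) (w : ℕ → ℝ) (s0 : ℕ) (L d : ℕ → ℕ) (z : ℤ) : ℝ :=
  ∑ k ∈ Finset.range z.toNat, Gk A w s0 L d k z

section
variable {α : ℝ} {A : ℝ → ℝ} {w : ℕ → ℝ} {c C a : ℝ} {s0 : ℕ} {L d : ℕ → ℕ}

lemma Zf_pos (hB : Bl A w C s0 L d) (k : ℕ) : 0 < Zf A w s0 (L k) := by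
  have := hB.Z_ge k
  have h0 : (0:ℝ) ≤ k := Nat.cast_nonneg k
  linarith

lemma wbf_nonneg (h : GoodA α A w c C a) (s0 L : ℕ) (z : ℤ) : 0 ≤ wbf A w s0 L z := by
  unfold wbf
  split_ifs
  · apply div_nonneg (h.w_pos _).le
    exact Finset.sum_nonneg fun i _ => by have := (h.w_pos i).le; positivity
  · exact le_rfl

lemma wbf_nat {s0 L s : ℕ} (hs : s ∈ Finset.Icc s0 L) : wbf A w s0 L s = w s / Zf A w s0 L := by
  rw [Finset.mem_Icc] at hs
  unfold wbf
  rw [if_pos (by omega)]; simp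

lemma wbf_zero {s0 L : ℕ} {z : ℤ} (hz : ¬ ((s0:ℤ) ≤ z ∧ z ≤ L)) : wbf A w s0 L z = 0 := if_neg hz

lemma Bl.d_pos (hB : Bl A w C s0 L d) (k : ℕ) : 0 < d k := by have := hB.dL k; omega

lemma Bl.X_pos (hB : Bl A w C s0 L d) (k : ℕ) : 0 < Xf d k :=
  Nat.mul_pos (by omega) (hB.d_pos k)

lemma Bl.X_gt (hB : Bl A w C s0 L d) (k : ℕ) : k < Xf d k :=
  Nat.lt_of_lt_of_le (Nat.lt_succ_self k) (Nat.le_mul_of_pos_right _ (hB.d_pos k))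

lemma Bl.sep' (hB : Bl A w C s0 L d) {k l : ℕ} (hkl : k < l) : 16 * Xf d k ≤ Xf d l := by
  induction l, hkl using Nat.le_induction with
  | base => exact hB.sep k
  | succ n _ ih => have := hB.sep n; omega

lemma Gk_nonneg (h : GoodA α A w c C a) (k : ℕ) (z : ℤ) : 0 ≤ Gk A w s0 L d k z := by
  unfold Gk
  have := h.pos (Nat.cast_nonneg (Xf d k) : (0:ℝ) ≤ _)
  have h2 : 0 ≤ ∑ j ∈ Finset.range (k + 1), wbf A w s0 (L k) (z - (Xf d k + j * d k : ℕ)) :=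
    Finset.sum_nonneg fun j _ => wbf_nonneg h _ _ _
  positivity

lemma Gk_supp (hB : Bl A w C s0 L d) {k : ℕ} {z : ℤ} (hz : Gk A w s0 L d k z ≠ 0) :
    (Xf d k : ℤ) < z ∧ z < 2 * Xf d k := by
  unfold Gk at hz
  obtain ⟨j, hj, hne⟩ := Finset.exists_ne_zero_of_sum_ne_zero (right_ne_zero_of_mul hz)
  have hj' := Finset.mem_range.1 hj
  have h1 : (s0:ℤ) ≤ z - (Xf d k + j * d k : ℕ) ∧ z - (Xf d k + j * d k : ℕ) ≤ L k := by
    by_contra hh; exact hne (wbf_zero hh)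
  have h2 := hB.dL k
  have h3 := hB.s0_pos
  have h4 : j * d k + d k ≤ Xf d k := by
    unfold Xf; nlinarith
  push_cast at h1
  have h5 : ((j * d k : ℕ) : ℤ) + d k ≤ Xf d k := by exact_mod_cast h4
  push_cast at h5
  have h6 : (0:ℤ) ≤ j * d k := by positivity
  constructor <;> omega

lemma gg_nonneg (h : GoodA α A w c C a) (z : ℤ) : 0 ≤ gg A w s0 L d z :=
  Finset.sum_nonneg fun k _ => Gk_nonneg h k z

lemma gg_of_nonpos {z : ℤ} (hz : z ≤ 0) : gg A w s0 L d z = 0 := by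
  unfold gg; rw [show z.toNat = 0 by omega]; simp

/-- on the scale of block `k` only block `k` is seen -/
lemma gg_eq_Gk (hB : Bl A w C s0 L d) {k : ℕ} {z : ℤ} (h1 : (Xf d k : ℤ) ≤ 8 * z)
    (h2 : z < 16 * Xf d k) : gg A w s0 L d z = Gk A w s0 L d k z := by
  have hXp := hB.X_pos k
  have key : ∀ l : ℕ, l ≠ k → Gk A w s0 L d l z = 0 := by
    intro l hl
    by_contra hne
    have hs := Gk_supp hB hne
    rcases lt_or_gt_of_ne hl with hlt | hgt
    · have := hB.sep' hlt; omega
    · have := hB.sep' hgt; omega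
  unfold gg
  by_cases hk : k < z.toNat
  · rw [Finset.sum_eq_single_of_mem k (Finset.mem_range.2 hk)]
    intro l _ hl; exact key l hl
  · have hz0 : Gk A w s0 L d k z = 0 := by
      by_contra hne
      have hs := Gk_supp hB hne
      have := hB.X_gt k
      omega
    rw [hz0]
    apply Finset.sum_eq_zero; intro l hl
    apply key; have := Finset.mem_range.1 hl; omega

/-- if `gg` is nonzero at `z` then `z` belongs to a block -/
lemma gg_ne (hB : Bl A w C s0 L d) {z : ℤ} (hz : gg A w s0 L d z ≠ 0) :
    ∃ k, (Xf d k : ℤ) < z ∧ z < 2 * Xf d k := by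
  unfold gg at hz
  obtain ⟨k, _, hne⟩ := Finset.exists_ne_zero_of_sum_ne_zero hz
  exact ⟨k, Gk_supp hB hne⟩

lemma sum_wbf (L : ℕ) : ∑' z : ℤ, ENNReal.ofReal (wbf A w s0 L z) =
    ∑ s ∈ Finset.Icc s0 L, ENNReal.ofReal (w s / Zf A w s0 L) := by
  rw [tsum_eq_sum (s := (Finset.Icc s0 L).map Nat.castEmbedding)]
  · rw [Finset.sum_map]
    apply Finset.sum_congr rfl; intro s hs
    rw [Nat.castEmbedding_apply, wbf_nat hs]
  · intro z hz
    rw [wbf_zero]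
    · simp
    · rintro ⟨h1, h2⟩
      apply hz
      simp only [Finset.mem_map, Finset.mem_Icc, Nat.castEmbedding_apply]
      exact ⟨z.toNat, by omega, by omega⟩

lemma sum_wbf' (h : GoodA α A w c C a) (L : ℕ) : ∑' z : ℤ, ENNReal.ofReal (wbf A w s0 L z) =
    ENNReal.ofReal (mf A w s0 L) := by
  rw [sum_wbf, ← ENNReal.ofReal_sum_of_nonneg, mf, Finset.sum_div]
  intro i _
  apply div_nonneg (h.w_pos i).le
  exact Finset.sum_nonneg fun i _ => by have := (h.w_pos i).le; positivity

lemma sum_Gk (h : GoodA α A w c C a) (hB : Bl A w C s0 L d) (k : ℕ) :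
    ∑' z : ℤ, ENNReal.ofReal (Gk A w s0 L d k z) ≤
      ENNReal.ofReal ((1 / 2) ^ (k + 3) / A (2 * Xf d k)) := by
  have hXp : (0:ℝ) < Xf d k := by exact_mod_cast hB.X_pos k
  have hAX := h.pos hXp.le
  have hm := mf_nonneg h s0 (L k)
  have hA2 := h.pos (x := 2 * Xf d k) (by positivity)
  have e : ∀ z : ℤ, ENNReal.ofReal (Gk A w s0 L d k z) = ENNReal.ofReal (A (Xf d k) / Xf d k) *
      ∑ j ∈ Finset.range (k + 1), ENNReal.ofReal (wbf A w s0 (L k) (z - (Xf d k + j * d k : ℕ))) := by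
    intro z
    unfold Gk
    rw [ENNReal.ofReal_mul (by positivity), ENNReal.ofReal_sum_of_nonneg]
    intro j _; exact wbf_nonneg h _ _ _
  simp_rw [e]
  rw [ENNReal.tsum_mul_left, Summable.tsum_finsetSum (fun i _ => ENNReal.summable)]
  have e2 : ∀ j ∈ Finset.range (k + 1), ∑' z : ℤ, ENNReal.ofReal (wbf A w s0 (L k) (z - (Xf d k + j * d k : ℕ)))
      = ENNReal.ofReal (mf A w s0 (L k)) := by
    intro j _
    rw [← sum_wbf' h]
    exact (Equiv.subRight ((Xf d k + j * d k : ℕ) : ℤ)).tsum_eq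
      (fun z => ENNReal.ofReal (wbf A w s0 (L k) z))
  rw [Finset.sum_congr rfl e2]
  simp only [Finset.sum_const, Finset.card_range, nsmul_eq_mul]
  rw [← ENNReal.ofReal_natCast, ← ENNReal.ofReal_mul (by positivity),
    ← ENNReal.ofReal_mul (by positivity)]
  apply ENNReal.ofReal_le_ofReal
  rw [le_div_iff₀ hA2]
  refine le_trans (le_of_eq ?_) (hB.massb k)
  push_cast; ring

lemma tail_gg (h : GoodA α A w c C a) (hB : Bl A w C s0 L d) (K x : ℕ)
    (hK : ∀ k < K, 2 * Xf d k ≤ x) :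
    ∑' z : ℤ, (if (x:ℤ) ≤ z then ENNReal.ofReal (gg A w s0 L d z) else 0) ≤
      ENNReal.ofReal ((1 / 2) ^ (K + 2) / A x) := by
  have hAx := h.pos (Nat.cast_nonneg x : (0:ℝ) ≤ _)
  calc ∑' z : ℤ, (if (x:ℤ) ≤ z then ENNReal.ofReal (gg A w s0 L d z) else 0)
      ≤ ∑' z : ℤ, ∑' k : ℕ, (if (x:ℤ) ≤ z then ENNReal.ofReal (Gk A w s0 L d k z) else 0) := by
        refine ENNReal.tsum_le_tsum fun z => ?_
        split_ifs
        · unfold gg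
          rw [ENNReal.ofReal_sum_of_nonneg (fun k _ => Gk_nonneg h k z)]
          exact ENNReal.sum_le_tsum _
        · simp
    _ = ∑' k : ℕ, ∑' z : ℤ, (if (x:ℤ) ≤ z then ENNReal.ofReal (Gk A w s0 L d k z) else 0) :=
        ENNReal.tsum_comm
    _ ≤ ∑' k : ℕ, (if K ≤ k then ENNReal.ofReal ((1 / 2) ^ (k + 3) / A x) else 0) := by
        refine ENNReal.tsum_le_tsum fun k => ?_
        by_cases hx : 2 * Xf d k ≤ x
        · have : ∀ z : ℤ, (if (x:ℤ) ≤ z then ENNReal.ofReal (Gk A w s0 L d k z) else 0) = 0 := by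
            intro z
            split_ifs with hz
            · have : Gk A w s0 L d k z = 0 := by
                by_contra hne
                have := Gk_supp hB hne; omega
              rw [this]; simp
            · rfl
          simp_rw [this]; simp
        · have hKk : K ≤ k := by
            by_contra hh; push Not at hh; exact hx (hK k hh)
          rw [if_pos hKk]
          calc _ ≤ ∑' z : ℤ, ENNReal.ofReal (Gk A w s0 L d k z) := by
                refine ENNReal.tsum_le_tsum fun z => ?_
                split_ifs <;> simp
            _ ≤ _ := sum_Gk h hB k
            _ ≤ _ := by
                apply ENNReal.ofReal_le_ofReal
                have : A x ≤ A (2 * Xf d k) := by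
                  apply h.mono (Nat.cast_nonneg x)
                  push Not at hx; exact_mod_cast hx.le
                gcongr
    _ = ∑' k : ℕ, ENNReal.ofReal ((1 / 2) ^ (K + 3) / A x * (1 / 2) ^ k) := by
        have h0 := ENNReal.summable.sum_add_tsum_nat_add' (k := K)
          (f := fun k : ℕ => if K ≤ k then ENNReal.ofReal ((1 / 2) ^ (k + 3) / A x) else 0)
        rw [← h0, Finset.sum_eq_zero, zero_add]
        · apply tsum_congr; intro k
          rw [if_pos (by omega)]
          congr 1; ring
        · intro k hk; rw [if_neg]; have := Finset.mem_range.1 hk; omega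
    _ = _ := by
        rw [← ENNReal.ofReal_tsum_of_nonneg (fun k => by positivity)
          (summable_geometric_two.mul_left _), tsum_mul_left, tsum_geometric_two]
        congr 1; ring

end

/-- base step weights -/
noncomputable def f0 (A : ℝ → ℝ) (n : ℕ) : ℝ := 1 / A ((n:ℝ) - 1) - 1 / A n

/-- symmetric base -/
noncomputable def bsC (A : ℝ → ℝ) : Cv := ⟨fun z => if z = 0 then 0 else ENNReal.ofReal (f0 A z.natAbs)⟩

/-- bump part -/
noncomputable def gC (A : ℝ → ℝ) (w : ℕ → ℝ) (s0 : ℕ) (L d : ℕ → ℕ) : Cv :=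
  ⟨fun z => ENNReal.ofReal (gg A w s0 L d z)⟩

/-- the step distribution -/
noncomputable def stp (A : ℝ → ℝ) (w : ℕ → ℝ) (s0 : ℕ) (L d : ℕ → ℕ) : Cv :=
  bsC A + gC A w s0 L d + Cv.pt (1 - Cv.mass (bsC A + gC A w s0 L d)) 0

section
variable {α : ℝ} {A : ℝ → ℝ} {w : ℕ → ℝ} {c C a : ℝ} {s0 : ℕ} {L d : ℕ → ℕ}

lemma f0_lo (h : GoodA α A w c C a) {n : ℕ} (hn : 1 ≤ n) : c / (n * A n) ≤ f0 A n := by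
  obtain ⟨m, rfl⟩ : ∃ m, n = m + 1 := ⟨n - 1, by omega⟩
  have h1 := h.step_lo m
  have hm : (0:ℝ) ≤ m := by positivity
  have h2 := h.pos hm
  have h3 := h.pos (x := (m:ℝ) + 1) (by positivity)
  unfold f0
  push_cast
  rw [add_sub_cancel_right, div_sub_div _ _ h2.ne' h3.ne', div_le_div_iff₀ (by positivity) (by positivity)]
  have h4 := h.mono hm (y := (m:ℝ) + 1) (by linarith)
  have h5 : c * A m ≤ c * A (m + 1) := mul_le_mul_of_nonneg_left h4 h.c_pos.le
  have h6 : c * A m ≤ (1 * A (m + 1) - A m * 1) * (m + 1) := by nlinarith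
  nlinarith [mul_le_mul_of_nonneg_right h6 h3.le]

lemma f0_hi (h : GoodA α A w c C a) {n : ℕ} (hn : 1 ≤ n) : f0 A n ≤ 1 / (n * A n) := by
  obtain ⟨m, rfl⟩ : ∃ m, n = m + 1 := ⟨n - 1, by omega⟩
  have h1 := h.step_up m
  have hm : (0:ℝ) ≤ m := by positivity
  have h2 := h.pos hm
  have h3 := h.pos (x := (m:ℝ) + 1) (by positivity)
  unfold f0
  push_cast
  rw [add_sub_cancel_right, div_sub_div _ _ h2.ne' h3.ne', div_le_div_iff₀ (by positivity) (by positivity)]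
  nlinarith [mul_le_mul_of_nonneg_left h1 h3.le]

lemma f0_nonneg (h : GoodA α A w c C a) {n : ℕ} (hn : 1 ≤ n) : 0 ≤ f0 A n := by
  refine le_trans ?_ (f0_lo h hn)
  have := h.c_pos
  have := h.pos (x := (n:ℝ)) (by positivity)
  positivity

lemma sum_f0 (h : GoodA α A w c C a) (m : ℕ) :
    ∑' n : ℕ, ENNReal.ofReal (f0 A (m + 1 + n)) = ENNReal.ofReal (1 / A m) := by
  have hnn : ∀ n : ℕ, 0 ≤ f0 A (m + 1 + n) := fun n => f0_nonneg h (by omega)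
  have hs : HasSum (fun n : ℕ => f0 A (m + 1 + n)) (1 / A m) := by
    rw [hasSum_iff_tendsto_nat_of_nonneg hnn]
    have e : ∀ n : ℕ, ∑ i ∈ Finset.range n, f0 A (m + 1 + i) = 1 / A m - 1 / A ((m + n : ℕ):ℝ) := by
      intro n
      induction n with
      | zero => simp
      | succ n ih =>
        rw [Finset.sum_range_succ, ih, f0]
        have : (((m + 1 + n : ℕ):ℝ) - 1) = ((m + n : ℕ):ℝ) := by push_cast; ring
        rw [this]
        have : (m + 1 + n : ℕ) = m + (n + 1) := by ring
        rw [this]; ring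
    simp_rw [e]
    have : Tendsto (fun n : ℕ => A ((m + n : ℕ):ℝ)) atTop atTop := by
      apply h.atop.comp
      apply tendsto_natCast_atTop_atTop.comp
      exact tendsto_atTop_mono (fun n => by simp) tendsto_id
    have := this.inv_tendsto_atTop.const_sub (1 / A m)
    simpa [one_div] using this
  rw [← ENNReal.ofReal_tsum_of_nonneg hnn hs.summable, hs.tsum_eq]

lemma bs_right (h : GoodA α A w c C a) (m : ℕ) :
    ∑' z : ℤ, (if (m:ℤ) < z then bsC A z else 0) = ENNReal.ofReal (1 / A m) := by
  rw [← sum_f0 h m]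
  have hi : Function.Injective (fun n : ℕ => ((m + 1 + n : ℕ) : ℤ)) := fun a b hab => by simpa using hab
  rw [← hi.tsum_eq]
  · congr 1; ext n
    simp only [bsC]
    rw [if_pos (by omega), if_neg (by omega)]; simp only [Int.natAbs_natCast]
  · intro z hz
    have : (m:ℤ) < z := by
      by_contra hh; simp [hh] at hz
    exact ⟨(z - m - 1).toNat, by push_cast; omega⟩

lemma bs_left (h : GoodA α A w c C a) (m : ℕ) :
    ∑' z : ℤ, (if z < -(m:ℤ) then bsC A z else 0) = ENNReal.ofReal (1 / A m) := by
  rw [← bs_right h m, ← (Equiv.neg ℤ).tsum_eq]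
  congr 1; ext z
  simp only [Equiv.neg_apply, neg_lt_neg_iff, bsC, neg_eq_zero, Int.natAbs_neg]

lemma gg_sum_le (h : GoodA α A w c C a) (hB : Bl A w C s0 L d) (x : ℕ) :
    ∑' z : ℤ, (if (x:ℤ) ≤ z then gC A w s0 L d z else 0) ≤ ENNReal.ofReal (1 / (4 * A x)) := by
  refine (tail_gg h hB 0 x (by intro k hk; omega)).trans ?_
  apply ENNReal.ofReal_le_ofReal
  apply le_of_eq; field_simp; norm_num

lemma mass_pre (h : GoodA α A w c C a) (hB : Bl A w C s0 L d) :
    Cv.mass (bsC A + gC A w s0 L d) ≤ 1 := by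
  have h4 := h.four 0 le_rfl
  rw [map_add, Cv.mass_def, Cv.mass_def]
  have e1 : ∑' z, bsC A z ≤ ENNReal.ofReal (1 / A 0) + ENNReal.ofReal (1 / A 0) := by
    have h1 := bs_right h 0
    have h2 := bs_left h 0
    push_cast at h1 h2
    nth_rewrite 1 [← h1]; rw [← h2, ← ENNReal.tsum_add]
    apply ENNReal.tsum_le_tsum
    intro z
    rcases lt_trichotomy z 0 with hz | hz | hz
    · rw [if_neg (by omega), if_pos (by omega), zero_add]
    · simp [hz, bsC]
    · rw [if_pos (by omega), if_neg (by omega), add_zero]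
  have e2 : ∑' z, gC A w s0 L d z ≤ ENNReal.ofReal (1 / (4 * A 0)) := by
    refine le_trans ?_ ((gg_sum_le h hB 0).trans (by simp))
    apply ENNReal.tsum_le_tsum
    intro z
    split_ifs with hz
    · exact le_rfl
    · simp only [gC]; rw [gg_of_nonpos (by push_cast at hz; omega)]; simp
  refine (add_le_add e1 e2).trans ?_
  rw [← ENNReal.ofReal_add (by positivity) (by positivity), ← ENNReal.ofReal_add (by positivity) (by positivity),
    ← ENNReal.ofReal_one]
  apply ENNReal.ofReal_le_ofReal
  have : 1 / A 0 ≤ 1 / 4 := one_div_le_one_div_of_le (by norm_num) h4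
  have : 1 / (4 * A 0) ≤ 1 / 4 := one_div_le_one_div_of_le (by norm_num) (by linarith)
  linarith

lemma mass_stp (h : GoodA α A w c C a) (hB : Bl A w C s0 L d) : Cv.mass (stp A w s0 L d) = 1 := by
  rw [stp, map_add, Cv.mass_pt]
  exact add_tsub_cancel_of_le (mass_pre h hB)

lemma stp_apply' {z : ℤ} (hz : z ≠ 0) : stp A w s0 L d z = bsC A z + gC A w s0 L d z := by
  rw [stp, Cv.add_apply, Cv.add_apply]; simp [Cv.pt, hz]

lemma stp_pos_apply (h : GoodA α A w c C a) {n : ℕ} (hn : 1 ≤ n) :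
    stp A w s0 L d n = ENNReal.ofReal (f0 A n + gg A w s0 L d n) := by
  rw [stp_apply' (by omega), ENNReal.ofReal_add (f0_nonneg h hn) (gg_nonneg h _)]
  simp only [bsC, gC]
  rw [if_neg (by omega)]; simp

lemma stp_right (h : GoodA α A w c C a) (m : ℕ) :
    ∑' z : ℤ, (if (m:ℤ) < z then stp A w s0 L d z else 0) = ENNReal.ofReal (1 / A m) +
      ∑' z : ℤ, (if ((m + 1 : ℕ):ℤ) ≤ z then gC A w s0 L d z else 0) := by
  rw [← bs_right h m, ← ENNReal.tsum_add]
  congr 1; ext z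
  split_ifs with h1 h2 h2
  · exact stp_apply' (by omega)
  · push_cast at h2; omega
  · push_cast at h2; omega
  · simp

lemma stp_left (h : GoodA α A w c C a) (m : ℕ) :
    ∑' z : ℤ, (if z < -(m:ℤ) then stp A w s0 L d z else 0) = ENNReal.ofReal (1 / A m) := by
  rw [← bs_left h m]
  congr 1; ext z
  split_ifs with h1
  · rw [stp_apply' (by omega)]
    simp only [gC]; rw [gg_of_nonpos (by omega)]; simp
  · rfl

lemma A_step (h : GoodA α A w c C a) (m : ℕ) : A (m + 1) ≤ 2 * A m := by
  have := h.step_up m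
  have hm : (0:ℝ) ≤ m := by positivity
  have h2 := h.pos hm
  nlinarith [h.pos (x := (m:ℝ) + 1) (by positivity)]

lemma stp_Stp (h : GoodA α A w c C a) (hB : Bl A w C s0 L d) : Stp A c (stp A w s0 L d) where
  mass_eq := mass_stp h hB
  low := by
    intro z hz
    rw [stp_apply' hz]
    refine le_trans ?_ le_self_add
    simp only [bsC]; rw [if_neg hz]
    exact ENNReal.ofReal_le_ofReal (f0_lo h (by omega))
  tail := by
    intro t ht
    obtain ⟨m, rfl⟩ : ∃ m, t = m + 1 := ⟨t - 1, by omega⟩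
    have e : ∑' z : ℤ, (if m + 1 ≤ z.natAbs then stp A w s0 L d z else 0)
        ≤ ∑' z : ℤ, (if (m:ℤ) < z then stp A w s0 L d z else 0) +
          ∑' z : ℤ, (if z < -(m:ℤ) then stp A w s0 L d z else 0) := by
      rw [← ENNReal.tsum_add]
      apply ENNReal.tsum_le_tsum
      intro z
      by_cases h1 : (m:ℤ) < z
      · rw [if_pos h1]
        refine le_trans ?_ le_self_add
        split_ifs <;> simp
      by_cases h2 : z < -(m:ℤ)
      · rw [if_pos h2]
        refine le_trans ?_ le_add_self
        split_ifs <;> simp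
      rw [if_neg (by omega)]; exact zero_le
    refine e.trans ?_
    rw [stp_right h, stp_left h]
    refine (add_le_add_left (add_le_add_right (gg_sum_le h hB _) _) _).trans ?_
    have p1 := h.pos (x := (m:ℝ)) (by positivity)
    have p2 := h.pos (x := ((m + 1:ℕ):ℝ)) (by positivity)
    rw [← ENNReal.ofReal_add (by positivity) (by positivity), ← ENNReal.ofReal_add (by positivity) (by positivity)]
    apply ENNReal.ofReal_le_ofReal
    have h3 : 1 / A m ≤ 2 / A ((m + 1:ℕ):ℝ) := by
      rw [div_le_div_iff₀ p1 p2]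
      have := A_step h m; push_cast; linarith
    have h4 : 1 / (4 * A ((m + 1:ℕ):ℝ)) = 1 / 4 / A ((m + 1:ℕ):ℝ) := by rw [div_div]
    have h5 : (6:ℝ) / A ((m + 1:ℕ):ℝ) = 2 / A ((m + 1:ℕ):ℝ) + 2 / A ((m + 1:ℕ):ℝ) + 2 / A ((m + 1:ℕ):ℝ) := by ring
    have h6 : 1 / 4 / A ((m + 1:ℕ):ℝ) ≤ 2 / A ((m + 1:ℕ):ℝ) := by gcongr; norm_num
    rw [h5, h4]; linarith

end

/-- the measure on the line attached to weights on the integers -/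
noncomputable def toM (a : Cv) : Measure ℝ := Measure.sum (fun z : ℤ => a z • Measure.dirac (z:ℝ))

open Classical in
lemma toM_apply (a : Cv) {S : Set ℝ} (hS : MeasurableSet S) :
    toM a S = ∑' z : ℤ, if (z:ℝ) ∈ S then a z else 0 := by
  rw [toM, Measure.sum_apply _ hS]
  congr 1; ext z
  rw [Measure.smul_apply, Measure.dirac_apply' _ hS, smul_eq_mul]
  by_cases hz : (z:ℝ) ∈ S <;> simp [hz]

lemma toM_univ (a : Cv) : toM a univ = Cv.mass a := by
  classical
  rw [toM_apply a MeasurableSet.univ]; simp [Cv.mass_def]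

lemma lintegral_toM (a : Cv) {g : ℝ → ENNReal} (hg : Measurable g) :
    ∫⁻ x, g x ∂(toM a) = ∑' z : ℤ, a z * g z := by
  rw [toM, lintegral_sum_measure]
  congr 1; ext z
  rw [lintegral_smul_measure, lintegral_dirac' _ hg, smul_eq_mul]

lemma toM_mul (a f : Cv) (hf : Cv.mass f = 1) :
    Measure.map (fun p : ℝ × ℝ => p.1 + p.2) ((toM a).prod (toM f)) = toM (a * f) := by
  classical
  have : IsProbabilityMeasure (toM f) := ⟨by rw [toM_univ, hf]⟩
  ext S hS
  have hm : Measurable (fun p : ℝ × ℝ => p.1 + p.2) := by fun_prop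
  rw [Measure.map_apply hm hS, Measure.prod_apply (hm hS), lintegral_toM _ (measurable_measure_prodMk_left (hm hS)),
    toM_apply _ hS]
  simp only [Cv.mul_apply]
  have e1 : ∀ z : ℤ, (if (z:ℝ) ∈ S then ∑' y, a y * f (z - y) else 0) =
      ∑' y, if (z:ℝ) ∈ S then a y * f (z - y) else 0 := by
    intro z; split_ifs <;> simp
  simp_rw [e1]
  rw [ENNReal.tsum_comm]
  congr 1; ext y
  rw [toM_apply _ (measurable_prodMk_left (hm hS)), ← ENNReal.tsum_mul_left,
    ← (Equiv.addRight y).tsum_eq (fun z : ℤ => if (z:ℝ) ∈ S then a y * f (z - y) else 0)]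
  congr 1; ext z
  simp only [mem_preimage, Equiv.coe_addRight, add_sub_cancel_right]
  push_cast
  rw [add_comm (y:ℝ)]
  split_ifs <;> simp

lemma convPow_toM (f : Cv) (hf : Cv.mass f = 1) (n : ℕ) : convPow (toM f) n = toM (f ^ n) := by
  induction n with
  | zero =>
    classical
    rw [convPow, pow_zero]
    ext S hS
    rw [toM_apply _ hS, tsum_eq_single 0, Measure.dirac_apply' _ hS]
    · by_cases h : (0:ℝ) ∈ S <;> simp [h, Cv.one_apply]
    · intro z hz; simp [Cv.one_apply, hz]
  | succ n ih => rw [convPow, ih, toM_mul _ _ hf, pow_succ]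

lemma toM_Ioc (a : Cv) (x : ℝ) : toM a (Ioc (x - 1) x) = a ⌊x⌋ := by
  classical
  rw [toM_apply _ measurableSet_Ioc, tsum_eq_single ⌊x⌋]
  · rw [if_pos]; exact ⟨by linarith [Int.lt_floor_add_one x], Int.floor_le x⟩
  · intro z hz
    rw [if_neg]
    rintro ⟨h1, h2⟩
    exact hz (Int.floor_eq_iff.2 ⟨h2, by linarith⟩).symm

lemma ren_toM (f : Cv) (hf : Cv.mass f = 1) (x : ℝ) :
    ∑' n, convPow (toM f) n (Ioc (x - 1) x) = Cv.ren f ⌊x⌋ := by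
  simp_rw [convPow_toM f hf, toM_Ioc]; rfl

lemma toM_Ioi (a : Cv) {x : ℝ} (hx : 0 ≤ x) :
    toM a (Ioi x) = ∑' z : ℤ, if ((⌊x⌋₊:ℕ):ℤ) < z then a z else 0 := by
  classical
  rw [toM_apply _ measurableSet_Ioi]
  congr 1; ext z
  have : (z:ℝ) ∈ Ioi x ↔ ((⌊x⌋₊:ℕ):ℤ) < z := by
    rw [Int.natCast_floor_eq_floor hx, Int.floor_lt, mem_Ioi]
  simp only [this]

lemma toM_Iic (a : Cv) {x : ℝ} (hx : 0 < x) :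
    toM a (Iic (-x)) = ∑' z : ℤ, if z < -((⌈x⌉₊ - 1 : ℕ):ℤ) then a z else 0 := by
  classical
  rw [toM_apply _ measurableSet_Iic]
  congr 1; ext z
  have h1 : 0 < ⌈x⌉₊ := Nat.ceil_pos.2 hx
  have : (z:ℝ) ∈ Iic (-x) ↔ z < -((⌈x⌉₊ - 1 : ℕ):ℤ) := by
    rw [mem_Iic, le_neg]
    have h2 : (x ≤ -(z:ℝ)) ↔ x ≤ ((-z : ℤ):ℝ) := by push_cast; rfl
    rw [h2, ← Int.ceil_le, ← Int.natCast_ceil_eq_ceil hx.le]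
    omega
  simp only [this]

section
variable {α : ℝ} {A : ℝ → ℝ} {w : ℕ → ℝ} {c C a : ℝ} {s0 : ℕ} {L d : ℕ → ℕ}

/-- bump tail -/
noncomputable def gt (A : ℝ → ℝ) (w : ℕ → ℝ) (s0 : ℕ) (L d : ℕ → ℕ) (m : ℕ) : ℝ :=
  (∑' z : ℤ, (if ((m + 1 : ℕ):ℤ) ≤ z then gC A w s0 L d z else 0)).toReal

lemma gt_nonneg (m : ℕ) : 0 ≤ gt A w s0 L d m := ENNReal.toReal_nonneg

lemma gt_le (h : GoodA α A w c C a) (hB : Bl A w C s0 L d) (K m : ℕ) (hK : ∀ k < K, 2 * Xf d k ≤ m + 1) :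
    gt A w s0 L d m ≤ (1 / 2) ^ (K + 2) / A ((m + 1 : ℕ):ℝ) := by
  have p2 := h.pos (x := ((m + 1:ℕ):ℝ)) (by positivity)
  exact ENNReal.toReal_le_of_le_ofReal (by positivity) (tail_gg h hB K (m + 1) hK)

lemma F_Ioi (h : GoodA α A w c C a) (hB : Bl A w C s0 L d) {x : ℝ} (hx : 0 ≤ x) :
    (toM (stp A w s0 L d) (Ioi x)).toReal = 1 / A (⌊x⌋₊:ℝ) + gt A w s0 L d ⌊x⌋₊ := by
  rw [toM_Ioi _ hx, stp_right h, ENNReal.toReal_add ENNReal.ofReal_ne_top, ENNReal.toReal_ofReal, gt]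
  · have p2 := h.pos (x := (⌊x⌋₊:ℝ)) (by positivity)
    positivity
  · exact ne_top_of_le_ne_top ENNReal.ofReal_ne_top (gg_sum_le h hB _)

lemma F_Iic (h : GoodA α A w c C a) {x : ℝ} (hx : 0 < x) :
    (toM (stp A w s0 L d) (Iic (-x))).toReal = 1 / A ((⌈x⌉₊ - 1 : ℕ):ℝ) := by
  rw [toM_Iic _ hx, stp_left h, ENNReal.toReal_ofReal]
  have p2 := h.pos (x := ((⌈x⌉₊ - 1 : ℕ):ℝ)) (by positivity)
  positivity

lemma ratio_bd (h : GoodA α A w c C a) {x : ℝ} {m : ℕ} (h1 : (m:ℝ) ≤ x) (h2 : x ≤ m + 1) (hm : 1 ≤ m):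
    1 ≤ A x * (1 / A m) ∧ A x * (1 / A m) ≤ 1 + 2 / x := by
  have hm0 : (0:ℝ) ≤ m := by positivity
  have hm1 : (1:ℝ) ≤ m := by exact_mod_cast hm
  have p := h.pos hm0
  have e1 := h.mono hm0 h1
  have e2 := h.mono (hm0.trans h1) h2
  have e3 := h.step_up m
  refine ⟨by rw [mul_one_div, one_le_div p]; exact e1, ?_⟩
  have hx : 0 < x := by linarith
  rw [mul_one_div, div_le_iff₀ p]
  have e4 : A (m + 1) ≤ (1 + 1 / ((m:ℝ) + 1)) * A m := by
    have : (1 + 1 / ((m:ℝ) + 1)) * A m = A m * (m + 2) / (m + 1) := by field_simp; ring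
    rw [this, le_div_iff₀ (by positivity)]; exact e3
  have e5 : 1 / ((m:ℝ) + 1) ≤ 2 / x := by
    rw [div_le_div_iff₀ (by positivity) hx]; linarith
  refine e2.trans (e4.trans ?_)
  gcongr

lemma tail_right (h : GoodA α A w c C a) (hB : Bl A w C s0 L d) :
    Tendsto (fun x => A x * (toM (stp A w s0 L d) (Ioi x)).toReal) atTop (𝓝 1) := by
  rw [Metric.tendsto_atTop]
  intro ε hε
  obtain ⟨K, hK⟩ := exists_pow_lt_of_lt_one (half_pos hε) (show (1/2:ℝ) < 1 by norm_num)
  obtain ⟨M, hM⟩ : ∃ M : ℕ, ∀ k < K, 2 * Xf d k ≤ M :=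
    ⟨∑ k ∈ Finset.range K, 2 * Xf d k, fun k hk =>
      Finset.single_le_sum (f := fun k => 2 * Xf d k) (fun _ _ => Nat.zero_le _) (Finset.mem_range.2 hk)⟩
  refine ⟨max (max 1 M) (4 / ε + 1), fun x hx => ?_⟩
  simp only [ge_iff_le, max_le_iff] at hx
  obtain ⟨⟨hx1, hxM⟩, hxε⟩ := hx
  have hx0 : (0:ℝ) ≤ x := by linarith
  rw [F_Ioi h hB hx0]
  set m := ⌊x⌋₊ with hmdef
  have hm1 : 1 ≤ m := Nat.le_floor (by exact_mod_cast hx1)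
  have hmM : M ≤ m := Nat.le_floor hxM
  have b1 := Nat.floor_le hx0
  have b2 := (Nat.lt_floor_add_one x).le
  obtain ⟨r1, r2⟩ := ratio_bd h b1 b2 hm1
  have g0 := gt_nonneg (A := A) (w := w) (s0 := s0) (L := L) (d := d) m
  have g1 := gt_le h hB K m (fun k hk => by have := hM k hk; omega)
  have pA := h.pos hx0
  have p2 := h.pos (x := ((m + 1:ℕ):ℝ)) (by positivity)
  have g2 : A x * gt A w s0 L d m ≤ (1 / 2) ^ (K + 2) := by
    have : A x ≤ A ((m + 1:ℕ):ℝ) := h.mono hx0 (by push_cast; exact b2)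
    calc _ ≤ A ((m + 1:ℕ):ℝ) * ((1 / 2) ^ (K + 2) / A ((m + 1 : ℕ):ℝ)) := by gcongr
      _ = _ := by field_simp
  have g3 : (1 / 2:ℝ) ^ (K + 2) ≤ (1/2) ^ K := by
    apply pow_le_pow_of_le_one <;> norm_num
  have g4 : 2 / x < ε / 2 := by
    rw [div_lt_div_iff₀ (by linarith) (by norm_num)]
    have : 4 / ε < x := by linarith
    rw [div_lt_iff₀ hε] at this; linarith
  have g5 : 0 ≤ A x * gt A w s0 L d m := by positivity
  rw [Real.dist_eq, abs_lt, mul_add]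
  constructor <;> linarith

lemma tail_left (h : GoodA α A w c C a) :
    Tendsto (fun x => A x * (toM (stp A w s0 L d) (Iic (-x))).toReal) atTop (𝓝 1) := by
  have ht : Tendsto (fun x : ℝ => 1 + 2 / x) atTop (𝓝 1) := by
    simpa using (tendsto_id.const_div_atTop (2:ℝ) (α := ℝ) (l := atTop)).const_add 1
  refine tendsto_of_tendsto_of_tendsto_of_le_of_le' tendsto_const_nhds ht ?_ ?_
  all_goals
    filter_upwards [eventually_gt_atTop (1:ℝ)] with x hx
    have h0 : 2 ≤ ⌈x⌉₊ := by
      have : 1 < ⌈x⌉₊ := Nat.lt_ceil.2 (by simpa using hx)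
      omega
    have e : (((⌈x⌉₊ - 1 : ℕ):ℝ)) = (⌈x⌉₊:ℝ) - 1 := by push_cast [Nat.cast_sub (show 1 ≤ ⌈x⌉₊ by omega)]; ring
    have h1 : (((⌈x⌉₊ - 1 : ℕ):ℝ)) ≤ x := by
      rw [e]; linarith [Nat.ceil_lt_add_one (show (0:ℝ) ≤ x by linarith)]
    have h2 : x ≤ (((⌈x⌉₊ - 1 : ℕ):ℝ)) + 1 := by
      rw [e]; linarith [Nat.le_ceil x]
    have := ratio_bd h h1 h2 (by omega)
    rw [F_Iic h (by linarith)]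
  · exact this.1
  · exact this.2

lemma span_one (h : GoodA α A w c C a) {t : ℝ}
    (ht : (∃ t, IsArithSpan (toM (stp A w s0 L d)) t) → IsGreatest {t | IsArithSpan (toM (stp A w s0 L d)) t} t) :
    t = 1 := by
  classical
  have meas : ∀ u : ℝ, MeasurableSet ({x : ℝ | ∃ k : ℤ, x = u * k}ᶜ) := by
    intro u
    apply MeasurableSet.compl
    have : {x : ℝ | ∃ k : ℤ, x = u * k} = range (fun k : ℤ => u * k) := by
      ext x; simp [eq_comm]
    rw [this]; exact (countable_range _).measurableSet
  have h1 : IsArithSpan (toM (stp A w s0 L d)) 1 := by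
    refine ⟨one_pos, ?_⟩
    rw [toM_apply _ (meas 1)]
    simp
  have hg := ht ⟨1, h1⟩
  have hge : 1 ≤ t := hg.2 h1
  obtain ⟨hpos, h0⟩ := hg.1
  rw [toM_apply _ (meas t), ENNReal.tsum_eq_zero] at h0
  have h2 := h0 1
  have hf : 0 < stp A w s0 L d 1 := by
    have e := stp_pos_apply (s0 := s0) (L := L) (d := d) h (le_refl 1)
    rw [Nat.cast_one] at e
    rw [e, ENNReal.ofReal_pos]
    have e1 := f0_lo h (le_refl 1)
    have e2 := gg_nonneg (s0 := s0) (L := L) (d := d) h ((1:ℕ):ℤ)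
    have e3 := h.pos (x := ((1:ℕ):ℝ)) (by positivity)
    have e4 : 0 < c / ((1:ℕ) * A (1:ℕ)) := by have := h.c_pos; positivity
    push_cast at *
    linarith
  have h3 : ((1:ℤ):ℝ) ∈ {x : ℝ | ∃ k : ℤ, x = t * k} := by
    by_contra hh
    rw [if_pos (show ((1:ℤ):ℝ) ∈ {x : ℝ | ∃ k : ℤ, x = t * k}ᶜ from hh)] at h2
    exact hf.ne' h2
  obtain ⟨k, hk⟩ := h3
  push_cast at hk
  have hk1 : 1 ≤ k := by
    have : (0:ℝ) < k := by
      by_contra hh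
      push Not at hh
      nlinarith
    exact_mod_cast this
  have : (1:ℝ) ≤ k := by exact_mod_cast hk1
  nlinarith

lemma rr_eq (h : GoodA α A w c C a) (hB : Bl A w C s0 L d) {y : ℝ} (hy : 1 ≤ y) :
    rr (toM (stp A w s0 L d)) 1 y = y * (f0 A ⌊y⌋₊ + gg A w s0 L d ⌊y⌋₊) /
      (1 / A (⌊y⌋₊:ℝ) + gt A w s0 L d ⌊y⌋₊) := by
  have hn : 1 ≤ ⌊y⌋₊ := Nat.le_floor (by exact_mod_cast hy)
  rw [rr, F_Ioi h hB (by linarith), toM_Ioc, ← Int.natCast_floor_eq_floor (by linarith), stp_pos_apply h hn,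
    ENNReal.toReal_ofReal]
  exact add_nonneg (f0_nonneg h hn) (gg_nonneg h _)

end

/-- kernel -/
noncomputable def Kf (A : ℝ → ℝ) (s : ℝ) : ℝ := A s ^ 2 / s

section
variable {α : ℝ} {A : ℝ → ℝ} {w : ℕ → ℝ} {c C a : ℝ} {s0 : ℕ} {L d : ℕ → ℕ}

lemma Kf_nonneg {s : ℝ} (hs : 0 ≤ s) : 0 ≤ Kf A s := by unfold Kf; positivity

lemma Kf_anti (h : GoodA α A w c C a) {x y : ℝ} (hx : 0 < x) (hxy : x ≤ y) : Kf A y ≤ Kf A x := by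
  unfold Kf
  rw [div_le_div_iff₀ (by linarith) hx]
  exact h.kanti x y hx hxy

lemma Kf_dbl (h : GoodA α A w c C a) {x y : ℝ} (hx : 0 < x) (hxy : x ≤ y) (hy : y ≤ 2 * x) : Kf A x ≤ 2 * Kf A y := by
  unfold Kf
  have h1 := h.mono hx.le hxy
  have h2 := h.pos hx.le
  rw [← mul_div_assoc, div_le_div_iff₀ hx (by linarith)]
  have : A x ^ 2 ≤ A y ^ 2 := by gcongr
  calc A x ^ 2 * y ≤ A y ^ 2 * (2 * x) := by gcongr; linarith
    _ = _ := by ring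

lemma sum_Kf (h : GoodA α A w c C a) (n : ℕ) : ∑ i ∈ Finset.Icc 1 n, Kf A i ≤ A n ^ 2 / c := by
  have hc := h.c_pos
  induction n with
  | zero => simp; positivity
  | succ n ih =>
    rw [Finset.sum_Icc_succ_top (by omega)]
    have h1 := h.step_lo n
    have p0 := h.pos (x := (n:ℝ)) (by positivity)
    have p1 := h.pos (x := (n:ℝ) + 1) (by positivity)
    have hn : (0:ℝ) < n + 1 := by positivity
    have hcl := h.c_le
    set t := c / ((n:ℝ) + 1) with ht
    have ht0 : 0 ≤ t := by positivity
    have ht1 : t ≤ 1 := by rw [ht, div_le_one hn]; have : (0:ℝ) ≤ n := by positivity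
                           linarith
    have h2 : A n ≤ A (n + 1) * (1 - t) := by
      have : A (n + 1) * (1 - t) = A (n + 1) * (n + 1 - c) / (n + 1) := by rw [ht]; field_simp
      rw [this, le_div_iff₀ hn]; exact h1
    have h3 : A n ^ 2 ≤ A (n + 1) ^ 2 * (1 - t) := by
      calc A n ^ 2 ≤ (A (n + 1) * (1 - t)) ^ 2 := by gcongr
        _ = A (n + 1) ^ 2 * ((1 - t) * (1 - t)) := by ring
        _ ≤ A (n + 1) ^ 2 * (1 - t) := by gcongr; nlinarith
    unfold Kf at *
    push_cast
    calc _ ≤ A n ^ 2 / c + A (n + 1) ^ 2 / (n + 1) := by gcongr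
      _ ≤ A (n + 1) ^ 2 * (1 - t) / c + A (n + 1) ^ 2 / (n + 1) := by gcongr
      _ = _ := by rw [ht]; field_simp; ring

/-- left bump sum -/
noncomputable def Ls (A : ℝ → ℝ) (w : ℕ → ℝ) (s0 L M : ℕ) (Y : ℤ) : ℝ :=
  ∑ i ∈ Finset.Icc 1 M, Kf A i * wbf A w s0 L (Y - i)

/-- right bump sum -/
noncomputable def Rs (A : ℝ → ℝ) (w : ℕ → ℝ) (s0 L M : ℕ) (Y : ℤ) : ℝ :=
  ∑ i ∈ Finset.Icc 1 M, Kf A i * wbf A w s0 L (Y + i)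

lemma sum_wbf_inj (h : GoodA α A w c C a) (L : ℕ) (s : Finset ℕ) (φ : ℕ → ℤ) (hφ : Set.InjOn φ s) :
    ∑ i ∈ s, wbf A w s0 L (φ i) ≤ mf A w s0 L := by
  have h1 : ∑ i ∈ s, ENNReal.ofReal (wbf A w s0 L (φ i)) ≤ ENNReal.ofReal (mf A w s0 L) := by
    rw [← sum_wbf' h L, ← Finset.sum_image (f := fun z => ENNReal.ofReal (wbf A w s0 L z)) hφ]
    exact ENNReal.sum_le_tsum _
  rw [← ENNReal.ofReal_sum_of_nonneg (fun i _ => wbf_nonneg h _ _ _)] at h1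
  exact (ENNReal.ofReal_le_ofReal_iff (mf_nonneg h _ _)).1 h1

lemma wbf_le (h : GoodA α A w c C a) (hB : Bl A w C s0 L d) (k : ℕ) (s : ℕ) :
    wbf A w s0 (L k) s ≤ w s / Zf A w s0 (L k) := by
  by_cases hs : s ∈ Finset.Icc s0 (L k)
  · rw [wbf_nat hs]
  · rw [wbf_zero]
    · have := h.w_pos s; have := Zf_pos hB k; positivity
    · simpa using hs

lemma Ls_zero (hB : Bl A w C s0 L d) (k M : ℕ) {Y : ℤ} (hY : Y ≤ 0) : Ls A w s0 (L k) M Y = 0 := by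
  apply Finset.sum_eq_zero
  intro i hi
  rw [wbf_zero, mul_zero]
  have := hB.s0_pos; simp only [Finset.mem_Icc] at hi; omega

lemma Ls_far (h : GoodA α A w c C a) (hB : Bl A w C s0 L d) (k M : ℕ) {Y : ℤ} (hY : d k ≤ Y) :
    Ls A w s0 (L k) M Y ≤ 1 / ((k:ℝ) + 1) ^ 2 := by
  have hd := hB.dL k
  have hYr : ((d k:ℕ):ℝ) ≤ (Y:ℝ) := by exact_mod_cast hY
  have hdr : 2 * ((L k:ℕ):ℝ) < (d k:ℝ) := by exact_mod_cast hd
  have hL0 : (0:ℝ) ≤ L k := by positivity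
  have hd2 : (d k:ℝ) / 2 ≤ (Y:ℝ) - L k := by linarith
  have hpos : (0:ℝ) < (Y:ℝ) - L k := by linarith
  have h1 : Ls A w s0 (L k) M Y ≤ Kf A ((Y:ℝ) - L k) * mf A w s0 (L k) := by
    calc Ls A w s0 (L k) M Y ≤ ∑ i ∈ Finset.Icc 1 M, Kf A ((Y:ℝ) - L k) * wbf A w s0 (L k) (Y - i) := by
          apply Finset.sum_le_sum
          intro i hi
          by_cases hz : (s0:ℤ) ≤ Y - i ∧ Y - i ≤ L k
          · apply mul_le_mul_of_nonneg_right _ (wbf_nonneg h _ _ _)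
            apply Kf_anti h hpos
            have : Y - L k ≤ i := by omega
            exact_mod_cast this
          · rw [wbf_zero hz]; simp
      _ ≤ _ := by
          rw [← Finset.mul_sum]
          apply mul_le_mul_of_nonneg_left _ (Kf_nonneg hpos.le)
          apply sum_wbf_inj h
          intro i _ j _ hij; simp only [sub_right_inj, Nat.cast_inj] at hij; exact hij
  have h2 := hB.kd k _ hd2
  have hk : (0:ℝ) < k + 1 := by positivity
  rw [le_div_iff₀ (by positivity)]
  have h3 : ((k:ℝ) + 1) * mf A w s0 (L k) * (A ((Y:ℝ) - L k) ^ 2 / ((Y:ℝ) - L k)) * (k + 1) ≤ 1 := by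
    rwa [le_div_iff₀ hk] at h2
  calc _ ≤ Kf A ((Y:ℝ) - L k) * mf A w s0 (L k) * ((k:ℝ) + 1) ^ 2 := by gcongr
    _ = ((k:ℝ) + 1) * mf A w s0 (L k) * (A ((Y:ℝ) - L k) ^ 2 / ((Y:ℝ) - L k)) * (k + 1) := by unfold Kf; ring
    _ ≤ 1 := h3

lemma Ls_near (h : GoodA α A w c C a) (hB : Bl A w C s0 L d) (k M : ℕ) {Y : ℤ} (hY : 0 < Y) :
    Ls A w s0 (L k) M Y ≤ (2 * C / c + 2 * C) / ((k:ℝ) + 1) := by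
  obtain ⟨y, rfl⟩ : ∃ y : ℕ, Y = y := ⟨Y.toNat, by omega⟩
  have hy : 1 ≤ y := by omega
  have hy0 : (0:ℝ) < y := by exact_mod_cast hy
  have hZ := Zf_pos hB k
  have hZk := hB.Z_ge k
  have hC := h.C_ge
  have hc := h.c_pos
  set Z := Zf A w s0 (L k)
  have key : ∀ i ∈ Finset.Icc 1 M, Kf A i * wbf A w s0 (L k) ((y:ℤ) - i) ≤
      if i < y then (Kf A i * (2 * w y) + 2 * Kf A y * w (y - i)) / Z else 0 := by
    intro i hi
    rw [Finset.mem_Icc] at hi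
    have hi0 : (0:ℝ) < i := by exact_mod_cast hi.1
    split_ifs with hiy
    · have e : ((y:ℤ) - i) = ((y - i : ℕ):ℤ) := by omega
      rw [e, add_div]
      have hw := wbf_le h hB k (y - i)
      have hwy := h.w_pos y
      have hwi := h.w_pos (y - i)
      have hK := Kf_nonneg (A := A) hi0.le
      have hKy := Kf_nonneg (A := A) hy0.le
      by_cases h2 : 2 * i ≤ y
      · refine le_trans ?_ (le_add_of_nonneg_right (by positivity))
        have := h.w_half (y - i) y (by omega)
        calc _ ≤ Kf A i * (w (y - i) / Z) := by gcongr
          _ ≤ Kf A i * (2 * w y / Z) := by gcongr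
          _ = _ := by ring
      · refine le_trans ?_ (le_add_of_nonneg_left (by positivity))
        have h3 : Kf A i ≤ 2 * Kf A y := Kf_dbl h hi0 (by exact_mod_cast hiy.le) (by exact_mod_cast (by omega : y ≤ 2 * i))
        calc _ ≤ Kf A i * (w (y - i) / Z) := by gcongr
          _ ≤ 2 * Kf A y * (w (y - i) / Z) := by gcongr
          _ = _ := by ring
    · rw [wbf_zero, mul_zero]
      have := hB.s0_pos; omega
  have h1 : Ls A w s0 (L k) M y ≤ ∑ i ∈ Finset.Icc 1 (y - 1), (Kf A i * (2 * w y) + 2 * Kf A y * w (y - i)) / Z := by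
    refine (Finset.sum_le_sum key).trans ?_
    rw [← Finset.sum_filter]
    apply Finset.sum_le_sum_of_subset_of_nonneg
    · intro i hi; simp only [Finset.mem_filter, Finset.mem_Icc] at *; omega
    · intro i _ _
      have hwy := h.w_pos y
      have hwi := h.w_pos (y - i)
      have hK := Kf_nonneg (A := A) (s := (i:ℝ)) (by positivity)
      have hKy := Kf_nonneg (A := A) hy0.le
      positivity
  refine h1.trans ?_
  rw [← Finset.sum_div, Finset.sum_add_distrib, ← Finset.sum_mul, ← Finset.mul_sum]
  have s1 : (∑ i ∈ Finset.Icc 1 (y - 1), Kf A i) * (2 * w y) ≤ 2 * C / c := by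
    have hwy := h.w_pos y
    have : ∑ i ∈ Finset.Icc 1 (y - 1), Kf A i ≤ A y ^ 2 / c := by
      refine le_trans ?_ (sum_Kf h y)
      apply Finset.sum_le_sum_of_subset_of_nonneg
      · intro i hi; simp only [Finset.mem_Icc] at *; omega
      · intro i _ _; exact Kf_nonneg (by positivity)
    calc _ ≤ A y ^ 2 / c * (2 * w y) := by gcongr
      _ = 2 * (A y ^ 2 * w y) / c := by ring
      _ ≤ _ := by gcongr; exact h.w_A y
  have s2 : 2 * Kf A y * ∑ i ∈ Finset.Icc 1 (y - 1), w (y - i) ≤ 2 * C := by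
    have e : ∑ i ∈ Finset.Icc 1 (y - 1), w (y - i) = ∑ i ∈ Finset.Icc 1 (y - 1), w i := by
      apply Finset.sum_nbij' (fun i => y - i) (fun i => y - i)
      all_goals intro i hi; simp only [Finset.mem_Icc] at *; try omega
    have e2 : ∑ i ∈ Finset.Icc 1 (y - 1), w i ≤ ∑ i ∈ Finset.Icc 1 y, w i := by
      apply Finset.sum_le_sum_of_subset_of_nonneg
      · intro i hi; simp only [Finset.mem_Icc] at *; omega
      · intro i _ _; exact (h.w_pos i).le
    have := h.w_K y hy
    have hKy := Kf_nonneg (A := A) hy0.le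
    rw [e]
    calc _ ≤ 2 * Kf A y * ∑ i ∈ Finset.Icc 1 y, w i := by gcongr
      _ = 2 * (A y ^ 2 / y * ∑ i ∈ Finset.Icc 1 y, w i) := by unfold Kf; ring
      _ ≤ _ := by linarith
  exact div_le_div₀ (by positivity) (add_le_add s1 s2) (by positivity) hZk

lemma one_j (d : ℕ) (n x J : ℕ) (E : ℝ) (hE : 0 ≤ E) :
    ∑ j ∈ Finset.range J, (if 0 < (n:ℤ) - (x + j * d : ℕ) ∧ (n:ℤ) - (x + j * d : ℕ) ≤ d then E else 0) ≤ E := by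
  rw [← Finset.sum_filter, Finset.sum_const, nsmul_eq_mul]
  apply mul_le_of_le_one_left hE
  have : (Finset.filter (fun j => 0 < (n:ℤ) - (x + j * d : ℕ) ∧ (n:ℤ) - (x + j * d : ℕ) ≤ d) (Finset.range J)).card ≤ 1 := by
    rw [Finset.card_le_one]
    intro i hi j hj
    simp only [Finset.mem_filter] at hi hj
    push_cast at hi hj
    by_contra hne
    rcases lt_or_gt_of_ne hne with hl | hl
    · have : (i:ℤ) + 1 ≤ j := by exact_mod_cast hl
      nlinarith [mul_le_mul_of_nonneg_right this (show (0:ℤ) ≤ d by positivity)]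
    · have : (j:ℤ) + 1 ≤ i := by exact_mod_cast hl
      nlinarith [mul_le_mul_of_nonneg_right this (show (0:ℤ) ≤ d by positivity)]
  exact_mod_cast this

lemma sum_Ls (h : GoodA α A w c C a) (hB : Bl A w C s0 L d) (k M n : ℕ) :
    ∑ j ∈ Finset.range (k + 1), Ls A w s0 (L k) M ((n:ℤ) - (Xf d k + j * d k : ℕ)) ≤
      (1 + 2 * C / c + 2 * C) / ((k:ℝ) + 1) := by
  have hC := h.C_ge
  have hc := h.c_pos
  have hE : 0 ≤ (2 * C / c + 2 * C) / ((k:ℝ) + 1) := by positivity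
  have key : ∀ j ∈ Finset.range (k + 1), Ls A w s0 (L k) M ((n:ℤ) - (Xf d k + j * d k : ℕ)) ≤
      1 / ((k:ℝ) + 1) ^ 2 + (if 0 < (n:ℤ) - (Xf d k + j * d k : ℕ) ∧ (n:ℤ) - (Xf d k + j * d k : ℕ) ≤ d k
        then (2 * C / c + 2 * C) / ((k:ℝ) + 1) else 0) := by
    intro j _
    have hp : (0:ℝ) ≤ 1 / ((k:ℝ) + 1) ^ 2 := by positivity
    split_ifs with hj
    · exact (Ls_near h hB k M hj.1).trans (by linarith)
    · rw [add_zero]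
      by_cases h0 : (n:ℤ) - (Xf d k + j * d k : ℕ) ≤ 0
      · rw [Ls_zero hB k M h0]; exact hp
      · exact Ls_far h hB k M (by omega)
  refine (Finset.sum_le_sum key).trans ?_
  rw [Finset.sum_add_distrib, Finset.sum_const, Finset.card_range, nsmul_eq_mul]
  have h2 := one_j (d k) n (Xf d k) (k + 1) _ hE
  have h1 : ((k + 1 : ℕ):ℝ) * (1 / ((k:ℝ) + 1) ^ 2) = 1 / ((k:ℝ) + 1) := by push_cast; field_simp
  rw [h1]
  calc _ ≤ 1 / ((k:ℝ) + 1) + (2 * C / c + 2 * C) / ((k:ℝ) + 1) := by gcongr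
    _ = _ := by ring

lemma Rs_far (h : GoodA α A w c C a) (hB : Bl A w C s0 L d) (k M : ℕ) {Y : ℤ} (hY : Y ≤ -d k) :
    Rs A w s0 (L k) M Y ≤ 1 / ((k:ℝ) + 1) ^ 2 := by
  have hdp := hB.d_pos k
  have hdp' : (0:ℝ) < d k := by exact_mod_cast hdp
  have hd2 : (d k:ℝ) / 2 ≤ (d k:ℝ) := by linarith
  have h1 : Rs A w s0 (L k) M Y ≤ Kf A (d k) * mf A w s0 (L k) := by
    calc Rs A w s0 (L k) M Y ≤ ∑ i ∈ Finset.Icc 1 M, Kf A (d k) * wbf A w s0 (L k) (Y + i) := by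
          apply Finset.sum_le_sum
          intro i hi
          by_cases hz : (s0:ℤ) ≤ Y + i ∧ Y + i ≤ L k
          · apply mul_le_mul_of_nonneg_right _ (wbf_nonneg h _ _ _)
            apply Kf_anti h hdp'
            have : d k ≤ i := by omega
            exact_mod_cast this
          · rw [wbf_zero hz]; simp
      _ ≤ _ := by
          rw [← Finset.mul_sum]
          apply mul_le_mul_of_nonneg_left _ (Kf_nonneg hdp'.le)
          apply sum_wbf_inj h
          intro i _ j _ hij; simp only [add_right_inj, Nat.cast_inj] at hij; exact hij
  have h2 := hB.kd k _ hd2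
  have hk : (0:ℝ) < k + 1 := by positivity
  rw [le_div_iff₀ (by positivity)]
  have h3 : ((k:ℝ) + 1) * mf A w s0 (L k) * (A (d k) ^ 2 / (d k)) * (k + 1) ≤ 1 := by
    rwa [le_div_iff₀ hk] at h2
  calc _ ≤ Kf A (d k) * mf A w s0 (L k) * ((k:ℝ) + 1) ^ 2 := by gcongr
    _ = ((k:ℝ) + 1) * mf A w s0 (L k) * (A (d k) ^ 2 / (d k)) * (k + 1) := by unfold Kf; ring
    _ ≤ 1 := h3

lemma sum_K_wbf (hB : Bl A w C s0 L d) (k : ℕ) :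
    ∑ s ∈ Finset.Icc s0 (L k), Kf A s * wbf A w s0 (L k) s = 1 := by
  have hZ := Zf_pos hB k
  have : ∀ s ∈ Finset.Icc s0 (L k), Kf A s * wbf A w s0 (L k) s = (A s ^ 2 / s * w s) / Zf A w s0 (L k) := by
    intro s hs; rw [wbf_nat hs, Kf]; ring
  rw [Finset.sum_congr rfl this, ← Finset.sum_div]
  exact div_self hZ.ne'

lemma Rs_near (h : GoodA α A w c C a) (hB : Bl A w C s0 L d) (k M : ℕ) (Y : ℤ) :
    Rs A w s0 (L k) M Y ≤ 2 + C / c := by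
  have hZ := Zf_pos hB k
  have hZ1 : 1 ≤ Zf A w s0 (L k) := by have := hB.Z_ge k; have : (0:ℝ) ≤ k := by positivity
                                       linarith
  have hC := h.C_ge
  have hc := h.c_pos
  have hs0 := hB.s0_pos
  have key : ∀ i ∈ Finset.Icc 1 M, Kf A i * wbf A w s0 (L k) (Y + i) ≤
      2 * (Kf A ((Y + i : ℤ):ℝ) * wbf A w s0 (L k) (Y + i)) + if i ≤ Y.toNat then Kf A i * w Y.toNat else 0 := by
    intro i hi
    rw [Finset.mem_Icc] at hi
    have hi0 : (0:ℝ) < i := by exact_mod_cast hi.1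
    have hKi := Kf_nonneg (A := A) hi0.le
    have hw0 := wbf_nonneg h s0 (L k) (Y + i)
    have hif : 0 ≤ if i ≤ Y.toNat then Kf A i * w Y.toNat else 0 := by
      split_ifs
      · have := h.w_pos Y.toNat; positivity
      · exact le_rfl
    by_cases hz : (s0:ℤ) ≤ Y + i ∧ Y + i ≤ L k
    · have hYi0 : (0:ℝ) < ((Y + i : ℤ):ℝ) := by exact_mod_cast (by omega : 0 < Y + i)
      have hKY := Kf_nonneg (A := A) hYi0.le
      by_cases hiY : i ≤ Y.toNat
      · rw [if_pos hiY]
        have e : Y + i = ((Y.toNat + i : ℕ):ℤ) := by omega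
        have hw := wbf_le h hB k (Y.toNat + i)
        have : wbf A w s0 (L k) (Y + i) ≤ w Y.toNat := by
          rw [e]
          refine hw.trans (le_trans (div_le_self (h.w_pos _).le hZ1) (h.w_anti (by omega)))
        have : 0 ≤ 2 * (Kf A ((Y + i : ℤ):ℝ) * wbf A w s0 (L k) (Y + i)) := by positivity
        have : Kf A i * wbf A w s0 (L k) (Y + i) ≤ Kf A i * w Y.toNat := by gcongr
        linarith
      · rw [if_neg hiY, add_zero]
        have h3 : Kf A i ≤ 2 * Kf A ((Y + i : ℤ):ℝ) := by
          by_cases hY0 : Y ≤ 0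
          · have : Kf A i ≤ Kf A ((Y + i : ℤ):ℝ) := Kf_anti h hYi0 (by exact_mod_cast (by omega : Y + i ≤ i))
            linarith
          · refine Kf_dbl h hi0 (by exact_mod_cast (by omega : (i:ℤ) ≤ Y + i)) (by exact_mod_cast (by omega : Y + i ≤ 2 * (i:ℤ)))
        calc _ ≤ 2 * Kf A ((Y + i : ℤ):ℝ) * wbf A w s0 (L k) (Y + i) := by gcongr
          _ = _ := by ring
    · rw [wbf_zero hz]; simpa using hif
  refine (Finset.sum_le_sum key).trans ?_
  rw [Finset.sum_add_distrib, ← Finset.mul_sum]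
  have s1 : ∑ i ∈ Finset.Icc 1 M, Kf A ((Y + i : ℤ):ℝ) * wbf A w s0 (L k) (Y + i) ≤ 1 := by
    rw [← sum_K_wbf hB k]
    have hinj : Set.InjOn (fun i : ℕ => (Y + i).toNat)
        (Finset.filter (fun i : ℕ => (s0:ℤ) ≤ Y + i ∧ Y + i ≤ L k) (Finset.Icc 1 M)) := by
      intro i hi j hj hij
      simp only [Finset.coe_filter, Set.mem_ofPred_eq] at hi hj
      dsimp only at hij; omega
    calc _ = ∑ i ∈ Finset.filter (fun i : ℕ => (s0:ℤ) ≤ Y + i ∧ Y + i ≤ L k) (Finset.Icc 1 M),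
          Kf A ((Y + i : ℤ):ℝ) * wbf A w s0 (L k) (Y + i) := by
          symm; apply Finset.sum_filter_of_ne
          intro i _ hne
          by_contra hz; rw [wbf_zero hz] at hne; simp at hne
      _ = ∑ i ∈ Finset.filter (fun i : ℕ => (s0:ℤ) ≤ Y + i ∧ Y + i ≤ L k) (Finset.Icc 1 M),
          (fun s : ℕ => Kf A s * wbf A w s0 (L k) s) ((Y + i).toNat) := by
          apply Finset.sum_congr rfl
          intro i hi
          simp only [Finset.mem_filter] at hi
          have e : Y + i = (((Y + i).toNat : ℕ):ℤ) := by omega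
          dsimp only
          have e2 : ((Y + i : ℤ):ℝ) = (((Y + i).toNat : ℕ):ℝ) := by exact_mod_cast e
          rw [e2, ← e]
      _ = ∑ s ∈ Finset.image (fun i : ℕ => (Y + i).toNat) (Finset.filter (fun i : ℕ => (s0:ℤ) ≤ Y + i ∧ Y + i ≤ L k) (Finset.Icc 1 M)),
          Kf A s * wbf A w s0 (L k) s := by rw [Finset.sum_image hinj]
      _ ≤ _ := by
          apply Finset.sum_le_sum_of_subset_of_nonneg
          · intro s hs
            simp only [Finset.mem_image, Finset.mem_filter, Finset.mem_Icc] at *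
            obtain ⟨i, hi, rfl⟩ := hs
            omega
          · intro s _ _
            exact mul_nonneg (Kf_nonneg (by positivity)) (wbf_nonneg h _ _ _)
  have s2 : ∑ i ∈ Finset.Icc 1 M, (if i ≤ Y.toNat then Kf A i * w Y.toNat else 0) ≤ C / c := by
    have hwy := h.w_pos Y.toNat
    rw [← Finset.sum_filter]
    calc _ ≤ ∑ i ∈ Finset.Icc 1 Y.toNat, Kf A i * w Y.toNat := by
          apply Finset.sum_le_sum_of_subset_of_nonneg
          · intro i hi; simp only [Finset.mem_filter, Finset.mem_Icc] at *; omega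
          · intro i _ _; exact mul_nonneg (Kf_nonneg (by positivity)) hwy.le
      _ = (∑ i ∈ Finset.Icc 1 Y.toNat, Kf A i) * w Y.toNat := by rw [Finset.sum_mul]
      _ ≤ A Y.toNat ^ 2 / c * w Y.toNat := by gcongr; exact sum_Kf h _
      _ = A Y.toNat ^ 2 * w Y.toNat / c := by ring
      _ ≤ C / c := by gcongr; exact h.w_A _
  linarith

lemma sum_Rs (h : GoodA α A w c C a) (hB : Bl A w C s0 L d) (k M n : ℕ) :
    ∑ j ∈ Finset.range (k + 1), Rs A w s0 (L k) M ((n:ℤ) - (Xf d k + j * d k : ℕ)) ≤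
      1 + 2 * (2 + C / c) := by
  have hC := h.C_ge
  have hc := h.c_pos
  have hE : 0 ≤ 2 + C / c := by positivity
  have hdp := hB.d_pos k
  have hdL := hB.dL k
  have key : ∀ j ∈ Finset.range (k + 1), Rs A w s0 (L k) M ((n:ℤ) - (Xf d k + j * d k : ℕ)) ≤
      1 / ((k:ℝ) + 1) ^ 2 + (if 0 < (n:ℤ) - (Xf d k + j * d k : ℕ) ∧ (n:ℤ) - (Xf d k + j * d k : ℕ) ≤ d k
        then 2 + C / c else 0) +
        (if 0 < ((n + d k : ℕ):ℤ) - (Xf d k + j * d k : ℕ) ∧ ((n + d k : ℕ):ℤ) - (Xf d k + j * d k : ℕ) ≤ d k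
        then 2 + C / c else 0) := by
    intro j _
    have hp : (0:ℝ) ≤ 1 / ((k:ℝ) + 1) ^ 2 := by positivity
    have i1 : 0 ≤ (if 0 < (n:ℤ) - (Xf d k + j * d k : ℕ) ∧ (n:ℤ) - (Xf d k + j * d k : ℕ) ≤ d k
        then 2 + C / c else 0) := by split_ifs <;> simp [hE]
    have i2 : 0 ≤ (if 0 < ((n + d k : ℕ):ℤ) - (Xf d k + j * d k : ℕ) ∧ ((n + d k : ℕ):ℤ) - (Xf d k + j * d k : ℕ) ≤ d k
        then 2 + C / c else 0) := by split_ifs <;> simp [hE]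
    have hn := Rs_near h hB k M ((n:ℤ) - (Xf d k + j * d k : ℕ))
    by_cases c1 : 0 < (n:ℤ) - (Xf d k + j * d k : ℕ) ∧ (n:ℤ) - (Xf d k + j * d k : ℕ) ≤ d k
    · rw [if_pos c1]; linarith
    by_cases c2 : 0 < ((n + d k : ℕ):ℤ) - (Xf d k + j * d k : ℕ) ∧ ((n + d k : ℕ):ℤ) - (Xf d k + j * d k : ℕ) ≤ d k
    · rw [if_pos c2]; linarith
    rw [if_neg c1, if_neg c2]
    simp only [add_zero]
    set q := j * d k
    by_cases c4 : (n:ℤ) - (Xf d k + q : ℕ) ≤ - d k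
    · exact Rs_far h hB k M c4
    · have : Rs A w s0 (L k) M ((n:ℤ) - (Xf d k + q : ℕ)) = 0 := by
        apply Finset.sum_eq_zero
        intro i hi
        rw [wbf_zero, mul_zero]
        push_cast at *
        omega
      rw [this]; exact hp
  refine (Finset.sum_le_sum key).trans ?_
  rw [Finset.sum_add_distrib, Finset.sum_add_distrib, Finset.sum_const, Finset.card_range, nsmul_eq_mul]
  have h2 := one_j (d k) n (Xf d k) (k + 1) _ hE
  have h3 := one_j (d k) (n + d k) (Xf d k) (k + 1) _ hE
  have h1 : ((k + 1 : ℕ):ℝ) * (1 / ((k:ℝ) + 1) ^ 2) = 1 / ((k:ℝ) + 1) := by push_cast; field_simp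
  have h4 : 1 / ((k:ℝ) + 1) ≤ 1 := by
    rw [div_le_one (by positivity)]; have : (0:ℝ) ≤ k := by positivity
    linarith
  rw [h1]
  linarith

end

/-- left sum against all bumps -/
noncomputable def PL (A : ℝ → ℝ) (w : ℕ → ℝ) (s0 : ℕ) (L d : ℕ → ℕ) (n M : ℕ) : ℝ :=
  ∑ i ∈ Finset.Icc 1 M, Kf A i * gg A w s0 L d ((n:ℤ) - i)

/-- right sum against all bumps -/
noncomputable def PR (A : ℝ → ℝ) (w : ℕ → ℝ) (s0 : ℕ) (L d : ℕ → ℕ) (n M : ℕ) : ℝ :=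
  ∑ i ∈ Finset.Icc 1 M, Kf A i * gg A w s0 L d ((n:ℤ) + i)

section
variable {α : ℝ} {A : ℝ → ℝ} {w : ℕ → ℝ} {c C a : ℝ} {s0 : ℕ} {L d : ℕ → ℕ}

lemma PL_eq (hB : Bl A w C s0 L d) (k n M : ℕ)
    (hk : ∀ i ∈ Finset.Icc 1 M, (Xf d k : ℤ) ≤ 8 * ((n:ℤ) - i) ∧ ((n:ℤ) - i) < 16 * Xf d k) :
    PL A w s0 L d n M = A (Xf d k) / Xf d k *
      ∑ j ∈ Finset.range (k + 1), Ls A w s0 (L k) M ((n:ℤ) - (Xf d k + j * d k : ℕ)) := by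
  unfold PL Ls
  rw [Finset.sum_comm, Finset.mul_sum]
  apply Finset.sum_congr rfl
  intro i hi
  rw [gg_eq_Gk hB (hk i hi).1 (hk i hi).2, Gk, ← Finset.mul_sum]
  have : ∀ j : ℕ, (n:ℤ) - i - (Xf d k + j * d k : ℕ) = (n:ℤ) - (Xf d k + j * d k : ℕ) - i := fun j => by ring
  simp_rw [this]
  ring

lemma PR_eq (hB : Bl A w C s0 L d) (k n M : ℕ)
    (hk : ∀ i ∈ Finset.Icc 1 M, (Xf d k : ℤ) ≤ 8 * ((n:ℤ) + i) ∧ ((n:ℤ) + i) < 16 * Xf d k) :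
    PR A w s0 L d n M = A (Xf d k) / Xf d k *
      ∑ j ∈ Finset.range (k + 1), Rs A w s0 (L k) M ((n:ℤ) - (Xf d k + j * d k : ℕ)) := by
  unfold PR Rs
  rw [Finset.sum_comm, Finset.mul_sum]
  apply Finset.sum_congr rfl
  intro i hi
  rw [gg_eq_Gk hB (hk i hi).1 (hk i hi).2, Gk, ← Finset.mul_sum]
  have : ∀ j : ℕ, (n:ℤ) + i - (Xf d k + j * d k : ℕ) = (n:ℤ) - (Xf d k + j * d k : ℕ) + i := fun j => by ring
  simp_rw [this]
  ring

lemma W_bd (h : GoodA α A w c C a) (hB : Bl A w C s0 L d) (k n : ℕ) (h1 : Xf d k ≤ 2 * n) (h2 : n ≤ 4 * Xf d k) :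
    (n:ℝ) / A n * (A (Xf d k) / Xf d k) ≤ 8 := by
  have hX := hB.X_pos k
  have hX0 : (0:ℝ) < Xf d k := by exact_mod_cast hX
  have hn0 : (0:ℝ) < n := by exact_mod_cast (by omega : 0 < n)
  have p := h.pos hn0.le
  have e1 : A (Xf d k) ≤ 2 * A n := (h.mono hX0.le (by exact_mod_cast h1)).trans (h.two hn0)
  have e2 : (n:ℝ) ≤ 4 * Xf d k := by exact_mod_cast h2
  rw [div_mul_div_comm, div_le_iff₀ (by positivity)]
  calc (n:ℝ) * A (Xf d k) ≤ (4 * Xf d k) * (2 * A n) := by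
        have := h.pos hX0.le
        gcongr
    _ = _ := by ring

lemma PL_small (h : GoodA α A w c C a) (hB : Bl A w C s0 L d) {ε : ℝ} (hε : 0 < ε) :
    ∃ n0 : ℕ, ∀ n M : ℕ, n0 ≤ n → 4 * M ≤ n → (n:ℝ) / A n * PL A w s0 L d n M ≤ ε := by
  have hC := h.C_ge
  have hc := h.c_pos
  set E := 1 + 2 * C / c + 2 * C
  have hE : 0 < E := by positivity
  obtain ⟨k0, hk0⟩ := exists_nat_gt (8 * E / ε)
  obtain ⟨n0, hn0⟩ : ∃ n0 : ℕ, ∀ k < k0, 4 * Xf d k + 1 ≤ n0 :=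
    ⟨∑ k ∈ Finset.range k0, (4 * Xf d k + 1), fun k hk =>
      Finset.single_le_sum (f := fun k => 4 * Xf d k + 1) (fun _ _ => Nat.zero_le _) (Finset.mem_range.2 hk)⟩
  refine ⟨n0, fun n M hn hM => ?_⟩
  have pn := h.pos (x := (n:ℝ)) (by positivity)
  by_cases hex : ∃ i ∈ Finset.Icc 1 M, gg A w s0 L d ((n:ℤ) - i) ≠ 0
  · obtain ⟨i, hi, hne⟩ := hex
    obtain ⟨k, hk1, hk2⟩ := gg_ne hB hne
    rw [Finset.mem_Icc] at hi
    have hkk : k0 ≤ k := by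
      by_contra hlt
      have := hn0 k (by omega)
      omega
    rw [PL_eq hB k n M (by intro i' hi'; rw [Finset.mem_Icc] at hi'; omega)]
    have hw := W_bd h hB k n (by omega) (by omega)
    have hs := sum_Ls h hB k M n
    have hk0' : (k0:ℝ) ≤ k := by exact_mod_cast hkk
    have hw0 : 0 ≤ (n:ℝ) / A n * (A (Xf d k) / Xf d k) := by
      have := h.pos (x := (Xf d k:ℝ)) (by positivity)
      positivity
    calc _ = ((n:ℝ) / A n * (A (Xf d k) / Xf d k)) * _ := by rw [mul_assoc]
      _ ≤ ((n:ℝ) / A n * (A (Xf d k) / Xf d k)) * (E / (k + 1)) := by gcongr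
      _ ≤ 8 * (E / (k + 1)) := by gcongr
      _ = 8 * E / (k + 1) := by ring
      _ ≤ ε := by
        rw [div_lt_iff₀ hε] at hk0
        rw [div_le_iff₀ (by positivity)]
        nlinarith
  · push Not at hex
    have : PL A w s0 L d n M = 0 := Finset.sum_eq_zero fun i hi => by rw [hex i hi, mul_zero]
    rw [this, mul_zero]; exact hε.le

lemma PR_bdd (h : GoodA α A w c C a) (hB : Bl A w C s0 L d) :
    ∃ E : ℝ, 0 < E ∧ ∀ n M : ℕ, 4 * M ≤ n → (n:ℝ) / A n * PR A w s0 L d n M ≤ E := by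
  have hC := h.C_ge
  have hc := h.c_pos
  refine ⟨8 * (1 + 2 * (2 + C / c)), by positivity, fun n M hM => ?_⟩
  have pn := h.pos (x := (n:ℝ)) (by positivity)
  by_cases hex : ∃ i ∈ Finset.Icc 1 M, gg A w s0 L d ((n:ℤ) + i) ≠ 0
  · obtain ⟨i, hi, hne⟩ := hex
    obtain ⟨k, hk1, hk2⟩ := gg_ne hB hne
    rw [Finset.mem_Icc] at hi
    rw [PR_eq hB k n M (by intro i' hi'; rw [Finset.mem_Icc] at hi'; omega)]
    have hw := W_bd h hB k n (by omega) (by omega)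
    have hs := sum_Rs h hB k M n
    have hw0 : 0 ≤ (n:ℝ) / A n * (A (Xf d k) / Xf d k) := by
      have := h.pos (x := (Xf d k:ℝ)) (by positivity)
      positivity
    calc _ = ((n:ℝ) / A n * (A (Xf d k) / Xf d k)) * _ := by rw [mul_assoc]
      _ ≤ ((n:ℝ) / A n * (A (Xf d k) / Xf d k)) * (1 + 2 * (2 + C / c)) := by gcongr
      _ ≤ _ := by gcongr
  · push Not at hex
    have : PR A w s0 L d n M = 0 := Finset.sum_eq_zero fun i hi => by rw [hex i hi, mul_zero]
    rw [this, mul_zero]; positivity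

lemma PR_X (h : GoodA α A w c C a) (hB : Bl A w C s0 L d) (k M : ℕ) (h1 : L k ≤ M) (h2 : M ≤ Xf d k) :
    A (Xf d k) / Xf d k ≤ PR A w s0 L d (Xf d k) M := by
  have hX := hB.X_pos k
  rw [PR_eq hB k _ M (by intro i hi; rw [Finset.mem_Icc] at hi; omega)]
  have p := h.pos (x := (Xf d k:ℝ)) (by positivity)
  apply le_mul_of_one_le_right (by positivity)
  have hnn : ∀ j ∈ Finset.range (k + 1), 0 ≤ Rs A w s0 (L k) M ((Xf d k:ℤ) - (Xf d k + j * d k : ℕ)) := by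
    intro j _
    exact Finset.sum_nonneg fun i _ => mul_nonneg (Kf_nonneg (by positivity)) (wbf_nonneg h _ _ _)
  refine le_trans ?_ (Finset.single_le_sum hnn (Finset.mem_range.2 (Nat.succ_pos k)))
  rw [← sum_K_wbf hB k]
  have : ((Xf d k:ℤ) - (Xf d k + 0 * d k : ℕ)) = 0 := by simp
  rw [this, Rs]
  simp only [zero_add]
  apply Finset.sum_le_sum_of_subset_of_nonneg
  · intro i hi; have := hB.s0_pos; simp only [Finset.mem_Icc] at *; omega
  · intro i _ _; exact mul_nonneg (Kf_nonneg (by positivity)) (wbf_nonneg h _ _ _)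

end

/- step integrals -/
lemma step_int (H : ℕ → ℝ) (M : ℕ) :
    IntegrableOn (fun s : ℝ => H ⌊s⌋₊) (Ioc 1 ((M:ℝ) + 1)) ∧
      ∫ s in Ioc (1:ℝ) ((M:ℝ) + 1), H ⌊s⌋₊ = ∑ i ∈ Finset.Icc 1 M, H i := by
  induction M with
  | zero => simp
  | succ M ih =>
    have hu : Ioc (1:ℝ) (((M + 1 : ℕ):ℝ) + 1) = Ioc (1:ℝ) ((M:ℝ) + 1) ∪ Ioc ((M:ℝ) + 1) ((M:ℝ) + 1 + 1) := by
      push_cast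
      rw [Ioc_union_Ioc_eq_Ioc] <;> linarith [show (0:ℝ) ≤ M by positivity]
    have hae : (fun s : ℝ => H ⌊s⌋₊) =ᵐ[volume.restrict (Ioc ((M:ℝ) + 1) ((M:ℝ) + 1 + 1))] fun _ => H (M + 1) := by
      rw [← restrict_Ioo_eq_restrict_Ioc]
      refine (ae_restrict_iff' measurableSet_Ioo).2 (Eventually.of_forall fun s hs => ?_)
      have : ⌊s⌋₊ = M + 1 := by
        rw [Nat.floor_eq_iff (by linarith [hs.1, show (0:ℝ) ≤ M by positivity])]
        push_cast; exact ⟨hs.1.le, hs.2⟩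
      simp only [this]
    have hi2 : IntegrableOn (fun s : ℝ => H ⌊s⌋₊) (Ioc ((M:ℝ) + 1) ((M:ℝ) + 1 + 1)) := by
      rw [IntegrableOn, integrable_congr hae]
      exact integrableOn_const (by simp)
    rw [hu]
    refine ⟨ih.1.union hi2, ?_⟩
    rw [setIntegral_union _ measurableSet_Ioc ih.1 hi2, ih.2, integral_congr_ae hae,
      Finset.sum_Icc_succ_top (by omega)]
    · simp
    · rw [Set.disjoint_left]; intro s hs hs'; exact absurd hs.2 (not_le.2 hs'.1)

lemma int_le_sum (f : ℝ → ℝ) (H : ℕ → ℝ) (b : ℝ) (hb : 1 ≤ b)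
    (hf : ∀ s, 1 ≤ s → s ≤ b → 0 ≤ f s ∧ f s ≤ H ⌊s⌋₊) (hH : ∀ i ∈ Finset.Icc 1 ⌊b⌋₊, 0 ≤ H i) :
    ∫ s in (1:ℝ)..b, f s ≤ ∑ i ∈ Finset.Icc 1 ⌊b⌋₊, H i := by
  rw [intervalIntegral.integral_of_le hb]
  obtain ⟨h1, h2⟩ := step_int H ⌊b⌋₊
  rw [← h2]
  have hsub : Ioc (1:ℝ) b ⊆ Ioc (1:ℝ) ((⌊b⌋₊:ℝ) + 1) := Ioc_subset_Ioc_right (Nat.lt_floor_add_one b).le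
  calc ∫ s in Ioc (1:ℝ) b, f s ≤ ∫ s in Ioc (1:ℝ) b, H ⌊s⌋₊ := by
        apply integral_mono_of_nonneg
        · exact (ae_restrict_iff' measurableSet_Ioc).2 (Eventually.of_forall fun s hs => (hf s hs.1.le hs.2).1)
        · exact h1.mono_set hsub
        · exact (ae_restrict_iff' measurableSet_Ioc).2 (Eventually.of_forall fun s hs => (hf s hs.1.le hs.2).2)
    _ ≤ _ := by
        apply setIntegral_mono_set h1 _ (Eventually.of_forall hsub)
        rw [← restrict_Ioo_eq_restrict_Ioc]
        refine (ae_restrict_iff' measurableSet_Ioo).2 (Eventually.of_forall fun s hs => ?_)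
        apply hH
        rw [Finset.mem_Icc]
        have h0 : (0:ℝ) ≤ s := by linarith [hs.1]
        refine ⟨Nat.le_floor (by exact_mod_cast hs.1.le), ?_⟩
        have := (Nat.floor_lt h0).2 (show s < ((⌊b⌋₊ + 1 : ℕ):ℝ) by push_cast; exact hs.2)
        omega

lemma sum_le_int (f : ℝ → ℝ) (H H' : ℕ → ℝ) (b : ℝ) (M : ℕ) (hb : 1 ≤ b) (hM : (M:ℝ) + 1 ≤ b)
    (hf : ∀ s, 1 ≤ s → s ≤ b → 0 ≤ f s ∧ f s ≤ H ⌊s⌋₊)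
    (hf' : ∀ s, 1 ≤ s → s < (M:ℝ) + 1 → H' ⌊s⌋₊ ≤ f s)
    (hm : AEStronglyMeasurable f (volume.restrict (Ioc 1 b))) :
    ∑ i ∈ Finset.Icc 1 M, H' i ≤ ∫ s in (1:ℝ)..b, f s := by
  rw [intervalIntegral.integral_of_le hb]
  obtain ⟨h1, h2⟩ := step_int H' M
  obtain ⟨h3, _⟩ := step_int H ⌊b⌋₊
  have hIntg : IntegrableOn f (Ioc 1 b) := by
    have hsub : Ioc (1:ℝ) b ⊆ Ioc (1:ℝ) ((⌊b⌋₊:ℝ) + 1) := Ioc_subset_Ioc_right (Nat.lt_floor_add_one b).le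
    refine (h3.mono_set hsub).mono' hm ?_
    refine (ae_restrict_iff' measurableSet_Ioc).2 (Eventually.of_forall fun s hs => ?_)
    rw [Real.norm_eq_abs, abs_of_nonneg (hf s hs.1.le hs.2).1]
    exact (hf s hs.1.le hs.2).2
  rw [← h2]
  have hsub : Ioc (1:ℝ) ((M:ℝ) + 1) ⊆ Ioc (1:ℝ) b := Ioc_subset_Ioc_right hM
  calc _ ≤ ∫ s in Ioc (1:ℝ) ((M:ℝ) + 1), f s := by
        apply integral_mono_ae h1 (hIntg.mono_set hsub)
        rw [← restrict_Ioo_eq_restrict_Ioc]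
        exact (ae_restrict_iff' measurableSet_Ioo).2 (Eventually.of_forall fun s hs => hf' s hs.1.le hs.2)
    _ ≤ _ := by
        apply setIntegral_mono_set hIntg _ (Eventually.of_forall hsub)
        exact (ae_restrict_iff' measurableSet_Ioc).2 (Eventually.of_forall fun s hs => (hf s hs.1.le hs.2).1)

section
variable {α : ℝ} {A : ℝ → ℝ} {w : ℕ → ℝ} {c C a : ℝ} {s0 : ℕ} {L d : ℕ → ℕ}

lemma gt_le' (h : GoodA α A w c C a) (hB : Bl A w C s0 L d) (m : ℕ) : gt A w s0 L d m ≤ 1 / A m := by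
  refine (gt_le h hB 0 m (by intro k hk; omega)).trans ?_
  have p2 := h.pos (x := (m:ℝ)) (by positivity)
  have := h.mono (x := (m:ℝ)) (y := ((m + 1:ℕ):ℝ)) (by positivity) (by push_cast; linarith)
  apply div_le_div₀ zero_le_one _ p2 this
  norm_num

lemma rr_up (h : GoodA α A w c C a) (hB : Bl A w C s0 L d) {x y : ℝ} (hy : 1 ≤ y) (hyx : y ≤ 2 * x) :
    0 ≤ rr (toM (stp A w s0 L d)) 1 y ∧
    rr (toM (stp A w s0 L d)) 1 y ≤ 2 + 4 * x * A x * gg A w s0 L d ⌊y⌋₊ := by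
  have hx : 0 < x := by linarith
  have hn : 1 ≤ ⌊y⌋₊ := Nat.le_floor (by exact_mod_cast hy)
  have hg := gg_nonneg (s0 := s0) (L := L) (d := d) h (⌊y⌋₊:ℤ)
  have hf := f0_nonneg h hn
  have hf2 := f0_hi h hn
  rw [rr_eq h hB hy]
  have b1 := Nat.floor_le (show 0 ≤ y by linarith)
  have b2 := (Nat.lt_floor_add_one y).le
  set n := ⌊y⌋₊
  have hn1 : (1:ℝ) ≤ n := by exact_mod_cast hn
  have p := h.pos (x := (n:ℝ)) (by positivity)
  have g0 := gt_nonneg (A := A) (w := w) (s0 := s0) (L := L) (d := d) n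
  refine ⟨by positivity, ?_⟩
  have e1 : y * (f0 A n + gg A w s0 L d n) / (1 / A n + gt A w s0 L d n) ≤
      y * (f0 A n + gg A w s0 L d n) / (1 / A n) := by
    apply div_le_div_of_nonneg_left (by positivity) (by positivity) (by linarith)
  refine e1.trans ?_
  rw [div_div_eq_mul_div, div_one, mul_add, add_mul]
  apply add_le_add
  · calc y * f0 A n * A n ≤ (2 * n) * (1 / (n * A n)) * A n := by gcongr; linarith
      _ = 2 := by field_simp
  · have e2 : A n ≤ 2 * A x := (h.mono (by positivity) (b1.trans hyx)).trans (h.two hx)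
    calc y * gg A w s0 L d n * A n ≤ (2 * x) * gg A w s0 L d n * (2 * A x) := by gcongr
      _ = _ := by ring

lemma rr_dn (h : GoodA α A w c C a) (hB : Bl A w C s0 L d) {x y : ℝ} (hx : 1 ≤ x) (hxy : x ≤ ⌊y⌋₊) :
    x * A x * gg A w s0 L d ⌊y⌋₊ / 2 ≤ rr (toM (stp A w s0 L d)) 1 y := by
  have hn : 1 ≤ ⌊y⌋₊ := by
    have : (1:ℝ) ≤ ⌊y⌋₊ := hx.trans hxy
    exact_mod_cast this
  have hy : 1 ≤ y := by
    have := (Nat.le_floor_iff' (by omega : (1:ℕ) ≠ 0)).1 hn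
    exact_mod_cast this
  have hg := gg_nonneg (s0 := s0) (L := L) (d := d) h (⌊y⌋₊:ℤ)
  have hf := f0_nonneg h hn
  rw [rr_eq h hB hy]
  have b1 := Nat.floor_le (show 0 ≤ y by linarith)
  set n := ⌊y⌋₊
  have p := h.pos (x := (n:ℝ)) (by positivity)
  have px := h.pos (x := x) (by linarith)
  have g0 := gt_nonneg (A := A) (w := w) (s0 := s0) (L := L) (d := d) n
  have g1 := gt_le' h hB n
  rw [le_div_iff₀ (by positivity)]
  have e2 := h.mono (by linarith) hxy
  have e3 : 1 / A n + gt A w s0 L d n ≤ 2 / A x := by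
    have : 1 / A n ≤ 1 / A x := one_div_le_one_div_of_le px e2
    have e : 2 / A x = 1 / A x + 1 / A x := by ring
    linarith
  calc x * A x * gg A w s0 L d n / 2 * (1 / A n + gt A w s0 L d n)
      ≤ x * A x * gg A w s0 L d n / 2 * (2 / A x) := by gcongr
    _ = x * gg A w s0 L d n := by field_simp
    _ ≤ y * (f0 A n + gg A w s0 L d n) := by
      gcongr
      · exact hxy.trans b1
      · linarith

/-- left majorant -/
noncomputable def HL (A : ℝ → ℝ) (w : ℕ → ℝ) (s0 : ℕ) (L d : ℕ → ℕ) (x : ℝ) (i : ℕ) : ℝ :=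
  Kf A i * (2 + 4 * x * A x * (gg A w s0 L d ((⌊x⌋₊:ℤ) - i) + gg A w s0 L d (((⌊x⌋₊ - 1 : ℕ):ℤ) - i)))

/-- right majorant -/
noncomputable def HR (A : ℝ → ℝ) (w : ℕ → ℝ) (s0 : ℕ) (L d : ℕ → ℕ) (x : ℝ) (i : ℕ) : ℝ :=
  Kf A i * (2 + 4 * x * A x * (gg A w s0 L d ((⌊x⌋₊:ℤ) + i) + gg A w s0 L d (((⌊x⌋₊ + 1 : ℕ):ℤ) + i)))

lemma HL_nonneg (h : GoodA α A w c C a) {x : ℝ} (hx : 1 ≤ x) (i : ℕ) : 0 ≤ HL A w s0 L d x i := by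
  have px := h.pos (x := x) (by linarith)
  have := Kf_nonneg (A := A) (s := (i:ℝ)) (by positivity)
  have := gg_nonneg (s0 := s0) (L := L) (d := d) h ((⌊x⌋₊:ℤ) - i)
  have := gg_nonneg (s0 := s0) (L := L) (d := d) h (((⌊x⌋₊ - 1 : ℕ):ℤ) - i)
  unfold HL; positivity

lemma HR_nonneg (h : GoodA α A w c C a) {x : ℝ} (hx : 1 ≤ x) (i : ℕ) : 0 ≤ HR A w s0 L d x i := by
  have px := h.pos (x := x) (by linarith)
  have := Kf_nonneg (A := A) (s := (i:ℝ)) (by positivity)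
  have := gg_nonneg (s0 := s0) (L := L) (d := d) h ((⌊x⌋₊:ℤ) + i)
  have := gg_nonneg (s0 := s0) (L := L) (d := d) h (((⌊x⌋₊ + 1 : ℕ):ℤ) + i)
  unfold HR; positivity

lemma L_bd (h : GoodA α A w c C a) (hB : Bl A w C s0 L d) {x s : ℝ} (hx : 16 ≤ x) (hs : 1 ≤ s) (hsx : s ≤ x / 8) :
    0 ≤ A s ^ 2 / s * rr (toM (stp A w s0 L d)) 1 (x - s) ∧
      A s ^ 2 / s * rr (toM (stp A w s0 L d)) 1 (x - s) ≤ HL A w s0 L d x ⌊s⌋₊ := by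
  obtain ⟨h0, h1⟩ := rr_up (x := x) (y := x - s) h hB (by linarith) (by linarith)
  have px := h.pos (x := x) (by linarith)
  have hK := Kf_nonneg (A := A) (s := s) (by linarith)
  refine ⟨mul_nonneg hK h0, ?_⟩
  have hi : 1 ≤ ⌊s⌋₊ := Nat.le_floor (by exact_mod_cast hs)
  have a1 := Nat.floor_le (show 0 ≤ s by linarith)
  have a2 := Nat.lt_floor_add_one s
  have b1 := Nat.floor_le (show 0 ≤ x by linarith)
  have b2 := Nat.lt_floor_add_one x
  have c1 := Nat.floor_le (show 0 ≤ x - s by linarith)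
  have c2 := Nat.lt_floor_add_one (x - s)
  have hKi : Kf A s ≤ Kf A (⌊s⌋₊:ℝ) := Kf_anti h (by exact_mod_cast hi) a1
  unfold HL
  set i := ⌊s⌋₊
  set n := ⌊x⌋₊
  set m := ⌊x - s⌋₊
  have u1 : m + i < n + 1 := by
    have : (m:ℝ) + i < n + 1 := by linarith
    exact_mod_cast this
  have u2 : n < m + i + 2 := by
    have : (n:ℝ) < m + i + 2 := by linarith
    exact_mod_cast this
  have g1 := gg_nonneg (s0 := s0) (L := L) (d := d) h ((n:ℤ) - i)
  have g2 := gg_nonneg (s0 := s0) (L := L) (d := d) h (((n - 1 : ℕ):ℤ) - i)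
  have hg : gg A w s0 L d m ≤ gg A w s0 L d ((n:ℤ) - i) + gg A w s0 L d (((n - 1 : ℕ):ℤ) - i) := by
    rcases (by omega : m + i = n ∨ m + i + 1 = n) with e | e
    · have : (m:ℤ) = (n:ℤ) - i := by omega
      rw [← this] at g1 ⊢; linarith
    · have : (m:ℤ) = ((n - 1 : ℕ):ℤ) - i := by omega
      rw [← this] at g2 ⊢; linarith
  have hnn : 0 ≤ Kf A (i:ℝ) := Kf_nonneg (by positivity)
  change Kf A s * _ ≤ _
  calc _ ≤ Kf A i * (2 + 4 * x * A x * gg A w s0 L d m) := mul_le_mul hKi h1 h0 hnn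
    _ ≤ _ := by gcongr

lemma R_bd (h : GoodA α A w c C a) (hB : Bl A w C s0 L d) {x s : ℝ} (hx : 16 ≤ x) (hs : 1 ≤ s) (hsx : s ≤ x / 8) :
    0 ≤ A s ^ 2 / s * rr (toM (stp A w s0 L d)) 1 (x + s) ∧
      A s ^ 2 / s * rr (toM (stp A w s0 L d)) 1 (x + s) ≤ HR A w s0 L d x ⌊s⌋₊ := by
  obtain ⟨h0, h1⟩ := rr_up (x := x) (y := x + s) h hB (by linarith) (by linarith)
  have px := h.pos (x := x) (by linarith)
  have hK := Kf_nonneg (A := A) (s := s) (by linarith)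
  refine ⟨mul_nonneg hK h0, ?_⟩
  have hi : 1 ≤ ⌊s⌋₊ := Nat.le_floor (by exact_mod_cast hs)
  have a1 := Nat.floor_le (show 0 ≤ s by linarith)
  have a2 := Nat.lt_floor_add_one s
  have b1 := Nat.floor_le (show 0 ≤ x by linarith)
  have b2 := Nat.lt_floor_add_one x
  have c1 := Nat.floor_le (show 0 ≤ x + s by linarith)
  have c2 := Nat.lt_floor_add_one (x + s)
  have hKi : Kf A s ≤ Kf A (⌊s⌋₊:ℝ) := Kf_anti h (by exact_mod_cast hi) a1
  unfold HR
  set i := ⌊s⌋₊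
  set n := ⌊x⌋₊
  set m := ⌊x + s⌋₊
  have u1 : n + i < m + 1 := by
    have : (n:ℝ) + i < m + 1 := by linarith
    exact_mod_cast this
  have u2 : m < n + i + 2 := by
    have : (m:ℝ) < n + i + 2 := by linarith
    exact_mod_cast this
  have g1 := gg_nonneg (s0 := s0) (L := L) (d := d) h ((n:ℤ) + i)
  have g2 := gg_nonneg (s0 := s0) (L := L) (d := d) h (((n + 1 : ℕ):ℤ) + i)
  have hg : gg A w s0 L d m ≤ gg A w s0 L d ((n:ℤ) + i) + gg A w s0 L d (((n + 1 : ℕ):ℤ) + i) := by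
    rcases (by omega : m = n + i ∨ m = n + 1 + i) with e | e
    · have : (m:ℤ) = (n:ℤ) + i := by omega
      rw [← this] at g1 ⊢; linarith
    · have : (m:ℤ) = ((n + 1 : ℕ):ℤ) + i := by omega
      rw [← this] at g2 ⊢; linarith
  have hnn : 0 ≤ Kf A (i:ℝ) := Kf_nonneg (by positivity)
  change Kf A s * _ ≤ _
  calc _ ≤ Kf A i * (2 + 4 * x * A x * gg A w s0 L d m) := mul_le_mul hKi h1 h0 hnn
    _ ≤ _ := by gcongr

lemma sum_HL (x : ℝ) (M : ℕ) : ∑ i ∈ Finset.Icc 1 M, HL A w s0 L d x i =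
    2 * ∑ i ∈ Finset.Icc 1 M, Kf A i + 4 * x * A x * (PL A w s0 L d ⌊x⌋₊ M + PL A w s0 L d (⌊x⌋₊ - 1) M) := by
  unfold PL HL
  rw [Finset.mul_sum, ← Finset.sum_add_distrib, Finset.mul_sum, ← Finset.sum_add_distrib]
  apply Finset.sum_congr rfl; intro i _; ring

lemma sum_HR (x : ℝ) (M : ℕ) : ∑ i ∈ Finset.Icc 1 M, HR A w s0 L d x i =
    2 * ∑ i ∈ Finset.Icc 1 M, Kf A i + 4 * x * A x * (PR A w s0 L d ⌊x⌋₊ M + PR A w s0 L d (⌊x⌋₊ + 1) M) := by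
  unfold PR HR
  rw [Finset.mul_sum, ← Finset.sum_add_distrib, Finset.mul_sum, ← Finset.sum_add_distrib]
  apply Finset.sum_congr rfl; intro i _; ring

lemma PL_nonneg (h : GoodA α A w c C a) (n M : ℕ) : 0 ≤ PL A w s0 L d n M :=
  Finset.sum_nonneg fun i _ => mul_nonneg (Kf_nonneg (by positivity)) (gg_nonneg h _)

lemma PR_nonneg (h : GoodA α A w c C a) (n M : ℕ) : 0 ≤ PR A w s0 L d n M :=
  Finset.sum_nonneg fun i _ => mul_nonneg (Kf_nonneg (by positivity)) (gg_nonneg h _)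

lemma x_div_A (h : GoodA α A w c C a) {x : ℝ} (hx : 16 ≤ x) {n : ℕ} (h1 : x ≤ 2 * n) (h2 : (n:ℝ) ≤ x + 1) :
    x / A x ≤ 4 * (n / A n) := by
  have px := h.pos (x := x) (by linarith)
  have pn := h.pos (x := (n:ℝ)) (by positivity)
  have e : A n ≤ 2 * A x := (h.mono (by positivity) (by linarith)).trans (h.two (by linarith))
  rw [← mul_div_assoc, div_le_div_iff₀ px pn]
  calc x * A n ≤ (2 * n) * (2 * A x) := by gcongr
    _ = _ := by ring

lemma base_bd (h : GoodA α A w c C a) {x η : ℝ} (hx : 16 ≤ x) (hη : 0 < η) (hη1 : η ≤ 1 / 8) (h1 : 1 ≤ η * x) :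
    1 / A x ^ 2 * (2 * ∑ i ∈ Finset.Icc 1 ⌊η * x⌋₊, Kf A i) ≤ 2 * C ^ 2 / c * (η ^ a) ^ 2 := by
  have hc := h.c_pos
  have hC := h.C_ge
  have px := h.pos (x := x) (by linarith)
  have e1 := sum_Kf h ⌊η * x⌋₊
  have e2 : A (⌊η * x⌋₊:ℝ) ≤ C * η ^ a * A x := by
    refine (h.mono (by positivity) (Nat.floor_le (by linarith))).trans ?_
    have := h.small (η * x) x h1 (by nlinarith)
    rwa [mul_div_cancel_right₀ _ (by linarith : x ≠ 0)] at this
  have p := h.pos (x := (⌊η * x⌋₊:ℝ)) (by positivity)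
  calc _ ≤ 1 / A x ^ 2 * (2 * ((C * η ^ a * A x) ^ 2 / c)) := by
        gcongr
        exact e1.trans (by gcongr)
    _ = _ := by field_simp

lemma star_bd (h : GoodA α A w c C a) (hB : Bl A w C s0 L d) {η ε : ℝ} (hη : 0 < η) (hη1 : η ≤ 1 / 8) (hε : 0 < ε) :
    ∀ᶠ x in atTop, 1 / (A x) ^ 2 * ∫ s in (1:ℝ)..(η * x), (A s) ^ 2 / s * rr (toM (stp A w s0 L d)) 1 (x - s)
      ≤ 2 * C ^ 2 / c * (η ^ a) ^ 2 + ε := by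
  obtain ⟨n0, hn0⟩ := PL_small h hB (show 0 < ε / 32 by positivity)
  filter_upwards [eventually_ge_atTop (16:ℝ), eventually_ge_atTop (1 / η), eventually_ge_atTop ((n0:ℝ) + 2)] with x hx hxη hxn
  have h1 : 1 ≤ η * x := by rw [div_le_iff₀ hη] at hxη; linarith
  have hηx : η * x ≤ x / 8 := by nlinarith
  have px := h.pos (x := x) (by linarith)
  have key := int_le_sum (fun s => (A s) ^ 2 / s * rr (toM (stp A w s0 L d)) 1 (x - s)) (HL A w s0 L d x) (η * x) h1
    (fun s hs hs' => L_bd h hB hx hs (hs'.trans hηx)) (fun i _ => HL_nonneg h (by linarith) i)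
  have b1 := Nat.floor_le (show 0 ≤ x by linarith)
  have b2 := Nat.lt_floor_add_one x
  have hM := Nat.floor_le (show 0 ≤ η * x by linarith)
  set M := ⌊η * x⌋₊ with hMd
  rw [sum_HL] at key
  set n := ⌊x⌋₊
  have hn16 : 16 ≤ n := Nat.le_floor (by exact_mod_cast hx)
  have hn2 : n0 + 2 ≤ n := Nat.le_floor (by push_cast; exact hxn)
  have en : ((n - 1 : ℕ):ℝ) = (n:ℝ) - 1 := by push_cast [Nat.cast_sub (show 1 ≤ n by omega)]; ring
  have hn16' : (16:ℝ) ≤ n := by exact_mod_cast hn16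
  have hMn : 4 * M ≤ n - 1 := by
    have : (4:ℝ) * M ≤ ((n - 1 : ℕ):ℝ) := by rw [en]; linarith
    exact_mod_cast this
  have q1 := hn0 n M (by omega) (by omega)
  have q2 := hn0 (n - 1) M (by omega) hMn
  have r1 := x_div_A h hx (n := n) (by linarith) (by linarith)
  have r2 := x_div_A h hx (n := n - 1) (by rw [en]; linarith) (by rw [en]; linarith)
  have t1 := PL_nonneg (s0 := s0) (L := L) (d := d) h n M
  have t2 := PL_nonneg (s0 := s0) (L := L) (d := d) h (n - 1) M
  have v1 : x / A x * PL A w s0 L d n M ≤ ε / 8 := by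
    calc _ ≤ 4 * (n / A n) * PL A w s0 L d n M := by gcongr
      _ = 4 * (n / A n * PL A w s0 L d n M) := by ring
      _ ≤ _ := by linarith
  have v2 : x / A x * PL A w s0 L d (n - 1) M ≤ ε / 8 := by
    calc _ ≤ 4 * ((n - 1 : ℕ) / A (n - 1 : ℕ)) * PL A w s0 L d (n - 1) M := by gcongr
      _ = 4 * ((n - 1 : ℕ) / A (n - 1 : ℕ) * PL A w s0 L d (n - 1) M) := by ring
      _ ≤ _ := by linarith
  have bb := base_bd h hx hη hη1 h1
  rw [← hMd] at bb
  calc _ ≤ 1 / A x ^ 2 * (2 * ∑ i ∈ Finset.Icc 1 M, Kf A i + 4 * x * A x * (PL A w s0 L d n M + PL A w s0 L d (n - 1) M)) := by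
        gcongr
    _ = 1 / A x ^ 2 * (2 * ∑ i ∈ Finset.Icc 1 M, Kf A i) + 4 * (x / A x * PL A w s0 L d n M) +
        4 * (x / A x * PL A w s0 L d (n - 1) M) := by field_simp; ring
    _ ≤ _ := by linarith

lemma star_nonneg (h : GoodA α A w c C a) (hB : Bl A w C s0 L d) {η : ℝ} (hη : 0 < η) (hη1 : η ≤ 1 / 8) :
    ∀ᶠ x in atTop, 0 ≤ 1 / (A x) ^ 2 * ∫ s in (1:ℝ)..(η * x), (A s) ^ 2 / s * rr (toM (stp A w s0 L d)) 1 (x - s) := by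
  filter_upwards [eventually_ge_atTop (16:ℝ), eventually_ge_atTop (1 / η)] with x hx hxη
  have h1 : 1 ≤ η * x := by rw [div_le_iff₀ hη] at hxη; linarith
  have hηx : η * x ≤ x / 8 := by nlinarith
  apply mul_nonneg (by positivity)
  apply intervalIntegral.integral_nonneg h1
  intro s hs
  exact (L_bd h hB hx hs.1 (hs.2.trans hηx)).1

lemma condStar_holds (h : GoodA α A w c C a) (hB : Bl A w C s0 L d) : CondStar (toM (stp A w s0 L d)) A 1 := by
  unfold CondStar
  have hev : ∀ᶠ η : ℝ in 𝓝[>] 0, 0 < η ∧ η ≤ 1 / 8 := by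
    have : Ioc (0:ℝ) (1/8) ∈ 𝓝[>] (0:ℝ) := Ioc_mem_nhdsGT (by norm_num)
    exact this
  have hlim : Tendsto (fun η : ℝ => 2 * C ^ 2 / c * (η ^ a) ^ 2) (𝓝[>] 0) (𝓝 0) := by
    have h1 : Tendsto (fun η : ℝ => η ^ a) (𝓝[>] 0) (𝓝 0) := by
      have := (Real.continuousAt_rpow_const 0 a (Or.inr h.a_pos.le)).tendsto
      rw [Real.zero_rpow h.a_pos.ne'] at this
      exact this.mono_left nhdsWithin_le_nhds
    simpa using (h1.pow 2).const_mul (2 * C ^ 2 / c)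
  refine tendsto_of_tendsto_of_tendsto_of_le_of_le' tendsto_const_nhds hlim ?_ ?_
  · filter_upwards [hev] with η hη
    exact le_limsup_of_frequently_le (star_nonneg h hB hη.1 hη.2).frequently ⟨_, eventually_map.2 (star_bd h hB hη.1 hη.2 one_pos)⟩
  · filter_upwards [hev] with η hη
    apply le_of_forall_pos_le_add
    intro ε hε
    apply limsup_le_of_le _ (star_bd h hB hη.1 hη.2 hε)
    exact isCoboundedUnder_le_of_eventually_le atTop (star_nonneg h hB hη.1 hη.2)

lemma two_bd (h : GoodA α A w c C a) (hB : Bl A w C s0 L d) {η : ℝ} (hη : 0 < η) (hη1 : η ≤ 1 / 8) :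
    ∃ B : ℝ, ∀ᶠ x in atTop, 1 / (A x) ^ 2 * ∫ s in (1:ℝ)..(η * x), (A s) ^ 2 / s *
      (rr (toM (stp A w s0 L d)) 1 (x - s) + rr (toM (stp A w s0 L d)) 1 (x + s)) ≤ B := by
  obtain ⟨n0, hn0⟩ := PL_small h hB one_pos
  obtain ⟨E, hE, hPR⟩ := PR_bdd h hB
  refine ⟨2 * (2 * C ^ 2 / c * (η ^ a) ^ 2) + 32 + 32 * E, ?_⟩
  filter_upwards [eventually_ge_atTop (16:ℝ), eventually_ge_atTop (1 / η), eventually_ge_atTop ((n0:ℝ) + 2)] with x hx hxη hxn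
  have h1 : 1 ≤ η * x := by rw [div_le_iff₀ hη] at hxη; linarith
  have hηx : η * x ≤ x / 8 := by nlinarith
  have px := h.pos (x := x) (by linarith)
  have key := int_le_sum (fun s => (A s) ^ 2 / s *
      (rr (toM (stp A w s0 L d)) 1 (x - s) + rr (toM (stp A w s0 L d)) 1 (x + s)))
      (fun i => HL A w s0 L d x i + HR A w s0 L d x i) (η * x) h1
    (fun s hs hs' => by
      have l1 := L_bd h hB hx hs (hs'.trans hηx)
      have l2 := R_bd h hB hx hs (hs'.trans hηx)
      simp only [mul_add]
      exact ⟨by linarith, by linarith⟩)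
    (fun i _ => add_nonneg (HL_nonneg h (by linarith) i) (HR_nonneg h (by linarith) i))
  have b1 := Nat.floor_le (show 0 ≤ x by linarith)
  have b2 := Nat.lt_floor_add_one x
  have hM := Nat.floor_le (show 0 ≤ η * x by linarith)
  set M := ⌊η * x⌋₊ with hMd
  rw [Finset.sum_add_distrib, sum_HL, sum_HR] at key
  set n := ⌊x⌋₊
  have hn16 : 16 ≤ n := Nat.le_floor (by exact_mod_cast hx)
  have hn2 : n0 + 2 ≤ n := Nat.le_floor (by push_cast; exact hxn)
  have en : ((n - 1 : ℕ):ℝ) = (n:ℝ) - 1 := by push_cast [Nat.cast_sub (show 1 ≤ n by omega)]; ring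
  have en2 : ((n + 1 : ℕ):ℝ) = (n:ℝ) + 1 := by push_cast; ring
  have hn16' : (16:ℝ) ≤ n := by exact_mod_cast hn16
  have hMn : 4 * M ≤ n - 1 := by
    have : (4:ℝ) * M ≤ ((n - 1 : ℕ):ℝ) := by rw [en]; linarith
    exact_mod_cast this
  have q1 := hn0 n M (by omega) (by omega)
  have q2 := hn0 (n - 1) M (by omega) hMn
  have q3 := hPR n M (by omega)
  have q4 := hPR (n + 1) M (by omega)
  have r1 := x_div_A h hx (n := n) (by linarith) (by linarith)
  have r2 := x_div_A h hx (n := n - 1) (by rw [en]; linarith) (by rw [en]; linarith)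
  have r3 := x_div_A h hx (n := n + 1) (by rw [en2]; linarith) (by rw [en2]; linarith)
  have gen : ∀ (m : ℕ) (P B : ℝ), 0 ≤ P → x / A x ≤ 4 * (m / A m) → m / A m * P ≤ B → x / A x * P ≤ 4 * B := by
    intro m P B hP h1 h2
    calc x / A x * P ≤ 4 * (m / A m) * P := by gcongr
      _ = 4 * (m / A m * P) := by ring
      _ ≤ _ := by linarith
  have v1 := gen n _ _ (PL_nonneg (s0 := s0) (L := L) (d := d) h n M) r1 q1
  have v2 := gen (n - 1) _ _ (PL_nonneg (s0 := s0) (L := L) (d := d) h (n - 1) M) r2 q2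
  have v3 := gen n _ _ (PR_nonneg (s0 := s0) (L := L) (d := d) h n M) r1 q3
  have v4 := gen (n + 1) _ _ (PR_nonneg (s0 := s0) (L := L) (d := d) h (n + 1) M) r3 q4
  have bb := base_bd h hx hη hη1 h1
  rw [← hMd] at bb
  calc _ ≤ 1 / A x ^ 2 * (2 * ∑ i ∈ Finset.Icc 1 M, Kf A i + 4 * x * A x * (PL A w s0 L d n M + PL A w s0 L d (n - 1) M) +
        (2 * ∑ i ∈ Finset.Icc 1 M, Kf A i + 4 * x * A x * (PR A w s0 L d n M + PR A w s0 L d (n + 1) M))) := by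
        gcongr
    _ = 2 * (1 / A x ^ 2 * (2 * ∑ i ∈ Finset.Icc 1 M, Kf A i)) + 4 * (x / A x * PL A w s0 L d n M) +
        4 * (x / A x * PL A w s0 L d (n - 1) M) + 4 * (x / A x * PR A w s0 L d n M) +
        4 * (x / A x * PR A w s0 L d (n + 1) M) := by field_simp; ring
    _ ≤ _ := by linarith

lemma rr_meas (f : Cv) (hf : Cv.mass f = 1) : Measurable (rr (toM f) 1) := by
  have : IsProbabilityMeasure (toM f) := ⟨by rw [toM_univ, hf]⟩
  have e : rr (toM f) 1 = fun x => x * (f ⌊x⌋).toReal / (toM f (Ioi x)).toReal := by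
    ext x; rw [rr, toM_Ioc]
  rw [e]
  have m1 : Measurable (fun x : ℝ => (f ⌊x⌋).toReal) :=
    (measurable_of_countable (fun z : ℤ => (f z).toReal)).comp Int.measurable_floor
  have m2 : Measurable (fun x : ℝ => (toM f (Ioi x)).toReal) := by
    apply Antitone.measurable
    intro x y hxy
    exact ENNReal.toReal_mono (measure_ne_top _ _) (measure_mono (Ioi_subset_Ioi hxy))
  exact (measurable_id.mul m1).div m2

lemma two_lo (h : GoodA α A w c C a) (hB : Bl A w C s0 L d) {η : ℝ} (hη : 0 < η) (hη1 : η ≤ 1 / 8) :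
    ∃ᶠ x in atTop, 1 / 4 ≤ 1 / (A x) ^ 2 * ∫ s in (1:ℝ)..(η * x), (A s) ^ 2 / s *
      (rr (toM (stp A w s0 L d)) 1 (x - s) + rr (toM (stp A w s0 L d)) 1 (x + s)) := by
  rw [frequently_atTop]
  intro x0
  obtain ⟨k, hk⟩ := exists_nat_gt (max (max x0 16) (1 / η))
  simp only [max_lt_iff] at hk
  obtain ⟨⟨hk1, hk2⟩, hk3⟩ := hk
  have hXk := hB.X_gt k
  have hXk' : (k:ℝ) < Xf d k := by exact_mod_cast hXk
  refine ⟨Xf d k, by linarith, ?_⟩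
  have hfl : ⌊((Xf d k:ℕ):ℝ)⌋₊ = Xf d k := Nat.floor_natCast _
  have hXe : ((Xf d k:ℕ):ℝ) = ((k:ℝ) + 1) * d k := by unfold Xf; push_cast; ring
  have hd := hB.dL k
  have hd1 : ((L k:ℕ):ℝ) + 1 ≤ d k := by exact_mod_cast (by omega : L k + 1 ≤ d k)
  have hdX : d k ≤ Xf d k := by unfold Xf; nlinarith
  set X := Xf d k with hXd
  have hx : (16:ℝ) ≤ X := by linarith
  have hLx : ((L k:ℕ):ℝ) + 1 ≤ η * X := by
    rw [hXe]
    rw [div_lt_iff₀ hη] at hk3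
    have : (d k:ℝ) ≤ d k * (η * (k + 1)) := le_mul_of_one_le_right (by positivity) (by linarith)
    linarith
  have h1 : 1 ≤ η * X := by
    have : (0:ℝ) ≤ L k := by positivity
    linarith
  have hηx : η * X ≤ X / 8 := by nlinarith
  have px := h.pos (x := (X:ℝ)) (by positivity)
  have key := sum_le_int (fun s => (A s) ^ 2 / s *
      (rr (toM (stp A w s0 L d)) 1 (X - s) + rr (toM (stp A w s0 L d)) 1 (X + s)))
      (fun i => HL A w s0 L d X i + HR A w s0 L d X i)
      (fun i => X * A X / 4 * (Kf A i * gg A w s0 L d ((X:ℤ) + i))) (η * X) (L k) h1 hLx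
    (fun s hs hs' => by
      have l1 := L_bd h hB hx hs (hs'.trans hηx)
      have l2 := R_bd h hB hx hs (hs'.trans hηx)
      simp only [mul_add]
      exact ⟨by linarith, by linarith⟩)
    (fun s hs hs' => by
      have l1 := L_bd h hB hx hs (by linarith)
      have a1 := Nat.floor_le (show 0 ≤ s by linarith)
      have a2 := Nat.lt_floor_add_one s
      have hi : 1 ≤ ⌊s⌋₊ := Nat.le_floor (by exact_mod_cast hs)
      have hi' : (1:ℝ) ≤ ⌊s⌋₊ := by exact_mod_cast hi
      have hfl2 : ⌊(X:ℝ) + s⌋₊ = X + ⌊s⌋₊ := by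
        rw [add_comm, Nat.floor_add_natCast (by linarith), add_comm]
      have l3 := rr_dn (x := (X:ℝ)) (y := X + s) h hB (by linarith) (by
        rw [hfl2]; push_cast; linarith)
      rw [hfl2] at l3
      push_cast at l3
      have hKd : Kf A (⌊s⌋₊:ℝ) ≤ 2 * Kf A s := Kf_dbl h (by linarith) a1 (by linarith)
      have hg := gg_nonneg (s0 := s0) (L := L) (d := d) h ((X:ℤ) + ⌊s⌋₊)
      have hKs := Kf_nonneg (A := A) (s := s) (by linarith)
      simp only [mul_add]
      calc (X:ℝ) * A X / 4 * (Kf A ⌊s⌋₊ * gg A w s0 L d ((X:ℤ) + ⌊s⌋₊))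
          ≤ (X:ℝ) * A X / 4 * (2 * Kf A s * gg A w s0 L d ((X:ℤ) + ⌊s⌋₊)) := by gcongr
        _ = Kf A s * (X * A X * gg A w s0 L d ((X:ℤ) + ⌊s⌋₊) / 2) := by ring
        _ ≤ Kf A s * rr (toM (stp A w s0 L d)) 1 (X + s) := by gcongr
        _ ≤ _ := le_add_of_nonneg_left l1.1)
    (by
      have mr := rr_meas (stp A w s0 L d) (mass_stp h hB)
      apply AEStronglyMeasurable.mul
      · apply ContinuousOn.aestronglyMeasurable _ measurableSet_Ioc
        apply ContinuousOn.div
        · apply ContinuousOn.pow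
          exact h.cont.mono fun s hs => (show (0:ℝ) ≤ s by linarith [hs.1])
        · exact continuousOn_id
        · intro s hs; exact (show (0:ℝ) < s by linarith [hs.1]).ne'
      · exact ((mr.comp (measurable_const.sub measurable_id)).add
          (mr.comp (measurable_const.add measurable_id))).aestronglyMeasurable)
  have e : ∑ i ∈ Finset.Icc 1 (L k), X * A X / 4 * (Kf A i * gg A w s0 L d ((X:ℤ) + i)) =
      X * A X / 4 * PR A w s0 L d X (L k) := by rw [PR, Finset.mul_sum]
  rw [e] at key
  have hp := PR_X h hB k (L k) le_rfl (by omega)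
  rw [← hXd] at hp
  have hX0 : (0:ℝ) < X := by linarith
  have : 1 / 4 * A X ^ 2 ≤ X * A X / 4 * PR A w s0 L d X (L k) := by
    calc 1 / 4 * A X ^ 2 = X * A X / 4 * (A X / X) := by field_simp
      _ ≤ _ := by gcongr
  rw [one_div_mul_eq_div, le_div_iff₀ (by positivity)]
  linarith

lemma two_fails (h : GoodA α A w c C a) (hB : Bl A w C s0 L d) :
    ¬ Tendsto (fun η : ℝ => limsup (fun x : ℝ => 1 / (A x) ^ 2 * ∫ s in (1:ℝ)..(η * x), (A s) ^ 2 / s *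
      (rr (toM (stp A w s0 L d)) 1 (x - s) + rr (toM (stp A w s0 L d)) 1 (x + s))) atTop) (𝓝[>] 0) (𝓝 0) := by
  intro ht
  have hev : ∀ᶠ η : ℝ in 𝓝[>] 0, 0 < η ∧ η ≤ 1 / 8 := by
    have : Ioc (0:ℝ) (1/8) ∈ 𝓝[>] (0:ℝ) := Ioc_mem_nhdsGT (by norm_num)
    exact this
  obtain ⟨η, h1, h2⟩ := ((ht.eventually (gt_mem_nhds (show (0:ℝ) < 1/4 by norm_num))).and hev).exists
  obtain ⟨B, hBd⟩ := two_bd h hB h2.1 h2.2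
  have := le_limsup_of_frequently_le (two_lo h hB h2.1 h2.2) ⟨B, eventually_map.2 hBd⟩
  exact absurd (lt_of_le_of_lt this h1) (lt_irrefl _)

end

section
variable {α : ℝ} {A : ℝ → ℝ} {w : ℕ → ℝ} {c C a : ℝ} {s0 : ℕ} {L d : ℕ → ℕ}

lemma S1 (h : GoodA α A w c C a) (hB : Bl A w C s0 L d) (k j : ℕ) (hj : j < k + 1) (N : ℕ)
    (hN : k7 C * A (L k) + 2 ≤ N) :
    ENNReal.ofReal (k7 C ^ 3 * c / 192 * (A (Xf d k) / Xf d k)) ≤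
      ∑ n ∈ Finset.range N, (stp A w s0 L d ^ n) ((Xf d k + j * d k : ℕ) : ℤ) := by
  have hXp : (0:ℝ) < Xf d k := by exact_mod_cast hB.X_pos k
  have hAX := h.pos hXp.le
  have hm := mf_nonneg h s0 (L k)
  have hk7 := k7_pos h
  have hs0 := hB.s0_pos
  have hLd := hB.dL k
  have hjd : j * d k + d k ≤ Xf d k := by unfold Xf; nlinarith
  set x : ℕ := Xf d k + j * d k with hx
  set W : ℝ := A (Xf d k) / Xf d k with hW
  have hWp : 0 < W := by positivity
  set B : Cv := ⟨fun z => ENNReal.ofReal (W * wbf A w s0 (L k) (z - (x:ℤ)))⟩ with hBd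
  have hBa : ∀ z, B z = ENNReal.ofReal (W * wbf A w s0 (L k) (z - (x:ℤ))) := fun z => rfl
  have hB0 : ∀ z : ℤ, z ≤ x → B z = 0 := by
    intro z hz
    rw [hBa, wbf_zero (by omega)]; simp
  have hle : B ≤ stp A w s0 L d := by
    intro z
    by_cases hz : z ≤ x
    · rw [hB0 z hz]; exact zero_le
    by_cases hz2 : z ≤ x + L k
    · obtain ⟨n, rfl⟩ := Int.eq_ofNat_of_zero_le (show 0 ≤ z by omega)
      have hn : 1 ≤ n := by omega
      rw [stp_pos_apply h hn, hBa]
      apply ENNReal.ofReal_le_ofReal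
      have h1 := f0_nonneg h hn
      have h2 : W * wbf A w s0 (L k) ((n:ℤ) - (x:ℤ)) ≤ gg A w s0 L d n := by
        rw [gg_eq_Gk hB (k := k) (by omega) (by omega), Gk]
        apply mul_le_mul_of_nonneg_left _ hWp.le
        exact Finset.single_le_sum (f := fun j => wbf A w s0 (L k) ((n:ℤ) - ((Xf d k + j * d k : ℕ):ℤ)))
          (fun i _ => wbf_nonneg h _ _ _) (Finset.mem_range.2 hj)
      linarith
    · rw [hBa, wbf_zero (by omega)]; simp
  obtain ⟨G, hG⟩ := Cv.exists_sub hle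
  have hmass : Cv.mass B = ENNReal.ofReal (W * mf A w s0 (L k)) := by
    rw [Cv.mass_def, ENNReal.ofReal_mul hWp.le, ← sum_wbf' h, ← ENNReal.tsum_mul_left]
    simp_rw [hBa, ENNReal.ofReal_mul hWp.le]
    exact (Equiv.subRight ((x : ℕ) : ℤ)).tsum_eq
      (fun z => ENNReal.ofReal W * ENNReal.ofReal (wbf A w s0 (L k) z))
  have key := C7 h (stp_Stp h hB) G B hG (fun z hz => hB0 z (by omega)) (Finset.Icc s0 (L k))
    (fun s => W * wbf A w s0 (L k) s) x (by
      intro s hs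
      refine ⟨mul_nonneg hWp.le (wbf_nonneg h _ _ _), ?_⟩
      rw [hBa]; congr 3; ring) (by
      intro s hs
      rw [Finset.mem_Icc] at hs
      refine ⟨by omega, ?_, hB.s0_A s hs.1⟩
      rw [hmass]
      apply ENNReal.ofReal_le_ofReal
      have hAs := h.pos (x := (s:ℝ)) (by positivity)
      rw [le_div_iff₀ hAs]
      have hmb := hB.massb k
      have hA2 : A s ≤ A (2 * Xf d k) := h.mono (by positivity) (by
        have : s ≤ 2 * Xf d k := by omega
        exact_mod_cast this)
      have hp := h.pos (x := (2 * Xf d k : ℝ)) (by positivity)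
      calc W * mf A w s0 (L k) * A s ≤ W * mf A w s0 (L k) * A (2 * Xf d k) := by gcongr
        _ = 1 * (W * mf A w s0 (L k) * A (2 * Xf d k)) := by ring
        _ ≤ ((k:ℝ) + 1) * (W * mf A w s0 (L k) * A (2 * Xf d k)) := by
            gcongr; linarith [(Nat.cast_nonneg k : (0:ℝ) ≤ k)]
        _ = ((k:ℝ) + 1) * W * mf A w s0 (L k) * A (2 * Xf d k) := by ring
        _ ≤ _ := hmb
        _ ≤ 1 := pow_le_one₀ (by norm_num) (by norm_num)) N (by
      intro s hs
      rw [Finset.mem_Icc] at hs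
      have : A s ≤ A (L k) := h.mono (by positivity) (by exact_mod_cast hs.2)
      have : k7 C * A s ≤ k7 C * A (L k) := by gcongr
      linarith)
  have e : ∑ s ∈ Finset.Icc s0 (L k), A s ^ 2 / s * (W * wbf A w s0 (L k) s) = W := by
    calc _ = W * ∑ s ∈ Finset.Icc s0 (L k), Kf A s * wbf A w s0 (L k) s := by
          rw [Finset.mul_sum]; apply Finset.sum_congr rfl; intro s _; rw [Kf]; ring
      _ = W := by rw [sum_K_wbf hB k, mul_one]
  rw [e] at key
  exact key

lemma sum_windows (g : ℕ → ENNReal) (J e : ℕ) :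
    ∑ j ∈ Finset.range J, ∑ i ∈ Finset.range e, g (j * e + i) = ∑ i ∈ Finset.range (J * e), g i := by
  induction J with
  | zero => simp
  | succ n ih => rw [Finset.sum_range_succ, ih, Nat.succ_mul, Finset.sum_range_add]

lemma S2 (h : GoodA α A w c C a) (hB : Bl A w C s0 L d) (k : ℕ) (N : ℕ) :
    ∃ j < k + 1, ((k + 1 : ℕ) : ENNReal) * ∑ i ∈ Finset.range (d k),
      ∑ n ∈ Finset.range N, (stp A w s0 L d ^ n) ((Xf d k + j * d k + i : ℕ) : ℤ) ≤
      ENNReal.ofReal (18 * C * (N ^ 2 / A (Xf d k))) := by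
  set f := stp A w s0 L d with hf
  have hXp : (0:ℝ) < Xf d k := by exact_mod_cast hB.X_pos k
  have hAX := h.pos hXp.le
  have hC := h.C_ge
  set Q : ℕ → ENNReal := fun j => ∑ i ∈ Finset.range (d k),
      ∑ n ∈ Finset.range N, (f ^ n) ((Xf d k + j * d k + i : ℕ) : ℤ) with hQ
  obtain ⟨j, hj, hmin⟩ := Finset.exists_min_image (Finset.range (k + 1)) Q ⟨0, by simp⟩
  refine ⟨j, Finset.mem_range.1 hj, ?_⟩
  have h1 : ((k + 1 : ℕ) : ENNReal) * Q j ≤ ∑ j ∈ Finset.range (k + 1), Q j := by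
    have := Finset.card_nsmul_le_sum (Finset.range (k + 1)) Q (Q j) hmin
    simpa using this
  refine h1.trans ?_
  have h2 : ∑ j ∈ Finset.range (k + 1), Q j =
      ∑ n ∈ Finset.range N, ∑ i ∈ Finset.range (Xf d k), (f ^ n) ((Xf d k + i : ℕ) : ℤ) := by
    have := sum_windows (fun i => ∑ n ∈ Finset.range N, (f ^ n) ((Xf d k + i : ℕ) : ℤ)) (k + 1) (d k)
    rw [Finset.sum_comm (s := Finset.range N)]
    rw [show Xf d k = (k + 1) * d k from rfl] at *
    rw [← this]
    simp only [hQ, add_assoc]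
  rw [h2]
  have h3 : ∀ n ∈ Finset.range N, ∑ i ∈ Finset.range (Xf d k), (f ^ n) ((Xf d k + i : ℕ) : ℤ) ≤
      ENNReal.ofReal (18 * C * (N / A (Xf d k))) := by
    intro n hn
    have hn' : (n:ℝ) ≤ N := by exact_mod_cast (Finset.mem_range.1 hn).le
    calc _ = ∑ i ∈ Finset.range (Xf d k), Cv.far (Xf d k) (f ^ n) ((Xf d k + i : ℕ) : ℤ) := by
          apply Finset.sum_congr rfl
          intro i _
          show _ = if _ then _ else _
          rw [if_pos (by omega)]
      _ ≤ ∑' i : ℕ, Cv.far (Xf d k) (f ^ n) ((Xf d k + i : ℕ) : ℤ) := ENNReal.sum_le_tsum _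
      _ ≤ ∑' z : ℤ, Cv.far (Xf d k) (f ^ n) z :=
          ENNReal.tsum_comp_le_tsum_of_injective (f := fun i : ℕ => ((Xf d k + i : ℕ) : ℤ))
            (by intro i i' hi; simpa using hi) _
      _ = Cv.mass (Cv.far (Xf d k) (f ^ n)) := rfl
      _ ≤ _ := C5 h (stp_Stp h hB) n _ (hB.X_pos k)
      _ ≤ _ := ENNReal.ofReal_le_ofReal (by gcongr)
  refine (Finset.sum_le_sum h3).trans (le_of_eq ?_)
  rw [Finset.sum_const, Finset.card_range, nsmul_eq_mul, ← ENNReal.ofReal_natCast,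
    ← ENNReal.ofReal_mul (by positivity)]
  congr 1; ring

lemma Xf_tendsto (hB : Bl A w C s0 L d) : Tendsto (fun k => (Xf d k : ℝ)) atTop atTop := by
  apply tendsto_natCast_atTop_atTop.comp
  exact tendsto_atTop_mono (fun k => (hB.X_gt k).le) tendsto_id

lemma S3 (h : GoodA α A w c C a) (hB : Bl A w C s0 L d) {ε τ : ℝ} (hε : 0 < ε) (hτ : 0 < τ) :
    ∀ᶠ k : ℕ in atTop, ∀ x : ℤ, ∀ e : ℕ, e ≤ d k →
      (stp A w s0 L d ^ ⌈ε * A (Xf d k)⌉₊ * Cv.ren (stp A w s0 L d)) (x + e) ≤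
      (stp A w s0 L d ^ ⌈ε * A (Xf d k)⌉₊ * Cv.ren (stp A w s0 L d)) x +
        ENNReal.ofReal (τ * (A (Xf d k) / Xf d k)) := by
  set f := stp A w s0 L d with hfd
  have hf := stp_Stp h hB
  rw [← hfd] at hf
  have hc := h.c_pos
  have hC := h.C_ge
  have ha := h.a_pos
  have hk3 := k3_pos c
  obtain ⟨D, X0, hD, hD'⟩ := C4 h hf (ε / 2) (by positivity)
  -- choose ρ
  obtain ⟨ρ, hρ, hρ1, hρe⟩ : ∃ ρ : ℝ, 0 < ρ ∧ ρ ≤ 1 / 2 ∧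
      Real.exp (-(c / 4 * (ε / 4 / (C * (2 * ρ) ^ a)))) * D ≤ τ / 2 := by
    have t1 : Tendsto (fun ρ : ℝ => (2 * ρ) ^ a) (𝓝[>] 0) (𝓝[>] 0) := by
      rw [tendsto_nhdsWithin_iff]
      constructor
      · have h1 := (Real.continuousAt_rpow_const 0 a (Or.inr ha.le)).tendsto
        rw [Real.zero_rpow ha.ne'] at h1
        have h2 : Tendsto (fun ρ : ℝ => 2 * ρ) (𝓝[>] 0) (𝓝 0) := by
          have : Tendsto (fun ρ : ℝ => 2 * ρ) (𝓝 0) (𝓝 (2 * 0)) := tendsto_id.const_mul 2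
          rw [mul_zero] at this
          exact this.mono_left nhdsWithin_le_nhds
        exact h1.comp h2
      · filter_upwards [self_mem_nhdsWithin] with ρ hρ
        have : (0:ℝ) < ρ := hρ
        exact Real.rpow_pos_of_pos (by linarith) _
    have t2 : Tendsto (fun ρ : ℝ => c / 4 * (ε / 4 / C) * ((2 * ρ) ^ a)⁻¹) (𝓝[>] 0) atTop :=
      (tendsto_inv_nhdsGT_zero.comp t1).const_mul_atTop (by positivity)
    have t3 := (Real.tendsto_exp_neg_atTop_nhds_zero.comp t2).mul_const D
    rw [zero_mul] at t3
    have hev : ∀ᶠ ρ : ℝ in 𝓝[>] 0, 0 < ρ ∧ ρ ≤ 1 / 2 := by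
      have : Ioc (0:ℝ) (1/2) ∈ 𝓝[>] (0:ℝ) := Ioc_mem_nhdsGT (by norm_num)
      exact this
    obtain ⟨ρ, h1, h2, h3⟩ := ((t3.eventually (eventually_le_nhds (half_pos hτ))).and hev).exists
    refine ⟨ρ, h2, h3, le_trans (le_of_eq ?_) h1⟩
    simp only [Function.comp]
    congr 3
    field_simp
  have hXt := Xf_tendsto hB
  have tJ : Tendsto (fun k : ℕ => k3 c * (C * (1 / ((k:ℝ) + 1)) ^ a) / ρ) atTop (𝓝 0) := by
    have h1 := (Real.continuousAt_rpow_const 0 a (Or.inr ha.le)).tendsto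
    rw [Real.zero_rpow ha.ne'] at h1
    have := (((h1.comp (tendsto_one_div_add_atTop_nhds_zero_nat (𝕜 := ℝ))).const_mul C).const_mul (k3 c)).div_const ρ
    simpa using this
  filter_upwards [hXt.eventually_ge_atTop X0, hXt.eventually_ge_atTop (1 / ρ), 
    (h.atop.comp hXt).eventually_ge_atTop (4 / ε), tJ.eventually (eventually_le_nhds (half_pos hτ))]
    with k hk0 hk1 hk2 hk3'
  intro x e he
  simp only [Function.comp] at hk2
  have hXp : (0:ℝ) < Xf d k := by exact_mod_cast hB.X_pos k
  have hX1 : (1:ℝ) ≤ Xf d k := by exact_mod_cast hB.X_pos k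
  have hdp := hB.d_pos k
  have hXJ : (Xf d k : ℝ) = (k + 1) * d k := by simp [Xf]
  set X : ℝ := ((Xf d k : ℕ) : ℝ) with hX
  have hAX := h.pos hXp.le
  set W : ℝ := A X / X with hW
  have hWp : 0 < W := by positivity
  set N := ⌈ε * A X⌉₊ with hN
  have hNlo : ε * A X ≤ N := Nat.le_ceil _
  have h4 : 4 ≤ ε * A X := by rw [div_le_iff₀ hε] at hk2; linarith
  set n := N / 2 with hn
  set m := N - N / 2 with hm
  have hnm : N = n + m := by omega
  have hmlo : ε / 2 * A X ≤ m := by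
    have : N ≤ 2 * m := by omega
    have : (N:ℝ) ≤ 2 * m := by exact_mod_cast this
    linarith
  have hnlo : ε / 4 * A X ≤ n := by
    have : N ≤ 2 * n + 1 := by omega
    have : (N:ℝ) ≤ 2 * n + 1 := by exact_mod_cast this
    linarith
  set φ := f ^ m * Cv.ren f with hφ
  have hv : f ^ N * Cv.ren f = f ^ n * φ := by rw [hφ, hnm]; ring
  rw [hv]
  have hρX : 1 ≤ ρ * X := by rw [div_le_iff₀ hρ] at hk1; linarith
  set q := ⌈ρ * X⌉₊ with hq
  have hqlo : ρ * X ≤ q := Nat.le_ceil _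
  have hqhi : (q:ℝ) ≤ 2 * ρ * X := by
    have := Nat.ceil_lt_add_one (show 0 ≤ ρ * X by positivity)
    linarith
  have hq1' : (1:ℝ) ≤ q := hρX.trans hqlo
  have hq1 : 1 ≤ q := by exact_mod_cast hq1'
  have hqX : (q:ℝ) ≤ X := by nlinarith
  have hAq := h.pos (x := (q:ℝ)) (by positivity)
  refine (L2 h hf q hq1 n φ x e).trans ?_
  gcongr
  have hAq2 : A q ≤ C * (2 * ρ) ^ a * A X := by
    refine (h.small q X hq1' hqX).trans ?_
    gcongr
    rw [div_le_iff₀ hXp]; exact hqhi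
  have hpa : 0 < (2 * ρ) ^ a := Real.rpow_pos_of_pos (by linarith) _
  have hratio : ε / 4 / (C * (2 * ρ) ^ a) ≤ n / A q := by
    rw [div_le_div_iff₀ (by positivity) hAq]
    calc ε / 4 * A q ≤ ε / 4 * (C * (2 * ρ) ^ a * A X) := by gcongr
      _ = (ε / 4 * A X) * (C * (2 * ρ) ^ a) := by ring
      _ ≤ _ := by gcongr
  have p1 : ENNReal.ofReal (Real.exp (-(c / 4 * (n / A q)))) * φ.sup ≤ ENNReal.ofReal (τ / 2 * W) := by
    calc _ ≤ ENNReal.ofReal (Real.exp (-(c / 4 * (ε / 4 / (C * (2 * ρ) ^ a))))) * ENNReal.ofReal (D * W) := by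
          gcongr
          exact hD' X hk0 m hmlo
      _ = ENNReal.ofReal (Real.exp (-(c / 4 * (ε / 4 / (C * (2 * ρ) ^ a)))) * D * W) := by
          rw [← ENNReal.ofReal_mul (Real.exp_pos _).le, mul_assoc]
      _ ≤ _ := ENNReal.ofReal_le_ofReal (by gcongr)
  have p2 : (Cv.ind e * φ).sup / q ≤ ENNReal.ofReal (τ / 2 * W) := by
    have i1 : (Cv.ind e * φ).sup ≤ ENNReal.ofReal (k3 c * A (d k)) := by
      refine le_trans (Cv.sup_le fun z => ?_) (C3' h hf (d k) hdp m)
      refine le_trans ?_ (Cv.le_sup _ z)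
      rw [Cv.ind_mul_apply, Cv.ind_mul_apply]
      exact Finset.sum_le_sum_of_subset (Finset.range_mono he)
    have hd1 : (1:ℝ) ≤ d k := by exact_mod_cast hdp
    have hdX : (d k : ℝ) ≤ X := by rw [hXJ]; nlinarith [(Nat.cast_nonneg k : (0:ℝ) ≤ k)]
    have i2 : A (d k) ≤ C * (1 / ((k:ℝ) + 1)) ^ a * A X := by
      have := h.small (d k) X hd1 hdX
      rwa [show (d k : ℝ) / X = 1 / ((k:ℝ) + 1) by rw [hXJ]; field_simp] at this
    have hAd := h.pos (x := (d k:ℝ)) (by positivity)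
    calc (Cv.ind e * φ).sup / q ≤ ENNReal.ofReal (k3 c * A (d k)) / q := by gcongr
      _ = ENNReal.ofReal (k3 c * A (d k) / q) := by
          rw [ENNReal.ofReal_div_of_pos (by positivity), ENNReal.ofReal_natCast]
      _ ≤ _ := ENNReal.ofReal_le_ofReal (by
          calc k3 c * A (d k) / q ≤ k3 c * (C * (1 / ((k:ℝ) + 1)) ^ a * A X) / (ρ * X) := by gcongr
            _ = k3 c * (C * (1 / ((k:ℝ) + 1)) ^ a) / ρ * W := by rw [hW]; field_simp
            _ ≤ _ := by gcongr)
  refine (add_le_add p1 p2).trans ?_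
  rw [← ENNReal.ofReal_add (by positivity) (by positivity)]
  exact ENNReal.ofReal_le_ofReal (by linarith)

lemma ren_fin (h : GoodA α A w c C a) (hB : Bl A w C s0 L d) (z : ℤ) :
    Cv.ren (stp A w s0 L d) z ≠ ⊤ := by
  have h1 := C3' h (stp_Stp h hB) 1 le_rfl 0
  have h2 := (Cv.le_sup _ z).trans h1
  rw [Cv.ind_mul_apply] at h2
  simp at h2
  exact ne_top_of_le_ne_top ENNReal.ofReal_ne_top h2

end

section
variable {α : ℝ} {A : ℝ → ℝ} {w : ℕ → ℝ} {c C a : ℝ} {s0 : ℕ} {L d : ℕ → ℕ}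

lemma srt_real (h : GoodA α A w c C a) (hB : Bl A w C s0 L d) {c' δ : ℝ} (hc' : 0 < c') (hδ : 0 < δ)
    (H : (fun x : ℝ => (∑' n : ℕ, convPow (toM (stp A w s0 L d)) n (Ioc (x - 1) x)).toReal)
      ~[atTop] fun x : ℝ => c' * 1 * (A x / x)) :
    ∀ᶠ k : ℕ in atTop, ∀ x : ℕ, Xf d k ≤ x → ∀ e : ℕ, e < d k → x + e ≤ 2 * Xf d k →
      (Cv.ren (stp A w s0 L d) (x : ℤ)).toReal ≤ (Cv.ren (stp A w s0 L d) ((x + e : ℕ) : ℤ)).toReal +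
        (2 * c' / ((k:ℝ) + 1) + 4 * δ * c') * (A (Xf d k) / Xf d k) := by
  have H' := H.isLittleO.def hδ
  have hu : ∀ᶠ x : ℝ in atTop, |(Cv.ren (stp A w s0 L d) ⌊x⌋).toReal - c' * (A x / x)| ≤ δ * (c' * (A x / x)) := by
    filter_upwards [H', eventually_gt_atTop 0] with x hx hx0
    have hA := h.pos hx0.le
    simp only [Pi.sub_apply, Real.norm_eq_abs, ren_toM _ (mass_stp h hB), mul_one] at hx
    rwa [abs_of_pos (show 0 < c' * (A x / x) by positivity)] at hx
  obtain ⟨x0, hx0⟩ := eventually_atTop.1 hu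
  filter_upwards [(Xf_tendsto hB).eventually_ge_atTop x0] with k hk
  intro x hx e he hxe
  have hXp : (0:ℝ) < Xf d k := by exact_mod_cast hB.X_pos k
  have hXJ : (Xf d k : ℝ) = (k + 1) * d k := by simp [Xf]
  have hdp : (0:ℝ) < d k := by exact_mod_cast hB.d_pos k
  have hx' : (Xf d k : ℝ) ≤ x := by exact_mod_cast hx
  have hxe' : ((x + e : ℕ) : ℝ) ≤ 2 * Xf d k := by exact_mod_cast hxe
  have he' : (e:ℝ) ≤ d k := by exact_mod_cast he.le
  have h1 := hx0 (x:ℝ) (hk.trans hx')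
  have h2 := hx0 ((x + e : ℕ):ℝ) (hk.trans (hx'.trans (by push_cast; linarith [(Nat.cast_nonneg e : (0:ℝ) ≤ e)])))
  rw [Int.floor_natCast] at h1 h2
  set X : ℝ := ((Xf d k : ℕ) : ℝ) with hX
  set y : ℝ := ((x + e : ℕ) : ℝ) with hy
  have hye : y = x + e := by rw [hy]; push_cast; ring
  have hxy : (x:ℝ) ≤ y := by rw [hye]; linarith [(Nat.cast_nonneg e : (0:ℝ) ≤ e)]
  have hx0' : (0:ℝ) < x := by linarith
  have hy0 : (0:ℝ) < y := by linarith
  have hAX := h.pos hXp.le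
  have hAx := h.pos hx0'.le
  have hAy := h.pos hy0.le
  have htwo := h.two hXp
  have b1 : A x ≤ 2 * A X := (h.mono hx0'.le (by linarith)).trans htwo
  have b2 : A y ≤ 2 * A X := (h.mono hy0.le hxe').trans htwo
  have bxy : A x ≤ A y := h.mono hx0'.le hxy
  have g1 : A x / x ≤ 2 * (A X / X) := by
    calc A x / x ≤ 2 * A X / X := by gcongr
      _ = _ := by ring
  have g2 : A y / y ≤ 2 * (A X / X) := by
    calc A y / y ≤ 2 * A X / X := by gcongr; linarith
      _ = _ := by ring
  have g3 : A x / x ≤ A y / y + 2 / ((k:ℝ) + 1) * (A X / X) := by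
    have i1 : A x / y ≤ A y / y := by gcongr
    have i2 : A x / x = A x / y + A x * e / (x * y) := by
      rw [hye] at hy0 ⊢; field_simp
    have i3 : A x * e / (x * y) ≤ 2 * A X * d k / (X * X) := by
      gcongr; linarith
    have i4 : 2 * A X * d k / (X * X) = 2 / ((k:ℝ) + 1) * (A X / X) := by
      nth_rewrite 2 [hXJ]; field_simp
    linarith
  have q1 := (abs_le.1 h1).2
  have q2 := (abs_le.1 h2).1
  have r1 : δ * (c' * (A x / x)) ≤ δ * (c' * (2 * (A X / X))) := by gcongr
  have r2 : δ * (c' * (A y / y)) ≤ δ * (c' * (2 * (A X / X))) := by gcongr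
  have r3 : c' * (A x / x) ≤ c' * (A y / y + 2 / ((k:ℝ) + 1) * (A X / X)) := by gcongr
  have r4 : (2 * c' / ((k:ℝ) + 1) + 4 * δ * c') * (A X / X) =
    c' * (2 / ((k:ℝ) + 1) * (A X / X)) + 2 * (δ * (c' * (2 * (A X / X)))) := by ring
  rw [r4]
  linarith

lemma srt_fails (h : GoodA α A w c C a) (hB : Bl A w C s0 L d) {c' : ℝ} (hc' : 0 < c') :
    ¬ ((fun x : ℝ => (∑' n : ℕ, convPow (toM (stp A w s0 L d)) n (Ioc (x - 1) x)).toReal)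
      ~[atTop] fun x : ℝ => c' * 1 * (A x / x)) := by
  intro H
  have hc := h.c_pos
  have hC := h.C_ge
  have hk7 := k7_pos h
  set c6 : ℝ := k7 C ^ 3 * c / 192 with hc6
  have hc6p : 0 < c6 := by positivity
  set ε : ℝ := Real.sqrt (c6 / (288 * C)) with hεd
  have hε : 0 < ε := Real.sqrt_pos.2 (by positivity)
  have hε2 : 72 * C * ε ^ 2 = c6 / 4 := by
    rw [hεd, Real.sq_sqrt (by positivity)]; field_simp; norm_num
  have hXt := Xf_tendsto hB
  have E1 := S3 h hB hε (show 0 < c6 / 4 by positivity)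
  have E2 := srt_real h hB hc' (δ := c6 / (32 * c')) (by positivity) H
  have t1 : Tendsto (fun k : ℕ => 2 * c' * (1 / ((k:ℝ) + 1))) atTop (𝓝 0) := by
    simpa using (tendsto_one_div_add_atTop_nhds_zero_nat (𝕜 := ℝ)).const_mul (2 * c')
  have t2 : Tendsto (fun k : ℕ => k7 C * (1 / ((k:ℝ) + 1))) atTop (𝓝 0) := by
    simpa using (tendsto_one_div_add_atTop_nhds_zero_nat (𝕜 := ℝ)).const_mul (k7 C)
  obtain ⟨k, e1, e2, e3, e4, e5⟩ := (E1.and (E2.and ((t1.eventually (eventually_le_nhds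
    (show 0 < c6 / 8 by positivity))).and ((t2.eventually (eventually_le_nhds (half_pos hε))).and
    ((h.atop.comp hXt).eventually_ge_atTop (4 / ε)))))).exists
  simp only [Function.comp] at e5
  have hXp : (0:ℝ) < Xf d k := by exact_mod_cast hB.X_pos k
  have hXJ : (Xf d k : ℝ) = (k + 1) * d k := by simp [Xf]
  have hdp : (0:ℝ) < d k := by exact_mod_cast hB.d_pos k
  have hAL := hB.AL k
  set f := stp A w s0 L d with hf
  set X : ℝ := ((Xf d k : ℕ) : ℝ) with hX
  have hAX := h.pos hXp.le
  set W : ℝ := A X / X with hW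
  have hWp : 0 < W := by positivity
  have h4 : 4 ≤ ε * A X := by rw [div_le_iff₀ hε] at e5; linarith
  set N := ⌈ε * A X⌉₊ with hN
  have hNlo : ε * A X ≤ N := Nat.le_ceil _
  have hNhi : (N:ℝ) ≤ 2 * (ε * A X) := by
    have := Nat.ceil_lt_add_one (show 0 ≤ ε * A X by positivity)
    linarith
  have hNok : k7 C * A (L k) + 2 ≤ N := by
    have i1 : A (L k) ≤ 1 / ((k:ℝ) + 1) * A X := by
      rw [one_div_mul_eq_div, le_div_iff₀ (by positivity)]; linarith
    have : k7 C * A (L k) ≤ ε / 2 * A X := by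
      calc k7 C * A (L k) ≤ k7 C * (1 / ((k:ℝ) + 1) * A X) := by gcongr
        _ = k7 C * (1 / ((k:ℝ) + 1)) * A X := by ring
        _ ≤ _ := by gcongr
    linarith
  obtain ⟨j, hj, hjs⟩ := S2 h hB k N
  rw [← hf, ← hX] at hjs
  have s1 := S1 h hB k j hj N hNok
  rw [← hf, ← hX, ← hW, ← hc6] at s1
  have hjd : j * d k + d k ≤ Xf d k := by unfold Xf; nlinarith
  set x : ℕ := Xf d k + j * d k with hx
  have hfin : ∀ z, Cv.ren f z ≠ ⊤ := fun z => ren_fin h hB z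
  set P : ℤ → ENNReal := fun z => ∑ n ∈ Finset.range N, (f ^ n) z with hP
  set V := f ^ N * Cv.ren f with hV
  have hsp : ∀ z, Cv.ren f z = P z + V z := fun z => Cv.ren_split f N z
  have hPf : ∀ z, P z ≠ ⊤ := fun z => ne_top_of_le_ne_top (hfin z) (by rw [hsp z]; exact le_self_add)
  have hVf : ∀ z, V z ≠ ⊤ := fun z => ne_top_of_le_ne_top (hfin z) (by rw [hsp z]; exact le_add_self)
  have hspR : ∀ z, (Cv.ren f z).toReal = (P z).toReal + (V z).toReal := fun z => by
    rw [hsp z, ENNReal.toReal_add (hPf z) (hVf z)]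
  have s1R : c6 * W ≤ (P (x:ℤ)).toReal := (ENNReal.ofReal_le_iff_le_toReal (hPf _)).1 s1
  have low : ∀ i ∈ Finset.range (d k), c6 / 2 * W ≤ (P ((x + i : ℕ) : ℤ)).toReal := by
    intro i hi
    rw [Finset.mem_range] at hi
    have u := e2 x (by omega) i hi (by omega)
    have v := ENNReal.toReal_mono (by finiteness [hVf x]) (e1 x i hi.le)
    rw [ENNReal.toReal_add (hVf _) ENNReal.ofReal_ne_top, ENNReal.toReal_ofReal (by positivity)] at v
    rw [hspR, hspR] at u
    have c1 : 2 * c' / ((k:ℝ) + 1) + 4 * (c6 / (32 * c')) * c' ≤ c6 / 4 := by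
      have : 4 * (c6 / (32 * c')) * c' = c6 / 8 := by field_simp; norm_num
      rw [this, div_eq_mul_one_div]; linarith
    have c2 : (2 * c' / ((k:ℝ) + 1) + 4 * (c6 / (32 * c')) * c') * W ≤ c6 / 4 * W := by gcongr
    push_cast at u ⊢
    nlinarith
  have hsum : ((k:ℝ) + 1) * ∑ i ∈ Finset.range (d k), (P ((x + i : ℕ) : ℤ)).toReal ≤ 18 * C * (N ^ 2 / A X) := by
    have := ENNReal.toReal_mono ENNReal.ofReal_ne_top hjs
    rw [ENNReal.toReal_ofReal (by positivity), ENNReal.toReal_mul, ENNReal.toReal_natCast,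
      ENNReal.toReal_sum (fun i _ => hPf _)] at this
    push_cast at this ⊢
    exact this
  have lowS : (d k) * (c6 / 2 * W) ≤ ∑ i ∈ Finset.range (d k), (P ((x + i : ℕ) : ℤ)).toReal := by
    have := Finset.card_nsmul_le_sum _ _ _ low
    simpa using this
  have f1 : X * (c6 / 2 * W) ≤ 18 * C * (N ^ 2 / A X) := by
    refine le_trans ?_ hsum
    rw [hXJ, mul_assoc]; gcongr
  have f2 : 18 * C * (N ^ 2 / A X) ≤ c6 / 4 * A X := by
    calc 18 * C * (N ^ 2 / A X) ≤ 18 * C * ((2 * (ε * A X)) ^ 2 / A X) := by gcongr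
      _ = 72 * C * ε ^ 2 * A X := by field_simp; ring
      _ = _ := by rw [hε2]
  have f3 : X * (c6 / 2 * W) = c6 / 2 * A X := by rw [hW]; field_simp
  have : 0 < c6 * A X := by positivity
  linarith

end

/-- **Theorem 1.5, counterexample part**: for every `α ∈ (0, 1/2]` there are `A`
regularly varying of index `α` and a probability `F` on `ℝ` satisfying (T2) with
`p = q = 1`, such that condition (★) holds but the two-sided condition fails;
in particular the SRT fails for `F`. -/
theorem condStar_not_sufficient_two_sided
    (α : ℝ) (hα1 : 0 < α) (hα2 : α ≤ 1 / 2) :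
    ∃ (A : ℝ → ℝ) (F : Measure ℝ),
      (∀ x : ℝ, 0 ≤ x → 0 < A x) ∧
      ContinuousOn A (Set.Ici 0) ∧
      StrictMonoOn A (Set.Ici 0) ∧
      (∀ l : ℝ, 0 < l →
        Tendsto (fun x : ℝ => A (l * x) / A x) atTop (nhds (l ^ α))) ∧
      IsProbabilityMeasure F ∧
      Tendsto (fun x : ℝ => A x * (F (Set.Ioi x)).toReal) atTop (nhds 1) ∧
      Tendsto (fun x : ℝ => A x * (F (Set.Iic (-x))).toReal) atTop (nhds 1) ∧
      ∀ h : ℝ, 0 < h →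
        ((∃ t, IsArithSpan F t) → IsGreatest {t | IsArithSpan F t} h) →
        CondStar F A h ∧
        ¬ Tendsto (fun η : ℝ =>
            limsup (fun x : ℝ =>
              1 / (A x) ^ 2 * ∫ s in (1:ℝ)..(η * x),
                (A s) ^ 2 / s * (rr F h (x - s) + rr F h (x + s)))
              atTop)
          (nhdsWithin 0 (Set.Ioi 0)) (nhds 0) ∧
        ∀ c : ℝ, 0 < c →
          ¬ ((fun x : ℝ => (∑' n : ℕ, convPow F n (Set.Ioc (x - h) x)).toReal)
              ~[atTop] fun x : ℝ => c * h * (A x / x)) := by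
  obtain ⟨A, w, c, C, a, h⟩ := exists_goodA hα1 hα2
  obtain ⟨s0, L, d, hB⟩ := exists_Bl h
  refine ⟨A, toM (stp A w s0 L d), fun x hx => h.pos hx, h.cont, h.smono, h.rv,
    ⟨by rw [toM_univ, mass_stp h hB]⟩, tail_right h hB, tail_left h, ?_⟩
  intro t _ ht
  have ht1 := span_one h ht
  subst ht1
  exact ⟨condStar_holds h hB, two_fails h hB, fun c' hc' => srt_fails h hB hc'⟩
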